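/- arXiv:1705.09703 — 3 statements merged into one kernel-verified Lean document; each statement's English description precedes it below -/
import Mathlib

section
/- For every integer k ≥ 2 there is a constant c_k > 0 such that the following holds. Let A ⊂ R be a finite set with |A| ≥ 2 and M ≥ 1 a real number such that |AA| ≤ M|A| or |A/A| ≤ M|A|. Then the 2^k-fold sumset satisfies |2^k A| ≥ c_k · |A|^{1+k/2} · M^{−(3/2)(2^k−1)} · (log|A|)^{−4(k−1)}. -/
open Finset Pointwise

/-- The `m`-fold sumset `mA = {a1 + ⋯ + am : ai ∈ A}`. -/
def iterSumset {G : Type*} [AddCommMonoid G] [DecidableEq G] (m : ℕ) (A : Finset G) :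
    Finset G :=
  (Fintype.piFinset fun _ : Fin m => A).image fun f => ∑ i, f i

theorem mul_mem_iterSumset {R : Type*} [Semiring R] [DecidableEq R] {m : ℕ} {A B : Finset R}
    {c x : R} (h : ∀ b ∈ B, c * b ∈ A) (hx : x ∈ iterSumset m B) : c * x ∈ iterSumset m A := by
  simp only [iterSumset, mem_image, Fintype.mem_piFinset] at hx ⊢
  obtain ⟨f, hf, rfl⟩ := hx
  exact ⟨fun i => c * f i, fun i => h _ (hf i), (mul_sum _ _ _).symm⟩

theorem iterSumset_mono {G : Type*} [AddCommMonoid G] [DecidableEq G] {m : ℕ} {A B : Finset G}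
    (h : B ⊆ A) : iterSumset m B ⊆ iterSumset m A :=
  image_subset_image (Fintype.piFinset_subset _ _ fun _ => h)

theorem iterSumset_add_iterSumset_subset {G : Type*} [AddCommMonoid G] [DecidableEq G]
    (m n : ℕ) (A : Finset G) : iterSumset m A + iterSumset n A ⊆ iterSumset (m + n) A := by
  intro x hx
  obtain ⟨_, hy, _, hz, rfl⟩ := mem_add.1 hx
  simp only [iterSumset, mem_image, Fintype.mem_piFinset] at hy hz ⊢
  obtain ⟨f, hf, rfl⟩ := hy
  obtain ⟨g, hg, rfl⟩ := hz
  refine ⟨Fin.append f g, fun i => ?_, by simp [Fin.sum_univ_add]⟩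
  refine Fin.addCases (fun j => ?_) (fun j => ?_) i
  · simpa using hf j
  · simpa using hg j

theorem iterSumset_pos {G : Type*} [AddCommMonoid G] [PartialOrder G] [IsOrderedCancelAddMonoid G]
    [DecidableEq G] {m : ℕ} (hm : m ≠ 0) {A : Finset G} (hA : ∀ a ∈ A, 0 < a) :
    ∀ x ∈ iterSumset m A, 0 < x := by
  intro x hx
  simp only [iterSumset, mem_image, Fintype.mem_piFinset] at hx
  obtain ⟨f, hf, rfl⟩ := hx
  have : NeZero m := ⟨hm⟩
  exact sum_pos (fun i _ => hA _ (hf i)) univ_nonempty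

theorem card_le_card_iterSumset_one {G : Type*} [AddCommMonoid G] [DecidableEq G] (A : Finset G) :
    A.card ≤ (iterSumset 1 A).card := by
  refine card_le_card fun a ha => ?_
  simp only [iterSumset, mem_image, Fintype.mem_piFinset]
  exact ⟨fun _ => a, fun _ => ha, by simp⟩

/-- Sums of points on two lines through the origin lie strictly between the lines, and determine
the summands. Summing over consecutive lines gives Solymosi's bound. -/
theorem card_slopes_mul_sq_le {S : Finset ℝ} (hS : ∀ x ∈ S, 0 < x) {T : ℝ → Finset ℝ} {w : ℕ}
    (L : Finset ℝ) (hT : ∀ l ∈ L, T l ⊆ S) (hTm : ∀ l ∈ L, ∀ x ∈ T l, l * x ∈ S)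
    (hw : ∀ l ∈ L, w ≤ (T l).card) (b : ℝ) (hb : ∀ l ∈ L, l ≤ b) :
    L.card * w ^ 2 ≤
      (((S + S) ×ˢ (S + S)).filter fun p : ℝ × ℝ => p.2 < b * p.1).card + w ^ 2 := by
  induction L using Finset.induction_on_max generalizing b with
  | empty => simp
  | insert m L hm ih =>
    rw [card_insert_of_notMem (fun h => (hm m h).false)]
    rcases L.eq_empty_or_nonempty with rfl | hL
    · simp
    set l := L.max' hL with hl
    have hlL : l ∈ L := L.max'_mem hL
    have hlm : l < m := hm l hlL
    have hmb : m ≤ b := hb m (mem_insert_self _ _)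
    have ih := ih (fun i hi => hT i (mem_insert_of_mem hi)) (fun i hi => hTm i (mem_insert_of_mem hi))
      (fun i hi => hw i (mem_insert_of_mem hi)) l (fun i hi => L.le_max' i hi)
    have hpos : ∀ p ∈ (S + S) ×ˢ (S + S), 0 < p.1 := by
      intro p hp
      obtain ⟨x, hx, y, hy, h⟩ := mem_add.1 (mem_product.1 hp).1
      rw [← h]
      exact add_pos (hS x hx) (hS y hy)
    let φ : ℝ × ℝ → ℝ × ℝ := fun q => (q.1 + q.2, l * q.1 + m * q.2)
    have hφ : Function.Injective φ := by
      rintro ⟨x, y⟩ ⟨x', y'⟩ h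
      simp only [φ, Prod.mk.injEq] at h
      have h1 : (m - l) * (y - y') = 0 := by linear_combination h.2 - l * h.1
      have h2 : y = y' := by
        rcases mul_eq_zero.1 h1 with h | h <;> linarith
      subst h2
      simpa using h.1
    have hdisj : Disjoint
        (((S + S) ×ˢ (S + S)).filter fun p : ℝ × ℝ => p.2 < l * p.1)
        ((T l ×ˢ T m).image φ) := by
      rw [disjoint_left]
      intro p hp hp'
      obtain ⟨⟨x, y⟩, hxy, rfl⟩ := mem_image.1 hp'
      have hy := hS y (hT m (mem_insert_self _ _) (mem_product.1 hxy).2)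
      have := (mem_filter.1 hp).2
      simp only [φ] at this
      nlinarith
    have hsub : (((S + S) ×ˢ (S + S)).filter fun p : ℝ × ℝ => p.2 < l * p.1) ∪
        ((T l ×ˢ T m).image φ) ⊆
        ((S + S) ×ˢ (S + S)).filter fun p : ℝ × ℝ => p.2 < b * p.1 := by
      refine union_subset (fun p hp => ?_) (fun p hp => ?_)
      · rw [mem_filter] at hp ⊢
        have := hpos p hp.1
        exact ⟨hp.1, by nlinarith [hp.2]⟩
      · obtain ⟨⟨x, y⟩, hxy, rfl⟩ := mem_image.1 hp
        obtain ⟨hx, hy⟩ := mem_product.1 hxy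
        have hlI : l ∈ insert m L := mem_insert_of_mem hlL
        have hmI : m ∈ insert m L := mem_insert_self _ _
        have hx0 := hS x (hT l hlI hx)
        have hy0 := hS y (hT m hmI hy)
        refine mem_filter.2 ⟨mem_product.2 ⟨add_mem_add (hT l hlI hx) (hT m hmI hy),
          add_mem_add (hTm l hlI x hx) (hTm m hmI y hy)⟩, ?_⟩
        simp only [φ]
        nlinarith
    have hcard := card_le_card hsub
    rw [card_union_of_disjoint hdisj, card_image_of_injective _ hφ, card_product] at hcard
    have h1 : w * w ≤ (T l).card * (T m).card :=
      Nat.mul_le_mul (hw l (mem_insert_of_mem hlL)) (hw m (mem_insert_self _ _))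
    nlinarith

theorem card_slopes_mul_sq_le_two_mul {S : Finset ℝ} (hS : ∀ x ∈ S, 0 < x) {T : ℝ → Finset ℝ}
    {w : ℕ} (L : Finset ℝ) (hT : ∀ l ∈ L, T l ⊆ S) (hTm : ∀ l ∈ L, ∀ x ∈ T l, l * x ∈ S)
    (hw : ∀ l ∈ L, w ≤ (T l).card) :
    L.card * w ^ 2 ≤ 2 * (S + S).card ^ 2 := by
  rcases L.eq_empty_or_nonempty with rfl | hL
  · simp
  have h := card_slopes_mul_sq_le hS L hT hTm hw (L.max' hL) (fun i hi => L.le_max' i hi)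
  have h1 := h.trans (Nat.add_le_add_right (card_filter_le _ _) _)
  rw [card_product] at h1
  have hwS : w ≤ (S + S).card := by
    obtain ⟨l, hl⟩ := hL
    have h2 := (hw l hl).trans (card_le_card (hT l hl))
    rcases S.eq_empty_or_nonempty with rfl | hS'
    · simpa using h2
    · exact h2.trans (card_le_card_add_left hS')
  have := Nat.pow_le_pow_left hwS 2
  nlinarith

/-- From a lower bound on a second moment, extract a level set whose contribution to it is large,
without losing a logarithm. -/
theorem exists_level_of_sum_sq {ι : Type*} {s : Finset ι} {f : ι → ℕ} {N : ℕ} {K : ℝ}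
    (hN : 0 < N) (hK : 0 < K) (hf : ∀ i ∈ s, f i ≤ N) (hsum : ∑ i ∈ s, f i ≤ N ^ 2)
    (hsq : (N : ℝ) ^ 4 ≤ K * ∑ i ∈ s, (f i : ℝ) ^ 2) :
    ∃ t : ℕ, (N : ℝ) ^ 2 ≤ 2 * K * t ∧
      (N : ℝ) ^ 5 ≤ 16 * K ^ 2 * ((s.filter fun i => t ≤ f i).card * (t : ℝ) ^ 2) := by
  by_contra! hcon
  have hN' : (0 : ℝ) < N := by exact_mod_cast hN
  set t₀ : ℕ := ⌈(N : ℝ) ^ 2 / (2 * K)⌉₊ with ht₀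
  have ht₀pos : 0 < t₀ := Nat.ceil_pos.2 (by positivity)
  have ht₀' : (0 : ℝ) < t₀ := by exact_mod_cast ht₀pos
  have ht₀K : (N : ℝ) ^ 2 ≤ 2 * K * t₀ := by
    have := Nat.le_ceil ((N : ℝ) ^ 2 / (2 * K))
    rw [div_le_iff₀ (by positivity)] at this
    linarith
  have hsum' : ∑ i ∈ s, (f i : ℝ) ≤ (N : ℝ) ^ 2 := by exact_mod_cast hsum
  set r := s.filter fun i => t₀ ≤ f i with hr
  have hpt : ∀ i ∈ s, (f i : ℝ) ^ 2 ≤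
      (N : ℝ) ^ 2 / (2 * K) * f i + N * (if t₀ ≤ f i then (f i : ℝ) else 0) := by
    intro i hi
    have hfi : (f i : ℝ) ≤ N := by exact_mod_cast hf i hi
    have hfi0 : (0 : ℝ) ≤ f i := Nat.cast_nonneg _
    split_ifs with h
    · have : 0 ≤ (N : ℝ) ^ 2 / (2 * K) * f i := by positivity
      nlinarith
    · have : (f i : ℝ) < (N : ℝ) ^ 2 / (2 * K) := Nat.lt_ceil.1 (not_le.1 h)
      nlinarith
  have hrich : (N : ℝ) ^ 3 ≤ 2 * K * ∑ i ∈ r, (f i : ℝ) := by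
    have h1 := sum_le_sum hpt
    rw [sum_add_distrib, ← mul_sum, ← mul_sum, ← sum_filter] at h1
    have h2 : (N : ℝ) ^ 2 / (2 * K) * ∑ i ∈ s, (f i : ℝ) ≤ (N : ℝ) ^ 2 / (2 * K) * (N : ℝ) ^ 2 :=
      mul_le_mul_of_nonneg_left hsum' (by positivity)
    have h3 : K * ((N : ℝ) ^ 2 / (2 * K) * (N : ℝ) ^ 2) = (N : ℝ) ^ 4 / 2 := by
      field_simp
    have h4 := mul_le_mul_of_nonneg_left (h1.trans (add_le_add_left h2 _)) hK.le
    rw [mul_add, h3] at h4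
    have h5 : (N : ℝ) * (N : ℝ) ^ 3 ≤ N * (2 * K * ∑ i ∈ r, (f i : ℝ)) := by
      linarith
    exact le_of_mul_le_mul_left h5 hN'
  set X : ℝ := (N : ℝ) ^ 5 / (16 * K ^ 2) with hX
  have hXpos : 0 < X := by positivity
  have hlev : ∀ t : ℕ, t₀ ≤ t → ((s.filter fun i => t ≤ f i).card : ℝ) ≤ X * ((t : ℝ) ^ 2)⁻¹ := by
    intro t ht
    have ht' : (t₀ : ℝ) ≤ t := by exact_mod_cast ht
    have ht0 : (0 : ℝ) < t := ht₀'.trans_le ht'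
    have := hcon t (ht₀K.trans (by gcongr))
    rw [← div_eq_mul_inv, le_div_iff₀ (by positivity), hX, le_div_iff₀ (by positivity)]
    linarith
  have hlayer : ∑ i ∈ r, (f i : ℝ) ≤ 2 * X / t₀ := by
    rcases r.eq_empty_or_nonempty with he | ⟨i₀, hi₀⟩
    · rw [he, sum_empty]; positivity
    have ht₀N : t₀ ≤ N := (mem_filter.1 hi₀).2.trans (hf _ (mem_filter.1 hi₀).1)
    have h1 : ∀ i ∈ r, (f i : ℝ) ≤ t₀ + ∑ t ∈ Ioc t₀ N, if t ≤ f i then (1 : ℝ) else 0 := by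
      intro i hi
      have hi' := mem_filter.1 hi
      have h2 : (Ioc t₀ N).filter (fun t => t ≤ f i) = Ioc t₀ (f i) := by
        ext t
        have := hf i hi'.1
        simp only [mem_filter, mem_Ioc]
        omega
      rw [← sum_filter, h2, sum_const, Nat.card_Ioc, nsmul_one, Nat.cast_sub hi'.2]
      linarith
    calc ∑ i ∈ r, (f i : ℝ)
        ≤ ∑ i ∈ r, ((t₀ : ℝ) + ∑ t ∈ Ioc t₀ N, if t ≤ f i then (1 : ℝ) else 0) := sum_le_sum h1
      _ = r.card * (t₀ : ℝ) + ∑ t ∈ Ioc t₀ N, ((r.filter fun i => t ≤ f i).card : ℝ) := by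
          rw [sum_add_distrib, sum_const, nsmul_eq_mul, sum_comm]
          simp
      _ ≤ X * ((t₀ : ℝ) ^ 2)⁻¹ * t₀ + ∑ t ∈ Ioc t₀ N, X * ((t : ℝ) ^ 2)⁻¹ := by
          refine add_le_add (mul_le_mul_of_nonneg_right (hlev t₀ le_rfl) ht₀'.le)
            (sum_le_sum fun t ht => ?_)
          refine le_trans ?_ (hlev t (mem_Ioc.1 ht).1.le)
          exact_mod_cast card_le_card (filter_subset_filter _ (filter_subset _ _))
      _ ≤ X * ((t₀ : ℝ) ^ 2)⁻¹ * t₀ + X * (t₀ : ℝ)⁻¹ := by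
          rw [← mul_sum]
          have h3 := sum_Ioc_inv_sq_le_sub (α := ℝ) ht₀pos.ne' ht₀N
          have h4 : (0 : ℝ) ≤ (N : ℝ)⁻¹ := by positivity
          gcongr
          linarith
      _ = 2 * X / t₀ := by field_simp; ring
  have hfin := hrich.trans (mul_le_mul_of_nonneg_left hlayer (by positivity))
  have : 2 * K * (2 * X / t₀) = (N : ℝ) ^ 5 / (4 * K * t₀) := by
    rw [hX]; field_simp; ring
  rw [this, le_div_iff₀ (by positivity)] at hfin
  have h5 : (N : ℝ) ^ 3 * (2 * N ^ 2) ≤ N ^ 3 * (4 * K * t₀) :=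
    mul_le_mul_of_nonneg_left (by linarith) (by positivity)
  have h6 : (0 : ℝ) < N ^ 5 := by positivity
  nlinarith

theorem card_filter_div_eq {A : Finset ℝ} (hA : ∀ a ∈ A, 0 < a) (l : ℝ) :
    ((A ×ˢ A).filter fun p : ℝ × ℝ => p.2 / p.1 = l).card = (A.filter fun a => l * a ∈ A).card := by
  symm
  refine card_bij (fun a _ => (a, l * a)) (fun a ha => ?_) (fun a _ b _ h => (Prod.mk.inj h).1)
    (fun p hp => ?_)
  · obtain ⟨h1, h2⟩ := mem_filter.1 ha
    exact mem_filter.2 ⟨mem_product.2 ⟨h1, h2⟩, by simp [(hA a h1).ne']⟩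
  · obtain ⟨h1, h2⟩ := mem_filter.1 hp
    obtain ⟨h3, h4⟩ := mem_product.1 h1
    have h5 : l * p.1 = p.2 := by rw [← h2, div_mul_cancel₀ _ (hA _ h3).ne']
    exact ⟨p.1, mem_filter.2 ⟨h3, h5 ▸ h4⟩, by rw [h5]⟩

theorem sum_card_filter_mul_mem {A : Finset ℝ} (hA : ∀ a ∈ A, 0 < a) :
    ∑ l ∈ A / A, (A.filter fun a => l * a ∈ A).card = A.card ^ 2 := by
  rw [sq, ← card_product, card_eq_sum_card_fiberwise (f := fun p : ℝ × ℝ => p.2 / p.1) (t := A / A)]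
  · exact sum_congr rfl fun l _ => (card_filter_div_eq hA l).symm
  · intro p hp
    have := mem_product.1 (mem_coe.1 hp)
    exact div_mem_div this.2 this.1

theorem mulEnergy_le_sum_sq {A : Finset ℝ} (hA : ∀ a ∈ A, 0 < a) :
    mulEnergy A A ≤ ∑ l ∈ A / A, (A.filter fun a => l * a ∈ A).card ^ 2 := by
  simp only [sq, ← card_product]
  rw [← card_sigma]
  refine card_le_card_of_injOn (fun x => ⟨x.1.1 / x.1.2, (x.1.2, x.2.1)⟩) ?_ ?_
  · rintro ⟨⟨a, b⟩, ⟨c, d⟩⟩ h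
    simp only [mem_coe, mem_filter, mem_product] at h
    obtain ⟨⟨⟨ha, hb⟩, hc, hd⟩, h⟩ := h
    have hb0 := (hA b hb).ne'
    have h1 : a / b * b = a := div_mul_cancel₀ _ hb0
    have h2 : a / b * c = d := by field_simp; linarith
    simp only [mem_coe, mem_sigma, mem_product, mem_filter, h1, h2]
    exact ⟨div_mem_div ha hb, ⟨hb, ha⟩, hc, hd⟩
  · rintro ⟨⟨a, b⟩, ⟨c, d⟩⟩ h ⟨⟨a', b'⟩, ⟨c', d'⟩⟩ h' heq
    simp only [mem_coe, mem_filter, mem_product] at h h'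
    simp only [Sigma.mk.injEq, heq_eq_eq, Prod.mk.injEq] at heq
    obtain ⟨h1, rfl, rfl⟩ := heq
    have hb0 := (hA b h.1.1.2).ne'
    have ha : a = a' := by field_simp at h1; exact h1
    subst ha
    have hd : d = d' := mul_left_cancel₀ hb0 (h.2.symm.trans h'.2)
    subst hd
    rfl

theorem card_pow_four_le_mul_sum_sq {A : Finset ℝ} {K : ℝ} (hA : ∀ a ∈ A, 0 < a)
    (hK : ((A * A).card : ℝ) ≤ K ∨ ((A / A).card : ℝ) ≤ K) :
    (A.card : ℝ) ^ 4 ≤ K * ∑ l ∈ A / A, ((A.filter fun a => l * a ∈ A).card : ℝ) ^ 2 := by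
  have h0 : (0 : ℝ) ≤ ∑ l ∈ A / A, ((A.filter fun a => l * a ∈ A).card : ℝ) ^ 2 :=
    sum_nonneg fun _ _ => sq_nonneg _
  rcases hK with hK | hK
  · have h1 : A.card ^ 4 ≤
        (A * A).card * ∑ l ∈ A / A, (A.filter fun a => l * a ∈ A).card ^ 2 :=
      calc A.card ^ 4 = A.card ^ 2 * A.card ^ 2 := by ring
        _ ≤ (A * A).card * mulEnergy A A := le_card_mul_mul_mulEnergy A A
        _ ≤ _ := Nat.mul_le_mul_left _ (mulEnergy_le_sum_sq hA)
    refine le_trans ?_ (mul_le_mul_of_nonneg_right hK h0)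
    exact_mod_cast h1
  · have h1 := sq_sum_le_card_mul_sum_sq (s := A / A)
      (f := fun l => (A.filter fun a => l * a ∈ A).card)
    rw [sum_card_filter_mul_mem hA, ← pow_mul] at h1
    refine le_trans ?_ (mul_le_mul_of_nonneg_right hK h0)
    exact_mod_cast h1

/-- The exponent `3 * (2 ^ k - 1) - k` of the doubling constant, given by its recursion. -/
def doublingExponent : ℕ → ℕ
  | 0 => 0
  | k + 1 => 2 * doublingExponent k + (k + 2)

theorem doublingExponent_add (k : ℕ) : doublingExponent k + k + 3 = 3 * 2 ^ k := by
  induction k with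
  | zero => rfl
  | succ k ih => rw [doublingExponent, pow_succ]; omega

theorem exists_le_card_iterSumset_sq (k : ℕ) :
    ∃ c : ℝ, 0 < c ∧ ∀ (A : Finset ℝ) (K : ℝ), (∀ a ∈ A, 0 < a) → 0 < K →
      (((A * A).card : ℝ) ≤ K ∨ ((A / A).card : ℝ) ≤ K) →
      c * (A.card : ℝ) ^ (doublingExponent k + k + 2) ≤
        K ^ doublingExponent k * ((iterSumset (2 ^ k) A).card : ℝ) ^ 2 := by
  induction k with
  | zero =>
    refine ⟨1, one_pos, fun A K _ _ _ => ?_⟩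
    have := card_le_card_iterSumset_one A
    simp only [doublingExponent, zero_add, pow_zero, one_mul]
    gcongr
  | succ k ih =>
    obtain ⟨c, hc, ih⟩ := ih
    set q := doublingExponent k with hq
    refine ⟨c / (32 * 2 ^ (k + q)), by positivity, fun A K hA hK hAK => ?_⟩
    rcases A.eq_empty_or_nonempty with rfl | hne
    · rw [card_empty, Nat.cast_zero, zero_pow (by omega), mul_zero]
      positivity
    have hN : (0 : ℝ) < A.card := by exact_mod_cast hne.card_pos
    obtain ⟨t, ht, hLt⟩ := exists_level_of_sum_sq (s := A / A)
      (f := fun l => (A.filter fun a => l * a ∈ A).card) hne.card_pos hK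
      (fun _ _ => card_filter_le _ _) (sum_card_filter_mul_mem hA).le
      (card_pow_four_le_mul_sum_sq hA hAK)
    set L := (A / A).filter fun l => t ≤ (A.filter fun a => l * a ∈ A).card with hL
    set S := iterSumset (2 ^ k) A with hS
    set Y : ℝ := c * (t : ℝ) ^ (q + k + 2) / K ^ q with hY
    have hY0 : 0 ≤ Y := by positivity
    have hT : ∀ l ∈ L,
        ⌈√Y⌉₊ ≤ (iterSumset (2 ^ k) (A.filter fun a => l * a ∈ A)).card := by
      intro l hl
      have hsub : (A.filter fun a => l * a ∈ A) ⊆ A := filter_subset _ _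
      have h1 := ih (A.filter fun a => l * a ∈ A) K (fun a ha => hA a (hsub ha)) hK
        (hAK.imp
          (le_trans (by exact_mod_cast card_le_card (mul_subset_mul hsub hsub)))
          (le_trans (by exact_mod_cast card_le_card (div_subset_div hsub hsub))))
      have h2 : (t : ℝ) ≤ (A.filter fun a => l * a ∈ A).card := by
        exact_mod_cast (mem_filter.1 hl).2
      refine Nat.ceil_le.2 (Real.sqrt_le_iff.2 ⟨Nat.cast_nonneg _, ?_⟩)
      rw [hY, div_le_iff₀ (by positivity), mul_comm _ (K ^ q)]
      refine le_trans ?_ h1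
      gcongr
    have hsol := card_slopes_mul_sq_le_two_mul (iterSumset_pos (by positivity) hA) L
      (T := fun l => iterSumset (2 ^ k) (A.filter fun a => l * a ∈ A))
      (fun l _ => iterSumset_mono (filter_subset _ _))
      (fun l _ x hx => mul_mem_iterSumset (fun b hb => (mem_filter.1 hb).2) hx) hT
    have hZ : (S + S).card ≤ (iterSumset (2 ^ (k + 1)) A).card := by
      rw [pow_succ, mul_two]
      exact card_le_card (iterSumset_add_iterSumset_subset _ _ A)
    set Z := (iterSumset (2 ^ (k + 1)) A).card with hZdef
    have hLY : (L.card : ℝ) * Y ≤ 2 * (Z : ℝ) ^ 2 := by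
      have h1 : (L.card : ℝ) * (⌈√Y⌉₊ : ℝ) ^ 2 ≤ 2 * (Z : ℝ) ^ 2 := by
        exact_mod_cast hsol.trans (Nat.mul_le_mul_left 2 (Nat.pow_le_pow_left hZ 2))
      refine le_trans (mul_le_mul_of_nonneg_left ?_ (Nat.cast_nonneg _)) h1
      calc Y = √Y ^ 2 := (Real.sq_sqrt hY0).symm
        _ ≤ _ := pow_le_pow_left₀ (Real.sqrt_nonneg _) (Nat.le_ceil _) 2
    have hLt' : (L.card : ℝ) * (c * (t : ℝ) ^ (q + k + 2)) ≤ 2 * (Z : ℝ) ^ 2 * K ^ q := by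
      rwa [hY, ← mul_div_assoc, div_le_iff₀ (by positivity)] at hLY
    have hpow := pow_le_pow_left₀ (by positivity) ht (q + k)
    have hprod := mul_le_mul hLt hpow (by positivity) (by positivity)
    rw [div_mul_eq_mul_div, div_le_iff₀ (by positivity), doublingExponent, ← hq]
    calc c * (A.card : ℝ) ^ (2 * q + (k + 2) + (k + 1) + 2)
        = c * ((A.card : ℝ) ^ 5 * ((A.card : ℝ) ^ 2) ^ (q + k)) := by ring
      _ ≤ c * (16 * K ^ 2 * ((L.card : ℝ) * (t : ℝ) ^ 2) * (2 * K * t) ^ (q + k)) :=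
          mul_le_mul_of_nonneg_left hprod hc.le
      _ = 16 * K ^ 2 * (2 * K) ^ (q + k) * ((L.card : ℝ) * (c * (t : ℝ) ^ (q + k + 2))) := by
          rw [mul_pow]; ring
      _ ≤ 16 * K ^ 2 * (2 * K) ^ (q + k) * (2 * (Z : ℝ) ^ 2 * K ^ q) :=
          mul_le_mul_of_nonneg_left hLt' (by positivity)
      _ = K ^ (2 * q + (k + 2)) * (Z : ℝ) ^ 2 * (32 * 2 ^ (k + q)) := by
          rw [mul_pow]; ring

/-- Pass to the larger of the positive part and the reflected negative part. -/
theorem exists_pos_finset_card_le {A : Finset ℝ} (hA : 2 ≤ A.card) :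
    ∃ B : Finset ℝ, (∀ b ∈ B, 0 < b) ∧ A.card ≤ 4 * B.card ∧ B * B ⊆ A * A ∧
      B / B ⊆ A / A.erase 0 ∧
      ∀ m, (iterSumset m B).card ≤ (iterSumset m A).card := by
  have hcard : A.card ≤ (A.filter (0 < ·)).card + (A.filter (· < 0)).card + 1 := by
    have h : A ⊆ (A.filter (0 < ·) ∪ A.filter (· < 0)) ∪ {0} := by
      intro a ha
      rcases lt_trichotomy a 0 with h | h | h <;> simp [ha, h]
    refine (card_le_card h).trans ((card_union_le _ _).trans ?_)
    rw [card_singleton]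
    exact Nat.add_le_add_right (card_union_le _ _) _
  have key : ∀ (s : ℝ) (B : Finset ℝ), s * s = 1 → (∀ b ∈ B, 0 < b) → (∀ b ∈ B, s * b ∈ A) →
      B * B ⊆ A * A ∧ B / B ⊆ A / A.erase 0 ∧
      ∀ m, (iterSumset m B).card ≤ (iterSumset m A).card := by
    intro s B hs hpos hB
    have hs0 : s ≠ 0 := by rintro rfl; simp at hs
    refine ⟨fun x hx => ?_, fun x hx => ?_, fun m => ?_⟩
    · obtain ⟨b, hb, d, hd, rfl⟩ := mem_mul.1 hx
      exact mem_mul.2 ⟨_, hB b hb, _, hB d hd, by linear_combination b * d * hs⟩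
    · obtain ⟨b, hb, d, hd, rfl⟩ := mem_div.1 hx
      exact mem_div.2 ⟨_, hB b hb, _,
        mem_erase.2 ⟨mul_ne_zero hs0 (hpos d hd).ne', hB d hd⟩, mul_div_mul_left _ _ hs0⟩
    · exact card_le_card_of_injOn (s * ·) (fun x hx => mul_mem_iterSumset hB hx)
        (mul_right_injective₀ hs0).injOn
  rcases le_total (A.filter (· < 0)).card (A.filter (0 < ·)).card with h | h
  · have hpos : ∀ b ∈ A.filter (0 < ·), 0 < b := fun b hb => (mem_filter.1 hb).2
    refine ⟨A.filter (0 < ·), hpos, by omega, key 1 _ (by norm_num) hpos fun b hb => ?_⟩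
    rw [one_mul]
    exact (mem_filter.1 hb).1
  · have hmem : ∀ b ∈ -A.filter (· < 0), -b ∈ A ∧ -b < 0 := fun b hb =>
      mem_filter.1 (mem_neg'.1 hb)
    have hpos : ∀ b ∈ -A.filter (· < 0), 0 < b := fun b hb => neg_lt_zero.1 (hmem b hb).2
    refine ⟨-A.filter (· < 0), hpos, by rw [card_neg]; omega,
      key (-1) _ (by norm_num) hpos fun b hb => ?_⟩
    rw [neg_one_mul]
    exact (hmem b hb).1

/-- for every integer `k ≥ 2` there is `c_k > 0` such that for every finite
`A ⊂ ℝ` with `|A| ≥ 2` and every real `M ≥ 1` with `|AA| ≤ M|A|` or `|A/A| ≤ M|A|`,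
the `2^k`-fold sumset satisfies
`|2^k A| ≥ c_k |A|^{1+k/2} M^{−(3/2)(2^k−1)} (log|A|)^{−4(k−1)}`. -/
theorem stmt_14 :
    ∀ k : ℕ, 2 ≤ k →
      ∃ c : ℝ, 0 < c ∧
        ∀ (A : Finset ℝ) (M : ℝ), 2 ≤ A.card → 1 ≤ M →
          (((A * A).card : ℝ) ≤ M * A.card ∨ ((A / (A.erase 0)).card : ℝ) ≤ M * A.card) →
          c * (A.card : ℝ) ^ ((1 : ℝ) + (k : ℝ) / 2) *
              M ^ (-((3 : ℝ) / 2 * ((2 : ℝ) ^ k - 1))) *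
              (Real.logb 2 A.card) ^ (-(4 * ((k : ℝ) - 1))) ≤
            ((iterSumset (2 ^ k) A).card : ℝ) := by
  intro k hk
  obtain ⟨c, hc, h⟩ := exists_le_card_iterSumset_sq k
  set q := doublingExponent k with hq
  set r := q + k with hr
  have hr3 : (r : ℝ) + 3 = 3 * 2 ^ k := by exact_mod_cast doublingExponent_add k
  refine ⟨√(c / 4 ^ (q + k + 2)), by positivity, fun A M hA hM hAM => ?_⟩
  obtain ⟨B, hpos, hBA, hmul, hdiv, hsum⟩ := exists_pos_finset_card_le hA
  have hN : (2 : ℝ) ≤ A.card := by exact_mod_cast hA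
  have hN0 : (0 : ℝ) < A.card := by linarith
  have hM0 : 0 < M := by linarith
  have hB := h B (M * A.card) hpos (by positivity)
    (hAM.imp
      (le_trans (by exact_mod_cast card_le_card hmul))
      (le_trans (by exact_mod_cast card_le_card hdiv)))
  set N : ℝ := (A.card : ℝ) with hNdef
  set Z : ℝ := ((iterSumset (2 ^ k) A).card : ℝ) with hZ
  have hZ0 : 0 ≤ Z := Nat.cast_nonneg _
  have hsq : c / 4 ^ (q + k + 2) * N ^ (k + 2) ≤ M ^ r * Z ^ 2 := by
    have h1 : N / 4 ≤ B.card := by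
      have : N ≤ 4 * B.card := by rw [hNdef]; exact_mod_cast hBA
      linarith
    have h2 : ((iterSumset (2 ^ k) B).card : ℝ) ≤ Z := Nat.cast_le.2 (hsum (2 ^ k))
    have h3 : N ^ q * (c / 4 ^ (q + k + 2) * N ^ (k + 2)) ≤ N ^ q * (M ^ q * Z ^ 2) :=
      calc N ^ q * (c / 4 ^ (q + k + 2) * N ^ (k + 2))
          = c * (N / 4) ^ (q + k + 2) := by rw [div_pow]; ring
        _ ≤ c * (B.card : ℝ) ^ (q + k + 2) := by gcongr
        _ ≤ (M * N) ^ q * ((iterSumset (2 ^ k) B).card : ℝ) ^ 2 := hB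
        _ ≤ (M * N) ^ q * Z ^ 2 := by gcongr
        _ = N ^ q * (M ^ q * Z ^ 2) := by rw [mul_pow]; ring
    refine (le_of_mul_le_mul_left h3 (by positivity)).trans ?_
    gcongr
    omega
  have hlog : (Real.logb 2 N) ^ (-(4 * ((k : ℝ) - 1))) ≤ 1 := by
    refine Real.rpow_le_one_of_one_le_of_nonpos ?_ ?_
    · rw [Real.le_logb_iff_rpow_le (by norm_num) hN0]
      simpa using hN
    · have : (2 : ℝ) ≤ k := by exact_mod_cast hk
      linarith
  refine (mul_le_of_le_one_right (by positivity) hlog).trans ?_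
  refine (pow_le_pow_iff_left₀ (by positivity) hZ0 two_ne_zero).1 ?_
  have hX : (N ^ ((1 : ℝ) + (k : ℝ) / 2)) ^ 2 = N ^ (k + 2) := by
    rw [← Real.rpow_natCast, ← Real.rpow_mul hN0.le, ← Real.rpow_natCast]
    congr 1
    push_cast
    ring
  have hY : (M ^ (-((3 : ℝ) / 2 * ((2 : ℝ) ^ k - 1)))) ^ 2 = (M ^ r)⁻¹ := by
    rw [← Real.rpow_natCast, ← Real.rpow_mul hM0.le, ← Real.rpow_natCast M r,
      ← Real.rpow_neg hM0.le]
    congr 1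
    push_cast
    linarith
  rw [mul_pow, mul_pow, hX, hY, Real.sq_sqrt (by positivity), ← div_eq_mul_inv,
    div_le_iff₀ (by positivity), mul_comm (Z ^ 2)]
  exact hsq
end

section
/- There is an absolute constant C ≥ 1 such that the following holds. Let p be an odd prime, Γ, Q1, Q2 ⊆ F_p nonempty sets with Γ ≠ {0}, let M_* ≥ 1 and M ≥ 1 be reals, and let k ≥ 0 be an integer such that for j = 1, 2: |Q_jΓ^{k+2}| · |Q_jΓ^{k+1}| · |Γ| ≤ p², |Q_jΓ^k| · |Γ| ≤ p, |Q_jΓ| ≤ M_*|Q_j|, |Q_jΓ^{k+2}| ≤ M|Q_j|, and |Γ|^{k/8 + 1/2} ≥ |Q_j| · M_* · M^{2^k+1} · 2^{3k+1} · C^{(k+4)/4} · (log|Q_jΓ^k|)^k. Then for every x ∈ F_p with x ≠ 0, |Q1 ∩ (Q2 + x)| ≤ 2 M_* M · √(|Q1||Q2|) · |Γ|^{−2^{−k}/2}. -/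
open Finset Pointwise

section Counting

variable {ι κ ε : Type*} [DecidableEq ι] [DecidableEq κ]

/-- Summing the reciprocals of the fibre sizes of a map counts at most the points of its target. -/
theorem sum_inv_card_fiber_le (E : Finset ε) (X : Finset ι) (l : ε → ι) (hl : ∀ e ∈ E, l e ∈ X) :
    ∑ e ∈ E, ((#{e' ∈ E | l e' = l e} : ℝ))⁻¹ ≤ #X := by
  rw [← Finset.sum_fiberwise_of_maps_to hl]
  calc ∑ x ∈ X, ∑ e ∈ E with l e = x, ((#{e' ∈ E | l e' = l e} : ℝ))⁻¹
      ≤ ∑ x ∈ X, (1 : ℝ) := by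
        refine Finset.sum_le_sum fun x _ => ?_
        have : ∑ e ∈ E with l e = x, ((#{e' ∈ E | l e' = l e} : ℝ))⁻¹
            = ∑ e ∈ E with l e = x, ((#{e' ∈ E | l e' = x} : ℝ))⁻¹ := by
          refine Finset.sum_congr rfl fun e he => ?_
          rw [(Finset.mem_filter.1 he).2]
        rw [this, Finset.sum_const, nsmul_eq_mul]
        exact mul_inv_le_one
    _ = #X := by simp

/-- The number of three-edge paths in a bipartite multigraph is at least its average value. -/
theorem card_pow_three_le (E : Finset ε) (X : Finset ι) (Y : Finset κ) (l : ε → ι) (r : ε → κ)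
    (hl : ∀ e ∈ E, l e ∈ X) (hr : ∀ e ∈ E, r e ∈ Y) :
    (#E : ℝ) ^ 3 ≤ #X * #Y *
      ∑ e ∈ E, (#{e' ∈ E | l e' = l e} : ℝ) * #{e' ∈ E | r e' = r e} := by
  rcases E.eq_empty_or_nonempty with rfl | ⟨e₀, he₀⟩
  · simp
  have hE : (0 : ℝ) < #E := by exact_mod_cast Finset.card_pos.2 ⟨e₀, he₀⟩
  have hX : (0 : ℝ) < #X := by exact_mod_cast Finset.card_pos.2 ⟨_, hl _ he₀⟩
  have hY : (0 : ℝ) < #Y := by exact_mod_cast Finset.card_pos.2 ⟨_, hr _ he₀⟩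
  have key : ∀ e ∈ E, (3 : ℝ) ≤
      #X * #Y / (#E : ℝ) ^ 2 * ((#{e' ∈ E | l e' = l e} : ℝ) * #{e' ∈ E | r e' = r e})
      + #E / #X * ((#{e' ∈ E | l e' = l e} : ℝ))⁻¹
      + #E / #Y * ((#{e' ∈ E | r e' = r e} : ℝ))⁻¹ := by
    intro e he
    have h1 : (0 : ℝ) < #{e' ∈ E | l e' = l e} := by
      exact_mod_cast Finset.card_pos.2 ⟨e, by simp [he]⟩
    have h2 : (0 : ℝ) < #{e' ∈ E | r e' = r e} := by
      exact_mod_cast Finset.card_pos.2 ⟨e, by simp [he]⟩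
    generalize (#{e' ∈ E | l e' = l e} : ℝ) = d at *
    generalize (#{e' ∈ E | r e' = r e} : ℝ) = d' at *
    have hu : 0 < #X / (#E : ℝ) * d := by positivity
    have hv : 0 < #Y / (#E : ℝ) * d' := by positivity
    have : ∀ u v : ℝ, 0 < u → 0 < v → 3 ≤ u * v + u⁻¹ + v⁻¹ := by
      intro u v hu hv
      have hx : 0 < √(u * v) := Real.sqrt_pos.2 (mul_pos hu hv)
      have hxx : √(u * v) ^ 2 = u * v := Real.sq_sqrt (mul_pos hu hv).le
      generalize √(u * v) = x at hx hxx
      have h2 : 2 * x ≤ u + v := by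
        refine abs_le_of_sq_le_sq' ?_ (by positivity) |>.2
        nlinarith [sq_nonneg (u - v)]
      have h3 : u * v + u⁻¹ + v⁻¹ - 3 = ((u * v) ^ 2 + (u + v) - 3 * (u * v)) / (u * v) := by
        field_simp; ring
      have h4 : 0 ≤ ((u * v) ^ 2 + (u + v) - 3 * (u * v)) / (u * v) := by
        refine div_nonneg ?_ (by positivity)
        rw [← hxx]
        nlinarith [mul_nonneg (mul_nonneg hx.le (sq_nonneg (x - 1))) (by linarith : 0 ≤ x + 2)]
      linarith
    convert this _ _ hu hv using 2 <;> field_simp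
  have h := Finset.sum_le_sum key
  rw [Finset.sum_add_distrib, Finset.sum_add_distrib, ← Finset.mul_sum, ← Finset.mul_sum,
    ← Finset.mul_sum, Finset.sum_const, nsmul_eq_mul] at h
  have hl' := mul_le_mul_of_nonneg_left (sum_inv_card_fiber_le E X l hl)
    (show (0 : ℝ) ≤ #E / #X by positivity)
  have hr' := mul_le_mul_of_nonneg_left (sum_inv_card_fiber_le E Y r hr)
    (show (0 : ℝ) ≤ #E / #Y by positivity)
  rw [div_mul_cancel₀ _ hX.ne'] at hl'
  rw [div_mul_cancel₀ _ hY.ne'] at hr'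
  have h3 : (#E : ℝ) ≤ #X * #Y / (#E : ℝ) ^ 2 *
      ∑ e ∈ E, (#{e' ∈ E | l e' = l e} : ℝ) * #{e' ∈ E | r e' = r e} := by linarith
  rw [div_mul_eq_mul_div, le_div_iff₀ (by positivity)] at h3
  linarith [h3, pow_succ (#E : ℝ) 2]

/-- A dense weighted bipartite graph contains a nonempty subgraph of large minimum degree. -/
theorem exists_min_degree_subgraph (f : ι → κ → ℝ) {d : ℝ} (hd : 0 < d) :
    ∀ (n : ℕ) (X : Finset ι) (Y : Finset κ), #X + #Y = n → 0 < n →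
      d * n ≤ ∑ x ∈ X, ∑ y ∈ Y, f x y →
      ∃ X' ⊆ X, ∃ Y' ⊆ Y, X'.Nonempty ∧ Y'.Nonempty ∧
        (∀ x ∈ X', d ≤ ∑ y ∈ Y', f x y) ∧ ∀ y ∈ Y', d ≤ ∑ x ∈ X', f x y := by
  intro n
  induction n with
  | zero => intro X Y _ h; omega
  | succ n ih =>
    intro X Y hn _ hsum
    have hpos : 0 < ∑ x ∈ X, ∑ y ∈ Y, f x y := lt_of_lt_of_le (by positivity) hsum
    have hX : X.Nonempty := by
      rw [Finset.nonempty_iff_ne_empty]; rintro rfl; simp at hpos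
    have hY : Y.Nonempty := by
      rw [Finset.nonempty_iff_ne_empty]; rintro rfl; simp at hpos
    have hXc := hX.card_pos
    have hYc := hY.card_pos
    push_cast at hsum
    by_cases h1 : ∃ x ∈ X, ∑ y ∈ Y, f x y < d
    · obtain ⟨x, hx, hlt⟩ := h1
      have := Finset.add_sum_erase X (fun x => ∑ y ∈ Y, f x y) hx
      obtain ⟨X', hX', Y', hY', h⟩ := ih (X.erase x) Y
        (by rw [Finset.card_erase_of_mem hx]; omega) (by omega) (by linarith)
      exact ⟨X', hX'.trans (Finset.erase_subset _ _), Y', hY', h⟩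
    by_cases h2 : ∃ y ∈ Y, ∑ x ∈ X, f x y < d
    · obtain ⟨y, hy, hlt⟩ := h2
      have := Finset.add_sum_erase Y (fun y => ∑ x ∈ X, f x y) hy
      rw [Finset.sum_comm] at hsum
      obtain ⟨X', hX', Y', hY', h⟩ := ih X (Y.erase y)
        (by rw [Finset.card_erase_of_mem hy]; omega) (by omega)
        (by rw [Finset.sum_comm]; linarith)
      exact ⟨X', hX', Y', hY'.trans (Finset.erase_subset _ _), h⟩
    push Not at h1 h2
    exact ⟨X, Subset.rfl, Y, Subset.rfl, hX, hY, h1, h2⟩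

/-- Among many large subsets of a finite set, two distinct ones have a large intersection. -/
theorem exists_large_inter (T : Finset ι) (S : ι → Finset κ) (U : Finset κ) {h D c : ℝ}
    (hT : T.Nonempty) (hU : U.Nonempty) (hSU : ∀ t ∈ T, S t ⊆ U) (h0 : 0 ≤ h) (hc : 0 < c)
    (hS : ∀ t ∈ T, h ≤ #(S t)) (hD : ∀ t ∈ T, (#(S t) : ℝ) ≤ D)
    (hbig : #U * (#T * D + (#T : ℝ) ^ 2 * c) ≤ (#T * h) ^ 2) :
    ∃ t ∈ T, ∃ t' ∈ T, t ≠ t' ∧ c ≤ #(S t ∩ S t') := by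
  by_contra! hcon
  have hTc : (0 : ℝ) < #T := by exact_mod_cast hT.card_pos
  have hUc : (0 : ℝ) < #U := by exact_mod_cast hU.card_pos
  have hcard : ∀ A ⊆ U, (#A : ℝ) = ∑ u ∈ U, if u ∈ A then (1 : ℝ) else 0 := by
    intro A hA
    rw [Finset.sum_ite_mem, Finset.inter_eq_right.2 hA]; simp
  have h1 : #T * h ≤ ∑ u ∈ U, ∑ t ∈ T, if u ∈ S t then (1 : ℝ) else 0 := by
    rw [Finset.sum_comm, ← nsmul_eq_mul]
    refine Finset.card_nsmul_le_sum _ _ _ fun t ht => ?_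
    rw [← hcard _ (hSU t ht)]; exact hS t ht
  have h2 : ∑ u ∈ U, (∑ t ∈ T, if u ∈ S t then (1 : ℝ) else 0) ^ 2
      = ∑ t ∈ T, ∑ t' ∈ T, (#(S t ∩ S t') : ℝ) := by
    simp_rw [sq, Finset.sum_mul_sum]
    rw [Finset.sum_comm]
    refine Finset.sum_congr rfl fun t ht => ?_
    rw [Finset.sum_comm]
    refine Finset.sum_congr rfl fun t' _ => ?_
    rw [hcard _ (Finset.inter_subset_left.trans (hSU t ht))]
    refine Finset.sum_congr rfl fun u _ => ?_
    by_cases h : u ∈ S t <;> by_cases h' : u ∈ S t' <;> simp [h, h']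
  have h3 := sq_sum_le_card_mul_sum_sq (s := U)
    (f := fun u => ∑ t ∈ T, if u ∈ S t then (1 : ℝ) else 0)
  rw [h2] at h3
  have h4 : ∑ t ∈ T, ∑ t' ∈ T, (#(S t ∩ S t') : ℝ) < #T * D + (#T : ℝ) ^ 2 * c := by
    calc ∑ t ∈ T, ∑ t' ∈ T, (#(S t ∩ S t') : ℝ)
        ≤ ∑ t ∈ T, ∑ t' ∈ T, ((if t = t' then D - c else 0) + c) := by
          refine Finset.sum_le_sum fun t ht => Finset.sum_le_sum fun t' ht' => ?_
          split_ifs with h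
          · subst h; simpa using hD t ht
          · simpa using (hcon t ht t' ht' h).le
      _ = #T * (D - c) + (#T : ℝ) ^ 2 * c := by
          simp only [Finset.sum_add_distrib, Finset.sum_const, nsmul_eq_mul, Finset.sum_ite_eq]
          rw [Finset.sum_congr rfl (g := fun _ => D - c) (fun t ht => by simp [ht])]
          simp; ring
      _ < _ := by nlinarith
  have h5 : (#T * h) ^ 2 ≤ (∑ u ∈ U, ∑ t ∈ T, if u ∈ S t then (1 : ℝ) else 0) ^ 2 :=
    pow_le_pow_left₀ (by positivity) h1 2
  have h6 := mul_lt_mul_of_pos_left h4 hUc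
  linarith

end Counting

/-- Cauchy-Schwarz for the image of a map in terms of its collisions. -/
theorem card_sq_le_card_image_mul_collisions {ι κ : Type*} [DecidableEq κ] (T : Finset ι)
    (f : ι → κ) :
    #T ^ 2 ≤ #(T.image f) * #{x ∈ T ×ˢ T | f x.1 = f x.2} := by
  have h1 : #T = ∑ c ∈ T.image f, #{t ∈ T | f t = c} :=
    Finset.card_eq_sum_card_image f T
  have h2 : #{x ∈ T ×ˢ T | f x.1 = f x.2} = ∑ c ∈ T.image f, #{t ∈ T | f t = c} ^ 2 := by
    rw [Finset.card_eq_sum_card_fiberwise (f := fun x => f x.1) (t := T.image f)]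
    · refine Finset.sum_congr rfl fun c _ => ?_
      rw [sq, ← Finset.card_product]
      congr 1
      ext ⟨x, y⟩
      simp only [Finset.mem_filter, Finset.mem_product]
      constructor
      · rintro ⟨⟨⟨a, b⟩, c⟩, d⟩; exact ⟨⟨a, d⟩, b, c ▸ d⟩
      · rintro ⟨⟨a, d⟩, b, c⟩; exact ⟨⟨⟨a, b⟩, d.trans c.symm⟩, d⟩
    · intro x hx
      simp only [Finset.coe_filter, Finset.mem_product, Set.mem_ofPred_eq] at hx
      exact Finset.mem_coe.2 (Finset.mem_image_of_mem _ hx.1.1)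
  rw [h2]
  conv_lhs => rw [h1]
  exact sq_sum_le_card_mul_sum_sq

section Step

variable {F : Type*} [Field F]

/-- The bilinear form which records the difference of the end points of a three-edge path. -/
def pathForm (β β' η : F) (θ ω : F × F) : F :=
  β * ω.1 * θ.2 + β' * θ.1 * ω.2 - η * θ.2 * ω.2

theorem pathForm_swap (β β' η : F) (θ ω : F × F) :
    pathForm β β' η θ ω = pathForm β' β η ω θ := by
  simp only [pathForm]; ring

variable [DecidableEq F]

/-- The number of `u ∈ R₁` with `u - y ∈ R₂`. -/
def shiftCount (R₁ R₂ : Finset F) (y : F) : ℕ := #{u ∈ R₁ | u - y ∈ R₂}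

theorem shiftCount_le_left (R₁ R₂ : Finset F) (y : F) : shiftCount R₁ R₂ y ≤ #R₁ :=
  Finset.card_filter_le _ _

theorem shiftCount_le_right (R₁ R₂ : Finset F) (y : F) : shiftCount R₁ R₂ y ≤ #R₂ :=
  Finset.card_le_card_of_injOn (fun u => u - y) (fun _ hu => (Finset.mem_filter.1 hu).2)
    fun _ _ _ _ h => sub_left_injective h

theorem sum_shiftCount_le (R₁ R₂ V : Finset F) :
    ∑ v ∈ V, shiftCount R₁ R₂ v ≤ #R₁ * #R₂ := by
  have h : ∑ v ∈ V, shiftCount R₁ R₂ v = #{x ∈ V ×ˢ R₁ | x.2 - x.1 ∈ R₂} := by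
    simp only [shiftCount, Finset.card_filter, Finset.sum_product]
  rw [h, ← Finset.card_product]
  refine Finset.card_le_card_of_injOn (fun x => (x.2, x.2 - x.1)) ?_ ?_
  · intro x hx
    have hx := Finset.mem_filter.1 hx
    exact Finset.mem_coe.2 (Finset.mem_product.2 ⟨(Finset.mem_product.1 hx.1).2, hx.2⟩)
  · rintro ⟨a, b⟩ _ ⟨c, d⟩ _ h
    simp only [Prod.mk.injEq] at h ⊢
    obtain ⟨rfl, h⟩ := h
    exact ⟨sub_right_injective h, rfl⟩

theorem exists_sum_shiftCount_pathForm_ge (R₁ R₂ A B : Finset F) {c : ℝ} (hc : 0 ≤ c)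
    (hB : B.Nonempty) (hN : ∀ a ∈ A, ∀ b ∈ B, ∀ b' ∈ B, c ≤ shiftCount R₁ R₂ (a * b * b')) :
    ∃ β ∈ B, ∃ β' ∈ B, (#A : ℝ) ^ 3 * #B ^ 2 * c ^ 3 ≤ #R₁ * #R₂ *
      ∑ η ∈ A, ∑ θ ∈ A ×ˢ B, ∑ ω ∈ A ×ˢ B,
        (shiftCount R₁ R₂ (pathForm β β' η θ ω) : ℝ) := by
  let E : Finset (F × F × F × F) :=
    {e ∈ A ×ˢ B ×ˢ B ×ˢ R₁ | e.2.2.2 - e.1 * e.2.1 * e.2.2.1 ∈ R₂}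
  let l : F × F × F × F → F × F := fun e => (e.2.2.2, e.2.2.1)
  let r : F × F × F × F → F × F := fun e => (e.2.2.2 - e.1 * e.2.1 * e.2.2.1, e.2.1)
  have hEmem : ∀ e ∈ E, e.1 ∈ A ∧ e.2.1 ∈ B ∧ e.2.2.1 ∈ B ∧ e.2.2.2 ∈ R₁ ∧
      e.2.2.2 - e.1 * e.2.1 * e.2.2.1 ∈ R₂ := by
    intro e he
    simpa [E, and_assoc] using he
  have hE : (#A : ℝ) * #B ^ 2 * c ≤ #E := by
    have : (#E : ℝ) = ∑ a ∈ A, ∑ b ∈ B, ∑ b' ∈ B, (shiftCount R₁ R₂ (a * b * b') : ℝ) := by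
      simp only [E, shiftCount, Finset.card_filter, Finset.sum_product, Nat.cast_sum]
    rw [this]
    calc (#A : ℝ) * #B ^ 2 * c = ∑ a ∈ A, ∑ b ∈ B, ∑ b' ∈ B, c := by
          simp only [Finset.sum_const, nsmul_eq_mul]; ring
      _ ≤ _ := Finset.sum_le_sum fun a ha => Finset.sum_le_sum fun b hb =>
          Finset.sum_le_sum fun b' hb' => hN a ha b hb b' hb'
  have h3 := card_pow_three_le E (R₁ ×ˢ B) (R₂ ×ˢ B) l r
    (fun e he => by have := hEmem e he; simp [l, this]; )
    (fun e he => by have := hEmem e he; simp [r, this])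
  let S : F → F → ℝ := fun β β' => ∑ η ∈ A, ∑ θ ∈ A ×ˢ B, ∑ ω ∈ A ×ˢ B,
        (shiftCount R₁ R₂ (pathForm β β' η θ ω) : ℝ)
  have hpaths : ∑ e ∈ E, (#{e' ∈ E | l e' = l e} : ℝ) * #{e' ∈ E | r e' = r e}
      ≤ ∑ x ∈ B ×ˢ B, S x.1 x.2 := by
    have h1 : ∑ e ∈ E, (#{e' ∈ E | l e' = l e} : ℝ) * #{e' ∈ E | r e' = r e}
        = #(E.sigma fun e => {e' ∈ E | l e' = l e} ×ˢ {e' ∈ E | r e' = r e}) := by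
      rw [Finset.card_sigma]
      push_cast
      simp only [Finset.card_product, Nat.cast_mul]
    have h2 : ∑ x ∈ B ×ˢ B, S x.1 x.2 =
        #{x ∈ B ×ˢ B ×ˢ A ×ˢ (A ×ˢ B) ×ˢ (A ×ˢ B) ×ˢ R₁ |
          x.2.2.2.2.2 - pathForm x.1 x.2.1 x.2.2.1 x.2.2.2.1 x.2.2.2.2.1 ∈ R₂} := by
      simp only [S, shiftCount, Finset.card_filter, Finset.sum_product, Nat.cast_sum]
    rw [h1, h2]
    norm_cast
    refine Finset.card_le_card_of_injOn (fun x => (x.2.2.2.2.1, x.2.1.2.1, x.1.1,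
      (x.2.1.1, x.1.2.1), (x.2.2.1, x.1.2.2.1), x.2.2.2.2.2)) ?_ ?_
    · rintro ⟨e, e1, e2⟩ hx
      simp only [Finset.coe_sigma, Set.mem_sigma_iff, Finset.mem_coe, Finset.mem_product,
        Finset.mem_filter, l, r, Prod.mk.injEq] at hx
      obtain ⟨he, ⟨he1, hu, hb⟩, he2, hu2, hb2⟩ := hx
      have he := hEmem _ he
      have he1 := hEmem _ he1
      have he2 := hEmem _ he2
      simp only [Finset.mem_coe, Finset.mem_filter, Finset.mem_product, he, he1, he2, true_and]
      have := he1.2.2.2.2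
      convert this using 1
      rw [hb, hu]
      rw [hb2] at hu2
      simp only [pathForm]
      linear_combination hu2
    · rintro ⟨e, e1, e2⟩ hx ⟨f, f1, f2⟩ hy h
      simp only [Finset.coe_sigma, Set.mem_sigma_iff, Finset.mem_coe, Finset.mem_product,
        Finset.mem_filter, l, r, Prod.mk.injEq] at hx hy h
      obtain ⟨he, ⟨he1, hu, hb⟩, he2, hu2, hb2⟩ := hx
      obtain ⟨hf, ⟨hf1, hv, hd⟩, hf2, hv2, hd2⟩ := hy
      obtain ⟨a, b, c, d⟩ := e
      obtain ⟨a1, b1, c1, d1⟩ := e1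
      obtain ⟨a2, b2, c2, d2⟩ := e2
      obtain ⟨a', b', c', d'⟩ := f
      obtain ⟨a1', b1', c1', d1'⟩ := f1
      obtain ⟨a2', b2', c2', d2'⟩ := f2
      simp only at *
      obtain ⟨rfl, rfl, rfl, ⟨rfl, rfl⟩, ⟨rfl, rfl⟩, rfl⟩ := h
      subst hu hb hb2 hv hd hd2
      have : d1 = d1' := by linear_combination hv2 - hu2
      subst this
      rfl
  obtain ⟨x, hx, hmax⟩ := Finset.exists_max_image (B ×ˢ B) (fun x => S x.1 x.2)
    (hB.product hB)
  have hBc : (0 : ℝ) < #B := by exact_mod_cast hB.card_pos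
  refine ⟨x.1, (Finset.mem_product.1 hx).1, x.2, (Finset.mem_product.1 hx).2, ?_⟩
  have h4 : ∑ y ∈ B ×ˢ B, S y.1 y.2 ≤ #B * #B * S x.1 x.2 := by
    have := Finset.sum_le_card_nsmul (B ×ˢ B) (fun x => S x.1 x.2) _ hmax
    simpa [Finset.card_product] using this
  have h5 : ((#A : ℝ) * #B ^ 2 * c) ^ 3 ≤ (#E : ℝ) ^ 3 := pow_le_pow_left₀ (by positivity) hE 3
  have h6 := mul_le_mul_of_nonneg_left (hpaths.trans h4)
    (show (0 : ℝ) ≤ #(R₁ ×ˢ B) * #(R₂ ×ˢ B) by positivity)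
  have h7 := (h5.trans h3).trans h6
  simp only [Finset.card_product, Nat.cast_mul] at h7
  change (#A : ℝ) ^ 3 * #B ^ 2 * c ^ 3 ≤ #R₁ * #R₂ * S x.1 x.2
  refine le_of_mul_le_mul_left ?_ (pow_pos hBc 4)
  linear_combination h7

/-- Among many functions with large correlations against most shifts, two distinct ones differ by
a popular difference of `R₂` at many points. -/
theorem exists_popular_difference {ι κ : Type*} [DecidableEq ι] [DecidableEq κ]
    (R₁ R₂ : Finset F) (G : ι → κ → F) (T : Finset ι) (Y : Finset κ) {m₁ m₂ s n h q : ℝ}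
    (hm₁ : #R₁ ≤ m₁) (hm₂ : #R₂ ≤ m₂) (hm₂0 : 0 < m₂) (hs : 0 < s) (hsm : s ^ 2 = m₁ * m₂)
    (hn : 0 < n) (hY : #Y ≤ n) (hh : 0 < h) (hq : 0 < q) (hqh : 2 * q * n ^ 2 ≤ h ^ 2)
    (hT : 1 ≤ q * #T)
    (hG : ∀ t ∈ T, s * h ≤ ∑ w ∈ Y, (shiftCount R₁ R₂ (G t w) : ℝ)) :
    ∃ t ∈ T, ∃ t' ∈ T, t ≠ t' ∧
      q * n / 2 ≤ #{w ∈ Y | q * m₂ / 2 ≤ (shiftCount R₂ R₂ (G t' w - G t w) : ℝ)} := by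
  let S : ι → Finset (κ × F) := fun t => {x ∈ Y ×ˢ R₁ | x.2 - G t x.1 ∈ R₂}
  have hScard : ∀ t, (#(S t) : ℝ) = ∑ w ∈ Y, (shiftCount R₁ R₂ (G t w) : ℝ) := by
    intro t
    simp only [S, shiftCount, Finset.card_filter, Finset.sum_product, Nat.cast_sum]
  have hTc : (0 : ℝ) < #T := by
    by_contra hcon
    have : (#T : ℝ) = 0 := le_antisymm (not_lt.1 hcon) (Nat.cast_nonneg _)
    rw [this] at hT; linarith
  have hTne : T.Nonempty := Finset.card_pos.1 (by exact_mod_cast hTc)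
  have hUcard : (#(Y ×ˢ R₁) : ℝ) ≤ n * m₁ := by
    rw [Finset.card_product]; push_cast
    exact mul_le_mul hY hm₁ (Nat.cast_nonneg _) hn.le
  have hUne : (Y ×ˢ R₁).Nonempty := by
    obtain ⟨t, ht⟩ := hTne
    have h1 : (0 : ℝ) < #(S t) := by
      rw [hScard]; exact lt_of_lt_of_le (mul_pos hs hh) (hG t ht)
    exact (Finset.card_pos.1 (by exact_mod_cast h1 : 0 < #(S t))).mono (Finset.filter_subset _ _)
  obtain ⟨t, ht, t', ht', hne, hlarge⟩ := exists_large_inter T S (Y ×ˢ R₁) (h := s * h)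
    (D := n * m₂) (c := q * n * m₂) hTne hUne (fun t _ => Finset.filter_subset _ _)
    (by positivity) (by positivity) (fun t ht => by rw [hScard]; exact hG t ht)
    (fun t _ => by
      rw [hScard]
      calc ∑ w ∈ Y, (shiftCount R₁ R₂ (G t w) : ℝ) ≤ ∑ w ∈ Y, m₂ :=
            Finset.sum_le_sum fun w _ =>
              (Nat.cast_le.2 (shiftCount_le_right R₁ R₂ _)).trans hm₂
        _ = #Y * m₂ := by simp
        _ ≤ n * m₂ := mul_le_mul_of_nonneg_right hY hm₂0.le)
    (by
      calc #(Y ×ˢ R₁) * (#T * (n * m₂) + (#T : ℝ) ^ 2 * (q * n * m₂))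
          ≤ n * m₁ * (#T * (n * m₂) + (#T : ℝ) ^ 2 * (q * n * m₂)) :=
            mul_le_mul_of_nonneg_right hUcard (by positivity)
        _ = n ^ 2 * s ^ 2 * #T * (1 + #T * q) := by rw [hsm]; ring
        _ ≤ n ^ 2 * s ^ 2 * #T * (2 * (q * #T)) :=
            mul_le_mul_of_nonneg_left (by linarith) (by positivity)
        _ = (2 * q * n ^ 2) * (s ^ 2 * (#T : ℝ) ^ 2) := by ring
        _ ≤ h ^ 2 * (s ^ 2 * (#T : ℝ) ^ 2) := mul_le_mul_of_nonneg_right hqh (by positivity)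
        _ = _ := by ring)
  refine ⟨t, ht, t', ht', hne, ?_⟩
  have h1 : (#(S t ∩ S t') : ℝ) ≤ ∑ w ∈ Y, (shiftCount R₂ R₂ (G t' w - G t w) : ℝ) := by
    have : ∑ w ∈ Y, shiftCount R₂ R₂ (G t' w - G t w)
        = #{x ∈ Y ×ˢ R₂ | x.2 - (G t' x.1 - G t x.1) ∈ R₂} := by
      simp only [shiftCount, Finset.card_filter, Finset.sum_product]
    rw [← Nat.cast_sum, this]
    refine Nat.cast_le.2 (Finset.card_le_card_of_injOn (fun x => (x.1, x.2 - G t x.1)) ?_ ?_)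
    · intro x hx
      simp only [S, Finset.coe_inter, Set.mem_inter_iff, Finset.mem_coe, Finset.mem_filter,
        Finset.mem_product] at hx ⊢
      refine ⟨⟨hx.1.1.1, hx.1.2⟩, ?_⟩
      convert hx.2.2 using 1
      ring
    · rintro ⟨a, b⟩ _ ⟨c, d⟩ _ h
      simp only [Prod.mk.injEq] at h ⊢
      obtain ⟨rfl, h⟩ := h
      exact ⟨rfl, sub_left_injective h⟩
  have h2 : ∑ w ∈ Y, (shiftCount R₂ R₂ (G t' w - G t w) : ℝ) ≤
      #{w ∈ Y | q * m₂ / 2 ≤ (shiftCount R₂ R₂ (G t' w - G t w) : ℝ)} * m₂ +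
        n * (q * m₂ / 2) := by
    rw [← Finset.sum_filter_add_sum_filter_not Y
      (fun w => q * m₂ / 2 ≤ (shiftCount R₂ R₂ (G t' w - G t w) : ℝ))]
    refine add_le_add ?_ ?_
    · rw [← nsmul_eq_mul]
      exact Finset.sum_le_card_nsmul _ _ _ fun w _ =>
        (Nat.cast_le.2 (shiftCount_le_right R₂ R₂ _)).trans hm₂
    · refine (Finset.sum_le_card_nsmul _ _ (q * m₂ / 2) fun w hw =>
        (not_le.1 (Finset.mem_filter.1 hw).2).le).trans ?_
      rw [nsmul_eq_mul]
      refine mul_le_mul_of_nonneg_right (le_trans ?_ hY) (by positivity)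
      exact_mod_cast Finset.card_filter_le _ _
  refine le_of_mul_le_mul_right ?_ hm₂0
  linarith [hlarge.trans (h1.trans h2)]

/-- Two points of `X` on a common line of slope `ξ` produce popular differences of `R₂` which are
dilates of the values on `Y` of a linear form of the dual slope. -/
theorem exists_popular_dilate (R₁ R₂ : Finset F) (X Y : Finset (F × F)) {β β' η ξ z : F}
    {m₁ m₂ s n h q : ℝ} (hβ : β ≠ 0)
    (hm₁ : #R₁ ≤ m₁) (hm₂ : #R₂ ≤ m₂) (hm₂0 : 0 < m₂) (hs : 0 < s) (hsm : s ^ 2 = m₁ * m₂)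
    (hn : 0 < n) (hY : #Y ≤ n) (hh : 0 < h) (hq : 0 < q) (hqh : 2 * q * n ^ 2 ≤ h ^ 2)
    (hT : 1 ≤ q * #{θ ∈ X | θ.1 + ξ * θ.2 = z})
    (hG : ∀ θ ∈ X, s * h ≤ ∑ ω ∈ Y, (shiftCount R₁ R₂ (pathForm β β' η θ ω) : ℝ)) :
    ∃ t ≠ (0 : F), ∃ W ⊆ Y, q * n / 2 ≤ #W ∧ ∀ ω ∈ W,
      q * m₂ / 2 ≤ shiftCount R₂ R₂ (t * (ω.1 + -(β' * ξ + η) / β * ω.2)) := by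
  obtain ⟨θ, hθ, θ', hθ', hne, hbig⟩ := exists_popular_difference R₁ R₂ (pathForm β β' η) _ Y
    hm₁ hm₂ hm₂0 hs hsm hn hY hh hq hqh hT (fun θ hθ => hG θ (Finset.mem_filter.1 hθ).1)
  have e1 := (Finset.mem_filter.1 hθ).2
  have e2 := (Finset.mem_filter.1 hθ').2
  refine ⟨(θ'.2 - θ.2) * β, mul_ne_zero ?_ hβ, _, Finset.filter_subset _ _, hbig, ?_⟩
  · intro h0
    have h2 : θ.2 = θ'.2 := (sub_eq_zero.1 h0).symm
    refine hne (Prod.ext ?_ h2)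
    rw [h2] at e1
    linear_combination e1 - e2
  · intro ω hω
    convert (Finset.mem_filter.1 hω).2 using 3
    simp only [pathForm]
    field_simp
    linear_combination (-β' * ω.2) * (e2 - e1)

/-- Cauchy-Schwarz for two distinct members of a dense family of weights. -/
theorem exists_correlated_pair {α π : Type*} [DecidableEq α] (A : Finset α) (Ω : Finset π)
    (φ : α → π → ℝ) {K : ℝ} (hK : 0 < K) (hA : 2 * K ^ 6 ≤ #A) (hΩ : Ω.Nonempty)
    (h0 : ∀ a x, 0 ≤ φ a x) (h1 : ∀ a x, φ a x ≤ 1)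
    (hsum : #A * #Ω ≤ K ^ 3 * ∑ a ∈ A, ∑ x ∈ Ω, φ a x) :
    ∃ a ∈ A, ∃ a' ∈ A, a ≠ a' ∧ #Ω ≤ 2 * K ^ 6 * ∑ x ∈ Ω, φ a x * φ a' x := by
  by_contra! hcon
  have hΩc : (0 : ℝ) < #Ω := by exact_mod_cast hΩ.card_pos
  have hAc : (0 : ℝ) < #A := lt_of_lt_of_le (by positivity) hA
  have hAne : A.Nonempty := Finset.card_pos.1 (by exact_mod_cast hAc)
  have h2 : ∑ x ∈ Ω, (∑ a ∈ A, φ a x) ^ 2 = ∑ a ∈ A, ∑ a' ∈ A, ∑ x ∈ Ω, φ a x * φ a' x := by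
    simp_rw [sq, Finset.sum_mul_sum]
    rw [Finset.sum_comm]
    exact Finset.sum_congr rfl fun a _ => Finset.sum_comm
  have h3 := sq_sum_le_card_mul_sum_sq (s := Ω) (f := fun x => ∑ a ∈ A, φ a x)
  rw [h2, Finset.sum_comm] at h3
  have h4 : 2 * K ^ 6 * ∑ a ∈ A, ∑ a' ∈ A, ∑ x ∈ Ω, φ a x * φ a' x <
      2 * K ^ 6 * (#A * #Ω) + #A ^ 2 * #Ω := by
    calc 2 * K ^ 6 * ∑ a ∈ A, ∑ a' ∈ A, ∑ x ∈ Ω, φ a x * φ a' x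
        = ∑ a ∈ A, ∑ a' ∈ A, 2 * K ^ 6 * ∑ x ∈ Ω, φ a x * φ a' x := by
          simp only [Finset.mul_sum]
      _ < ∑ a ∈ A, ∑ a' ∈ A, ((if a = a' then 2 * K ^ 6 * (#Ω : ℝ) else 0) + (#Ω : ℝ)) := by
          refine Finset.sum_lt_sum_of_nonempty hAne fun a ha =>
            Finset.sum_lt_sum (fun a' ha' => ?_) ⟨a, ha, ?_⟩
          · split_ifs with h
            · refine le_add_of_le_of_nonneg (mul_le_mul_of_nonneg_left ?_ (by positivity)) hΩc.le
              have := Finset.sum_le_card_nsmul Ω (fun x => φ a x * φ a' x) 1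
                fun x _ => mul_le_one₀ (h1 a x) (h0 _ _) (h1 _ _)
              simpa using this
            · simpa using (hcon a ha a' ha' h).le
          · rw [if_pos rfl]
            refine lt_add_of_le_of_pos (mul_le_mul_of_nonneg_left ?_ (by positivity)) hΩc
            have := Finset.sum_le_card_nsmul Ω (fun x => φ a x * φ a x) 1
              fun x _ => mul_le_one₀ (h1 a x) (h0 _ _) (h1 _ _)
            simpa using this
      _ = _ := by
          simp only [Finset.sum_add_distrib, Finset.sum_const, nsmul_eq_mul, Finset.sum_ite_eq]
          rw [Finset.sum_congr rfl (g := fun _ => 2 * K ^ 6 * (#Ω : ℝ))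
            (fun t ht => by simp [ht])]
          simp; ring
  have h5 : (#A * #Ω : ℝ) ^ 2 ≤ (K ^ 3 * ∑ a ∈ A, ∑ x ∈ Ω, φ a x) ^ 2 :=
    pow_le_pow_left₀ (by positivity) hsum 2
  have h6 : 2 * (#A * #Ω : ℝ) ^ 2 < #Ω * (2 * K ^ 6 * (#A * #Ω) + #A ^ 2 * #Ω) := by
    have := mul_lt_mul_of_pos_left h4 hΩc
    have h7 := mul_le_mul_of_nonneg_left h3 (show (0 : ℝ) ≤ 2 * K ^ 6 by positivity)
    linear_combination 2 * h5 + h7 + this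
  have h8 : (#A : ℝ) ^ 2 * #Ω ^ 2 < #Ω ^ 2 * #A * (2 * K ^ 6) := by linarith
  have h9 := mul_le_mul_of_nonneg_left hA (show (0 : ℝ) ≤ (#Ω : ℝ) ^ 2 * #A by positivity)
  linarith

end Step

section Direction

/-- A set of at most `p` points of the plane over `ZMod p` has few pairs on parallel lines of a
suitable slope. -/
theorem exists_slope_card_collisions_le (p : ℕ) [Fact p.Prime] (S : Finset (ZMod p × ZMod p))
    (hS : #S ≤ p) :
    ∃ ζ : ZMod p, #{x ∈ S ×ˢ S | x.1.1 + ζ * x.1.2 = x.2.1 + ζ * x.2.2} ≤ 2 * #S := by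
  by_contra! hcon
  have hp : 0 < p := (Fact.out : p.Prime).pos
  have h1 : p * (2 * #S) <
      ∑ ζ : ZMod p, #{x ∈ S ×ˢ S | x.1.1 + ζ * x.1.2 = x.2.1 + ζ * x.2.2} := by
    have := Finset.sum_lt_sum_of_nonempty (s := (Finset.univ : Finset (ZMod p)))
      ⟨0, Finset.mem_univ _⟩ (fun ζ _ => hcon ζ)
    simpa [ZMod.card] using this
  have h2 : ∑ ζ : ZMod p, #{x ∈ S ×ˢ S | x.1.1 + ζ * x.1.2 = x.2.1 + ζ * x.2.2} =
      ∑ x ∈ S ×ˢ S, #{ζ : ZMod p | x.1.1 + ζ * x.1.2 = x.2.1 + ζ * x.2.2} := by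
    simp only [Finset.card_filter]
    exact Finset.sum_comm
  have h3 : ∑ x ∈ S ×ˢ S, #{ζ : ZMod p | x.1.1 + ζ * x.1.2 = x.2.1 + ζ * x.2.2} ≤
      ∑ x ∈ S ×ˢ S, ((if x.1 = x.2 then p else 0) + 1) := by
    refine Finset.sum_le_sum fun x _ => ?_
    split_ifs with h
    · refine le_trans (Finset.card_le_univ _) ?_
      simp [ZMod.card]
    · refine le_trans (Finset.card_le_one.2 fun ζ hζ ζ' hζ' => ?_) (le_of_eq (zero_add 1).symm)
      simp only [Finset.mem_filter, Finset.mem_univ, true_and] at hζ hζ'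
      by_contra hne
      have h5 : (ζ - ζ') * (x.1.2 - x.2.2) = 0 := by linear_combination hζ - hζ'
      rcases mul_eq_zero.1 h5 with h6 | h6
      · exact hne (sub_eq_zero.1 h6)
      · have h7 := sub_eq_zero.1 h6
        rw [h7] at hζ
        exact h (Prod.ext (add_right_cancel hζ) h7)
  have h4 : ∑ x ∈ S ×ˢ S, ((if x.1 = x.2 then p else 0) + 1) = #S * p + #S * #S := by
    rw [Finset.sum_add_distrib, Finset.sum_product]
    simp only [Finset.sum_ite_eq]
    rw [Finset.sum_congr rfl (g := fun _ => p) (fun t ht => by simp [ht])]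
    simp
  have h5 : #S * #S ≤ #S * p := Nat.mul_le_mul_left _ hS
  rw [h2] at h1
  have := h1.trans_le (h3.trans_eq h4)
  linarith [mul_comm p #S]

/-- A set of residues containing `0` and closed under a nonzero translation is everything. -/
theorem forall_of_zero_of_add (p : ℕ) [Fact p.Prime] (R : ZMod p → Prop) {t : ZMod p}
    (ht : t ≠ 0) (h0 : R 0) (hadd : ∀ x, R x → R (x + t)) (x : ZMod p) : R x := by
  have h : ∀ j : ℕ, R (j * t) := by
    intro j
    induction j with
    | zero => simpa using h0
    | succ j ih => convert hadd _ ih using 1; push_cast; ring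
  convert h (x / t).val using 1
  rw [ZMod.natCast_val, ZMod.cast_id', id, div_mul_cancel₀ _ ht]

variable {F : Type*} [Field F] [DecidableEq F]

theorem le_mul_card_image_of_fiber_le {ι κ : Type*} [DecidableEq κ] (W : Finset ι) (f : ι → κ)
    {q : ℝ} (h : ∀ z, q * #{x ∈ W | f x = z} ≤ 1) : q * #W ≤ #(W.image f) := by
  rw [Finset.card_eq_sum_card_image f W]
  push_cast
  rw [Finset.mul_sum]
  refine (Finset.sum_le_card_nsmul _ _ 1 fun z _ => h z).trans ?_
  simp

/-- If no line of the dual slope is rich in `Y`, two points of `X` on a common line produce many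
popular differences. -/
theorem exists_many_of_rich_of_not_rich (R₁ R₂ : Finset F) (X Y : Finset (F × F))
    {β β' η ξ z : F} {m₁ m₂ s n h q : ℝ} (hβ : β ≠ 0)
    (hm₁ : #R₁ ≤ m₁) (hm₂ : #R₂ ≤ m₂) (hm₂0 : 0 < m₂) (hs : 0 < s) (hsm : s ^ 2 = m₁ * m₂)
    (hn : 0 < n) (hY : #Y ≤ n) (hh : 0 < h) (hq : 0 < q) (hqh : 2 * q * n ^ 2 ≤ h ^ 2)
    (hT : 1 ≤ q * #{θ ∈ X | θ.1 + ξ * θ.2 = z})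
    (hG : ∀ θ ∈ X, s * h ≤ ∑ ω ∈ Y, (shiftCount R₁ R₂ (pathForm β β' η θ ω) : ℝ))
    (hno : ∀ z, ¬ 1 ≤ q * #{ω ∈ Y | ω.1 + -(β' * ξ + η) / β * ω.2 = z}) :
    ∃ V : Finset F, q ^ 2 * n / 8 ≤ #V ∧ ∀ v ∈ V, q * m₂ / 2 ≤ shiftCount R₂ R₂ v := by
  obtain ⟨t, ht, W, hWY, hW, hpop⟩ := exists_popular_dilate R₁ R₂ X Y hβ hm₁ hm₂ hm₂0 hs hsm hn hY
    hh hq hqh hT hG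
  refine ⟨W.image fun ω => t * (ω.1 + -(β' * ξ + η) / β * ω.2), ?_, ?_⟩
  · have h1 := le_mul_card_image_of_fiber_le W
      (fun ω => t * (ω.1 + -(β' * ξ + η) / β * ω.2)) (fun z => by
        refine le_trans (mul_le_mul_of_nonneg_left (Nat.cast_le.2 (Finset.card_le_card ?_)) hq.le)
          (not_le.1 (hno (z / t))).le
        intro ω hω
        have hω := Finset.mem_filter.1 hω
        refine Finset.mem_filter.2 ⟨hWY hω.1, ?_⟩
        rw [eq_div_iff ht, mul_comm]; exact hω.2)
    refine le_trans ?_ h1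
    have := mul_le_mul_of_nonneg_left hW hq.le
    nlinarith [mul_pos (pow_pos hq 2) hn]
  · intro v hv
    obtain ⟨ω, hω, rfl⟩ := Finset.mem_image.1 hv
    exact hpop ω hω

theorem exists_many_of_rich_of_collisions_le (R₁ R₂ : Finset F) (X Y S : Finset (F × F))
    {β β' η ξ z : F} {m₁ m₂ s n h q : ℝ} (hβ : β ≠ 0)
    (hm₁ : #R₁ ≤ m₁) (hm₂ : #R₂ ≤ m₂) (hm₂0 : 0 < m₂) (hs : 0 < s) (hsm : s ^ 2 = m₁ * m₂)
    (hn : 0 < n) (hYS : Y ⊆ S) (hS : #S ≤ n) (hh : 0 < h) (hq : 0 < q)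
    (hqh : 2 * q * n ^ 2 ≤ h ^ 2)
    (hT : 1 ≤ q * #{θ ∈ X | θ.1 + ξ * θ.2 = z})
    (hG : ∀ θ ∈ X, s * h ≤ ∑ ω ∈ Y, (shiftCount R₁ R₂ (pathForm β β' η θ ω) : ℝ))
    (hcol : #{x ∈ S ×ˢ S | x.1.1 + -(β' * ξ + η) / β * x.1.2 =
      x.2.1 + -(β' * ξ + η) / β * x.2.2} ≤ 2 * n) :
    ∃ V : Finset F, q ^ 2 * n / 8 ≤ #V ∧ ∀ v ∈ V, q * m₂ / 2 ≤ shiftCount R₂ R₂ v := by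
  have hY : (#Y : ℝ) ≤ n := le_trans (by exact_mod_cast Finset.card_le_card hYS) hS
  obtain ⟨t, ht, W, hWY, hW, hpop⟩ := exists_popular_dilate R₁ R₂ X Y hβ hm₁ hm₂ hm₂0 hs hsm hn hY
    hh hq hqh hT hG
  refine ⟨W.image fun ω => t * (ω.1 + -(β' * ξ + η) / β * ω.2), ?_, ?_⟩
  · have h1 := card_sq_le_card_image_mul_collisions W
      (fun ω => t * (ω.1 + -(β' * ξ + η) / β * ω.2))
    have h2 : (#{x ∈ W ×ˢ W | t * (x.1.1 + -(β' * ξ + η) / β * x.1.2) =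
        t * (x.2.1 + -(β' * ξ + η) / β * x.2.2)} : ℝ) ≤ 2 * n := by
      refine le_trans (Nat.cast_le.2 (Finset.card_le_card ?_)) hcol
      intro x hx
      simp only [Finset.mem_filter, Finset.mem_product] at hx ⊢
      exact ⟨⟨hYS (hWY hx.1.1), hYS (hWY hx.1.2)⟩, mul_left_cancel₀ ht hx.2⟩
    have h3 : (#W : ℝ) ^ 2 ≤ #(W.image fun ω => t * (ω.1 + -(β' * ξ + η) / β * ω.2)) * (2 * n) :=
      le_trans (by exact_mod_cast h1) (mul_le_mul_of_nonneg_left h2 (Nat.cast_nonneg _))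
    have h4 : (q * n / 2) ^ 2 ≤ (#W : ℝ) ^ 2 := pow_le_pow_left₀ (by positivity) hW 2
    refine le_of_mul_le_mul_right ?_ (show 0 < 2 * n by linarith)
    linear_combination h4 + h3
  · intro v hv
    obtain ⟨ω, hω, rfl⟩ := Finset.mem_image.1 hv
    exact hpop ω hω

/-- The dichotomy between rich and poor directions, iterated along the two forms `pathForm β β' η₁`
and `pathForm β β' η₂`. -/
theorem exists_many_popular_differences (p : ℕ) [Fact p.Prime] (R₁ R₂ A B : Finset (ZMod p))
    (X Y : Finset (ZMod p × ZMod p)) {β β' η₁ η₂ : ZMod p} {m₁ m₂ s h q : ℝ}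
    (hβ : β ≠ 0) (hβ' : β' ≠ 0) (hη : η₁ ≠ η₂)
    (hm₁ : #R₁ ≤ m₁) (hm₂ : #R₂ ≤ m₂) (hm₂0 : 0 < m₂) (hs : 0 < s) (hsm : s ^ 2 = m₁ * m₂)
    (hXS : X ⊆ A ×ˢ B) (hYS : Y ⊆ A ×ˢ B) (hX : X.Nonempty) (hS : #(A ×ˢ B) ≤ p)
    (hh : 0 < h) (hq : 0 < q) (hqh : 2 * q * (#(A ×ˢ B) : ℝ) ^ 2 ≤ h ^ 2) (hA : #A < q * h)
    (hGX : ∀ e, e = η₁ ∨ e = η₂ → ∀ θ ∈ X,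
      s * h ≤ ∑ ω ∈ Y, (shiftCount R₁ R₂ (pathForm β β' e θ ω) : ℝ))
    (hGY : ∀ e, e = η₁ ∨ e = η₂ → ∀ ω ∈ Y,
      s * h ≤ ∑ θ ∈ X, (shiftCount R₁ R₂ (pathForm β β' e θ ω) : ℝ)) :
    ∃ V : Finset (ZMod p), q ^ 2 * #(A ×ˢ B) / 8 ≤ #V ∧
      ∀ v ∈ V, q * m₂ / 2 ≤ shiftCount R₂ R₂ v := by
  by_contra hfail
  have hn : (0 : ℝ) < #(A ×ˢ B) := by exact_mod_cast (hX.mono hXS).card_pos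
  have hXn : (#X : ℝ) ≤ #(A ×ˢ B) := by exact_mod_cast Finset.card_le_card hXS
  have hYn : (#Y : ℝ) ≤ #(A ×ˢ B) := by exact_mod_cast Finset.card_le_card hYS
  have hGY' : ∀ e, e = η₁ ∨ e = η₂ → ∀ ω ∈ Y,
      s * h ≤ ∑ θ ∈ X, (shiftCount R₁ R₂ (pathForm β' β e ω θ) : ℝ) := by
    intro e he ω hω
    simp_rw [pathForm_swap β' β e ω]
    exact hGY e he ω hω
  have hXY : ∀ e, e = η₁ ∨ e = η₂ → ∀ ξ, (∃ z, 1 ≤ q * #{θ ∈ X | θ.1 + ξ * θ.2 = z}) →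
      ∃ z, 1 ≤ q * #{ω ∈ Y | ω.1 + -(β' * ξ + e) / β * ω.2 = z} := by
    rintro e he ξ ⟨z, hz⟩
    by_contra! hno
    exact hfail (exists_many_of_rich_of_not_rich R₁ R₂ X Y hβ hm₁ hm₂ hm₂0 hs hsm hn hYn hh hq hqh
      hz (hGX e he) fun z => not_le.2 (hno z))
  have hYX : ∀ e, e = η₁ ∨ e = η₂ → ∀ ζ, (∃ z, 1 ≤ q * #{ω ∈ Y | ω.1 + ζ * ω.2 = z}) →
      ∃ z, 1 ≤ q * #{θ ∈ X | θ.1 + -(β * ζ + e) / β' * θ.2 = z} := by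
    rintro e he ζ ⟨z, hz⟩
    by_contra! hno
    exact hfail (exists_many_of_rich_of_not_rich R₁ R₂ Y X hβ' hm₁ hm₂ hm₂0 hs hsm hn hXn hh hq hqh
      hz (hGY' e he) fun z => not_le.2 (hno z))
  have hle : ∀ y, (shiftCount R₁ R₂ y : ℝ) ≤ s := by
    intro y
    refine abs_le_of_sq_le_sq' ?_ hs.le |>.2
    rw [hsm, sq]
    exact mul_le_mul ((Nat.cast_le.2 (shiftCount_le_left _ _ _)).trans hm₁)
      ((Nat.cast_le.2 (shiftCount_le_right _ _ _)).trans hm₂) (Nat.cast_nonneg _)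
      ((Nat.cast_nonneg _).trans hm₁)
  have hXh : h ≤ #X := by
    obtain ⟨θ, hθ⟩ := hX
    have hY : Y.Nonempty := by
      rw [Finset.nonempty_iff_ne_empty]
      rintro rfl
      have := hGX η₁ (Or.inl rfl) θ hθ
      rw [Finset.sum_empty] at this
      exact absurd this (not_le.2 (mul_pos hs hh))
    obtain ⟨ω, hω⟩ := hY
    refine le_of_mul_le_mul_left ((hGY η₁ (Or.inl rfl) ω hω).trans ?_) hs
    refine (Finset.sum_le_card_nsmul _ _ s fun _ _ => hle _).trans ?_
    rw [nsmul_eq_mul, mul_comm]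
  have h0 : ∃ z, 1 ≤ q * #{θ ∈ X | θ.1 + 0 * θ.2 = z} := by
    by_contra! hno
    have h1 := le_mul_card_image_of_fiber_le X (fun θ => θ.1)
      fun z => by simpa using (hno z).le
    have h2 : #(X.image fun θ => θ.1) ≤ #A := by
      refine Finset.card_le_card fun a ha => ?_
      obtain ⟨θ, hθ, rfl⟩ := Finset.mem_image.1 ha
      exact (Finset.mem_product.1 (hXS hθ)).1
    have h3 : (#(X.image fun θ => θ.1) : ℝ) ≤ #A := by exact_mod_cast h2
    linarith [mul_le_mul_of_nonneg_left hXh hq.le]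
  have hall := forall_of_zero_of_add p (fun ξ => ∃ z, 1 ≤ q * #{θ ∈ X | θ.1 + ξ * θ.2 = z})
    (t := (η₁ - η₂) / β') (div_ne_zero (sub_ne_zero.2 hη) hβ') h0 (by
      intro ξ hξ
      have e : -(β * (-(β' * ξ + η₁) / β) + η₂) / β' = ξ + (η₁ - η₂) / β' := by
        field_simp; ring
      rw [← e]
      exact hYX η₂ (Or.inr rfl) _ (hXY η₁ (Or.inl rfl) ξ hξ))
  obtain ⟨ζ, hζ⟩ := exists_slope_card_collisions_le p (A ×ˢ B) hS
  obtain ⟨z, hz⟩ := hall (-(β * ζ + η₁) / β')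
  have hζ' : -(β' * (-(β * ζ + η₁) / β') + η₁) / β = ζ := by
    field_simp; ring
  refine hfail (exists_many_of_rich_of_collisions_le R₁ R₂ X Y (A ×ˢ B) hβ hm₁ hm₂ hm₂0 hs hsm hn
    hYS le_rfl hh hq hqh hz (hGX η₁ (Or.inl rfl)) ?_)
  rw [hζ']
  exact_mod_cast hζ

end Direction

/-- If all products `a * b * b'` are popular differences between `R₁` and `R₂`, then `R₂` has many
popular differences, essentially as many as there are pairs in `A × B`. -/
theorem exists_many_popular_differences_of_products (p : ℕ) [Fact p.Prime]
    (R₁ R₂ A B : Finset (ZMod p)) {m₁ m₂ s K : ℝ}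
    (hm₁ : #R₁ ≤ m₁) (hm₂ : #R₂ ≤ m₂) (hm₂0 : 0 < m₂) (hs : 0 < s) (hsm : s ^ 2 = m₁ * m₂)
    (h0B : 0 ∉ B) (hn : #A * #B ≤ p) (hK : 0 < K) (hA : 2 * K ^ 6 ≤ #A) (hB : 128 * K ^ 18 < #B)
    (hN : ∀ a ∈ A, ∀ b ∈ B, ∀ b' ∈ B, s / K ≤ shiftCount R₁ R₂ (a * b * b')) :
    ∃ V : Finset (ZMod p), #A * #B / (8192 * K ^ 24) ≤ (#V : ℝ) ∧
      ∀ v ∈ V, m₂ / (64 * K ^ 12) ≤ shiftCount R₂ R₂ v := by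
  have hAc : (0 : ℝ) < #A := lt_of_lt_of_le (by positivity) hA
  have hBc : (0 : ℝ) < #B := lt_trans (by positivity) hB
  have hAne : A.Nonempty := Finset.card_pos.1 (by exact_mod_cast hAc)
  have hBne : B.Nonempty := Finset.card_pos.1 (by exact_mod_cast hBc)
  have hm₁0 : 0 ≤ m₁ := (Nat.cast_nonneg _).trans hm₁
  have hle : ∀ y, (shiftCount R₁ R₂ y : ℝ) ≤ s := by
    intro y
    refine abs_le_of_sq_le_sq' ?_ hs.le |>.2
    rw [hsm, sq]
    exact mul_le_mul ((Nat.cast_le.2 (shiftCount_le_left _ _ _)).trans hm₁)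
      ((Nat.cast_le.2 (shiftCount_le_right _ _ _)).trans hm₂) (Nat.cast_nonneg _) hm₁0
  have hScard : (#(A ×ˢ B) : ℝ) = #A * #B := by rw [Finset.card_product]; push_cast; rfl
  obtain ⟨β, hβ, β', hβ', hsum⟩ := exists_sum_shiftCount_pathForm_ge R₁ R₂ A B
    (div_nonneg hs.le hK.le) hBne hN
  obtain ⟨η₁, -, η₂, -, hη, hcorr⟩ := exists_correlated_pair A ((A ×ˢ B) ×ˢ (A ×ˢ B))
    (fun η x => (shiftCount R₁ R₂ (pathForm β β' η x.1 x.2) : ℝ) / s) hK hA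
    ((hAne.product hBne).product (hAne.product hBne)) (fun _ _ => by positivity)
    (fun _ _ => (div_le_one hs).2 (hle _)) (by
      have h0 : ∑ η ∈ A, ∑ x ∈ (A ×ˢ B) ×ˢ (A ×ˢ B),
          (shiftCount R₁ R₂ (pathForm β β' η x.1 x.2) : ℝ) / s = (∑ η ∈ A, ∑ θ ∈ A ×ˢ B,
            ∑ ω ∈ A ×ˢ B, (shiftCount R₁ R₂ (pathForm β β' η θ ω) : ℝ)) / s := by
        rw [Finset.sum_div]
        refine Finset.sum_congr rfl fun η _ => ?_
        rw [← Finset.sum_div, Finset.sum_product]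
      rw [h0, Finset.card_product (A ×ˢ B), ← mul_div_assoc, le_div_iff₀ hs]
      push_cast
      rw [hScard]
      have h1 : (#R₁ : ℝ) * #R₂ ≤ s ^ 2 := by
        rw [hsm]; exact mul_le_mul hm₁ hm₂ (Nat.cast_nonneg _) hm₁0
      have h2 := hsum.trans (mul_le_mul_of_nonneg_right h1 (by positivity))
      rw [div_pow, ← mul_div_assoc, div_le_iff₀ (by positivity)] at h2
      refine le_of_mul_le_mul_left ?_ (show 0 < s ^ 2 by positivity)
      linear_combination h2)
  set f : ZMod p × ZMod p → ZMod p × ZMod p → ℝ := fun θ ω =>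
    (shiftCount R₁ R₂ (pathForm β β' η₁ θ ω) : ℝ) / s *
      ((shiftCount R₁ R₂ (pathForm β β' η₂ θ ω) : ℝ) / s) with hf
  have hnpos : (0 : ℝ) < #A * #B := mul_pos hAc hBc
  have hd : (0 : ℝ) < #A * #B / (4 * K ^ 6) := by positivity
  have hf1 : ∀ e, e = η₁ ∨ e = η₂ → ∀ θ ω,
      s * f θ ω ≤ shiftCount R₁ R₂ (pathForm β β' e θ ω) := by
    have h01 : ∀ y, (shiftCount R₁ R₂ y : ℝ) / s ≤ 1 := fun y => (div_le_one hs).2 (hle _)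
    have h00 : ∀ y, 0 ≤ (shiftCount R₁ R₂ y : ℝ) / s := fun y => by positivity
    rintro e (rfl | rfl) θ ω
    · rw [← le_div_iff₀' hs]
      exact mul_le_of_le_one_right (h00 _) (h01 _)
    · rw [← le_div_iff₀' hs]
      exact mul_le_of_le_one_left (h00 _) (h01 _)
  obtain ⟨X, hX, Y, hY, hXne, -, hXd, hYd⟩ := exists_min_degree_subgraph f hd
    (#(A ×ˢ B) + #(A ×ˢ B)) (A ×ˢ B) (A ×ˢ B) rfl
    (by have := (hAne.product hBne).card_pos; omega) (by
      rw [Finset.sum_product, Finset.card_product (A ×ˢ B)] at hcorr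
      push_cast at hcorr ⊢
      rw [hScard] at hcorr ⊢
      rw [div_mul_eq_mul_div, div_le_iff₀ (by positivity)]
      linear_combination 2 * hcorr)
  obtain ⟨V, hV, hpop⟩ := exists_many_popular_differences p R₁ R₂ A B X Y (β := β) (β' := β')
    (q := 1 / (32 * K ^ 12)) (fun h => h0B (h ▸ hβ)) (fun h => h0B (h ▸ hβ')) hη hm₁ hm₂ hm₂0 hs hsm
    hX hY hXne (by rwa [Finset.card_product]) hd (by positivity)
    (le_of_eq (by rw [hScard]; field_simp; ring)) (by
      have : 1 / (32 * K ^ 12) * (#A * #B / (4 * K ^ 6)) = #A * #B / (128 * K ^ 18) := by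
        field_simp; ring
      rw [this, lt_div_iff₀ (by positivity)]
      exact mul_lt_mul_of_pos_left hB hAc)
    (fun e he θ hθ => by
      refine (mul_le_mul_of_nonneg_left (hXd θ hθ) hs.le).trans ?_
      rw [Finset.mul_sum]
      exact Finset.sum_le_sum fun ω _ => hf1 e he θ ω)
    (fun e he ω hω => by
      refine (mul_le_mul_of_nonneg_left (hYd ω hω) hs.le).trans ?_
      rw [Finset.mul_sum]
      exact Finset.sum_le_sum fun θ _ => hf1 e he θ ω)
  refine ⟨V, le_trans (le_of_eq ?_) hV, fun v hv => le_trans (le_of_eq ?_) (hpop v hv)⟩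
  · rw [hScard]; field_simp; ring
  · field_simp; ring

section Levels

theorem shiftCount_le_shiftCount_mul {F : Type*} [Field F] [DecidableEq F] (R₁ R₂ Γ : Finset F)
    (y : F) {γ : F} (hγ : γ ∈ Γ.erase 0) :
    shiftCount R₁ R₂ y ≤ shiftCount (R₁ * Γ) (R₂ * Γ) (y * γ) := by
  obtain ⟨h0, hΓ⟩ := Finset.mem_erase.1 hγ
  refine Finset.card_le_card_of_injOn (fun u => u * γ) ?_ fun _ _ _ _ h => mul_right_cancel₀ h0 h
  intro u hu
  obtain ⟨hu, hu'⟩ := Finset.mem_filter.1 (Finset.mem_coe.1 hu)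
  refine Finset.mem_coe.2 (Finset.mem_filter.2 ⟨Finset.mul_mem_mul hu hΓ, ?_⟩)
  rw [← sub_mul]
  exact Finset.mul_mem_mul hu' hΓ

theorem two_mul_card_le_of_popular {F : Type*} [Field F] [DecidableEq F] (R V : Finset F)
    {m P : ℝ} (hm : 0 < m) (hP : 0 < P) (hR : #R ≤ m)
    (hV : ∀ v ∈ V, 2 * m / P ≤ shiftCount R R v) : 2 * #V ≤ m * P := by
  have h1 : #V * (2 * m / P) ≤ m ^ 2 := by
    rw [← nsmul_eq_mul]
    refine (Finset.card_nsmul_le_sum V (fun v => (shiftCount R R v : ℝ)) _ hV).trans ?_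
    rw [← Nat.cast_sum]
    refine (Nat.cast_le.2 (sum_shiftCount_le R R V)).trans ?_
    push_cast
    rw [← sq]
    exact pow_le_pow_left₀ (Nat.cast_nonneg _) hR 2
  rw [← mul_div_assoc, div_le_iff₀ hP] at h1
  refine le_of_mul_le_mul_left ?_ hm
  linarith

/-- One round of the iteration: many popular differences at one level give more of them, of lower
popularity, two levels up. -/
theorem exists_popular_next_level (p : ℕ) [Fact p.Prime] (R₁ R₂ Γ A : Finset (ZMod p))
    {m₁ m₂ s P : ℝ} {c t : ℕ}
    (hm₁ : #(R₁ * Γ * Γ) ≤ m₁) (hm₂ : #(R₂ * Γ * Γ) ≤ m₂) (hm₂0 : 0 < m₂) (hs : 0 < s)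
    (hsm : s ^ 2 = m₁ * m₂) (hP : 2 ≤ P) (hg : P ^ 18 ≤ #(Γ.erase 0))
    (hc : P ^ 18 ≤ c) (hcp : c * #(Γ.erase 0) ≤ p) (hcm : m₂ * P ^ 36 < 2 * (c * #(Γ.erase 0)))
    (hA : (#(Γ.erase 0) : ℝ) ^ (t + 1) ≤ P ^ 3 * #A)
    (hN : ∀ a ∈ A, 2 * s / P ≤ shiftCount R₁ R₂ a) :
    ∃ V : Finset (ZMod p), (#(Γ.erase 0) : ℝ) ^ (t + 2) ≤ (P ^ 12) ^ 3 * #V ∧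
      ∀ v ∈ V, 2 * m₂ / P ^ 12 ≤ shiftCount (R₂ * Γ * Γ) (R₂ * Γ * Γ) v := by
  have hP0 : 0 < P := by linarith
  have hP1 : 1 ≤ P := by linarith
  have hg1 : (1 : ℝ) ≤ #(Γ.erase 0) := (one_le_pow₀ hP1).trans hg
  have hpow : ∀ i j : ℕ, i ≤ j → P ^ i ≤ P ^ j := fun i j h => pow_le_pow_right₀ hP1 h
  have hstep : ∀ A' ⊆ A, #A' ≤ c → P ^ 6 ≤ #A' → ∃ V : Finset (ZMod p),
      #A' * #(Γ.erase 0) ≤ P ^ 24 * #V ∧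
      ∀ v ∈ V, 2 * m₂ / P ^ 12 ≤ shiftCount (R₂ * Γ * Γ) (R₂ * Γ * Γ) v := by
    intro A' hA' hA'c hA'P
    obtain ⟨V, hV, hpop⟩ := exists_many_popular_differences_of_products p (R₁ * Γ * Γ)
      (R₂ * Γ * Γ) A' (Γ.erase 0) (K := P / 2) hm₁ hm₂ hm₂0 hs hsm (by simp)
      ((Nat.mul_le_mul_right _ hA'c).trans hcp) (by positivity)
      (le_trans (by rw [div_pow]; linarith [pow_pos hP0 6]) hA'P)
      (lt_of_lt_of_le (by rw [div_pow]; linarith [pow_pos hP0 18]) hg) (by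
        intro a ha b hb b' hb'
        refine le_trans (le_of_eq ?_) ((hN a (hA' ha)).trans (Nat.cast_le.2
          ((shiftCount_le_shiftCount_mul R₁ R₂ Γ a hb).trans
            (shiftCount_le_shiftCount_mul _ _ Γ _ hb'))))
        field_simp)
    refine ⟨V, ?_, fun v hv => le_trans ?_ (hpop v hv)⟩
    · rw [div_pow, div_le_iff₀ (by positivity)] at hV
      refine hV.trans ?_
      have : (0 : ℝ) ≤ #V * P ^ 24 := by positivity
      linarith
    · rw [div_pow, div_le_div_iff₀ (by positivity) (by positivity)]
      have := mul_pos hm₂0 (pow_pos hP0 12)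
      linarith
  have hA6 : P ^ 6 ≤ #A := by
    refine le_of_mul_le_mul_left (le_trans ?_ hA) (pow_pos hP0 3)
    calc P ^ 3 * P ^ 6 = P ^ 9 := by ring
      _ ≤ P ^ 18 := hpow _ _ (by norm_num)
      _ ≤ #(Γ.erase 0) := hg
      _ ≤ _ := le_self_pow₀ hg1 (by omega)
  have hAc : #A ≤ c := by
    by_contra! hlt
    obtain ⟨A', hA', hcard⟩ := Finset.exists_subset_card_eq hlt.le
    obtain ⟨V, hV, hpop⟩ := hstep A' hA' hcard.le
      (by rw [hcard]; exact (hpow _ _ (by norm_num)).trans hc)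
    have h1 := two_mul_card_le_of_popular (R₂ * Γ * Γ) V hm₂0 (pow_pos hP0 12) hm₂ hpop
    rw [hcard] at hV
    have h2 := mul_le_mul_of_nonneg_left h1 (pow_pos hP0 24).le
    have : P ^ 24 * (m₂ * P ^ 12) = m₂ * P ^ 36 := by ring
    linarith
  obtain ⟨V, hV, hpop⟩ := hstep A Subset.rfl hAc hA6
  refine ⟨V, ?_, hpop⟩
  calc (#(Γ.erase 0) : ℝ) ^ (t + 2) = (#(Γ.erase 0) : ℝ) ^ (t + 1) * #(Γ.erase 0) := pow_succ _ _
    _ ≤ P ^ 3 * #A * #(Γ.erase 0) := mul_le_mul_of_nonneg_right hA (by linarith)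
    _ = P ^ 3 * (#A * #(Γ.erase 0)) := by ring
    _ ≤ P ^ 3 * (P ^ 24 * #V) := mul_le_mul_of_nonneg_left hV (by positivity)
    _ = P ^ 27 * #V := by ring
    _ ≤ P ^ 36 * #V := mul_le_mul_of_nonneg_right (hpow _ _ (by norm_num)) (Nat.cast_nonneg _)
    _ = _ := by ring

/-- The iteration of `exists_popular_next_level`. -/
theorem card_pow_le_of_popular (p : ℕ) [Fact p.Prime] (Q₁ Q₂ Γ : Finset (ZMod p)) {x : ZMod p}
    (hx : x ≠ 0) {m₁ m₂ s P : ℝ} {c n : ℕ} (hn : 1 ≤ n)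
    (hm₁ : #(Q₁ * Γ ^ 3) ≤ m₁) (hm₂ : ∀ j, 1 ≤ j → j ≤ 2 * n + 1 → #(Q₂ * Γ ^ j) ≤ m₂)
    (hm₂0 : 0 < m₂) (hs : 0 < s) (hsm : s ^ 2 = m₁ * m₂) (hP : 2 ≤ P)
    (hg : (P ^ 12 ^ (n - 1)) ^ 18 ≤ #(Γ.erase 0)) (hc : (P ^ 12 ^ (n - 1)) ^ 18 ≤ c)
    (hcp : c * #(Γ.erase 0) ≤ p)
    (hcm : m₂ * (P ^ 12 ^ (n - 1)) ^ 36 < 2 * (c * #(Γ.erase 0)))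
    (hN : 2 * s / P ≤ shiftCount Q₁ Q₂ x) :
    2 * (#(Γ.erase 0) : ℝ) ^ (n + 1) ≤ m₂ * (P ^ 12 ^ n) ^ 4 := by
  have hP1 : 1 ≤ P := by linarith
  have hmono : ∀ t < n, P ^ 12 ^ t ≤ P ^ 12 ^ (n - 1) := fun t ht =>
    pow_le_pow_right₀ hP1 (Nat.pow_le_pow_right (by norm_num) (by omega))
  have h2 : ∀ t, 2 ≤ P ^ 12 ^ t := fun t =>
    hP.trans (le_self_pow₀ hP1 (by positivity))
  have hpos : ∀ t, 0 < P ^ 12 ^ t := fun t => by linarith [h2 t]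
  have hg' : ∀ t < n, (P ^ 12 ^ t) ^ 18 ≤ #(Γ.erase 0) := fun t ht =>
    (pow_le_pow_left₀ (hpos t).le (hmono t ht) 18).trans hg
  have hc' : ∀ t < n, (P ^ 12 ^ t) ^ 18 ≤ c := fun t ht =>
    (pow_le_pow_left₀ (hpos t).le (hmono t ht) 18).trans hc
  have hcm' : ∀ t < n, m₂ * (P ^ 12 ^ t) ^ 36 < 2 * (c * #(Γ.erase 0)) := fun t ht =>
    (mul_le_mul_of_nonneg_left (pow_le_pow_left₀ (hpos t).le (hmono t ht) 36) hm₂0.le).trans_lt hcm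
  have hmul : ∀ (Q : Finset (ZMod p)) (j : ℕ), Q * Γ ^ j * Γ * Γ = Q * Γ ^ (j + 2) := by
    intro Q j
    rw [pow_add, pow_two]; simp only [mul_assoc]
  have hlevel : ∀ t, (P ^ 12 ^ t) ^ 12 = P ^ 12 ^ (t + 1) := fun t => by
    rw [← pow_mul, ← pow_succ]
  have main : ∀ t < n, ∃ V : Finset (ZMod p),
      (#(Γ.erase 0) : ℝ) ^ (t + 2) ≤ (P ^ 12 ^ (t + 1)) ^ 3 * #V ∧
      ∀ v ∈ V, 2 * m₂ / P ^ 12 ^ (t + 1) ≤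
        shiftCount (Q₂ * Γ ^ (2 * t + 3)) (Q₂ * Γ ^ (2 * t + 3)) v := by
    intro t
    induction t with
    | zero =>
      intro ht
      have := exists_popular_next_level p (Q₁ * Γ ^ 1) (Q₂ * Γ ^ 1) Γ
        ((Γ.erase 0).image fun γ => x * γ) (t := 0) (by rwa [hmul])
        (by rw [hmul]; exact hm₂ 3 (by norm_num) (by omega)) hm₂0 hs hsm (h2 0) (hg' 0 ht)
        (hc' 0 ht) hcp (hcm' 0 ht) (by
          rw [Finset.card_image_of_injective _ (mul_right_injective₀ hx), zero_add, pow_one]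
          exact le_mul_of_one_le_left (Nat.cast_nonneg _)
            (one_le_pow₀ (by linarith [h2 0]))) (by
          intro a ha
          obtain ⟨γ, hγ, rfl⟩ := Finset.mem_image.1 ha
          rw [pow_zero, pow_one, pow_one]
          exact hN.trans (Nat.cast_le.2 (shiftCount_le_shiftCount_mul Q₁ Q₂ Γ x hγ)))
      rw [hmul, hlevel] at this
      exact this
    | succ t ih =>
      intro ht
      obtain ⟨A, hA, hpop⟩ := ih (by omega)
      have hm : (#(Q₂ * Γ ^ (2 * t + 3) * Γ * Γ) : ℝ) ≤ m₂ := by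
        rw [hmul]; exact hm₂ _ (by omega) (by omega)
      have := exists_popular_next_level p (Q₂ * Γ ^ (2 * t + 3)) (Q₂ * Γ ^ (2 * t + 3)) Γ A
        (s := m₂) (t := t + 1) hm hm hm₂0 hm₂0 (sq m₂) (h2 (t + 1)) (hg' _ ht) (hc' _ ht) hcp
        (hcm' _ ht) hA hpop
      rw [hmul, hlevel] at this
      exact this
  obtain ⟨V, hV, hpop⟩ := main (n - 1) (by omega)
  have e1 : n - 1 + 1 = n := by omega
  have e2 : n - 1 + 2 = n + 1 := by omega
  rw [e1] at hV hpop
  rw [e2] at hV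
  have h3 := two_mul_card_le_of_popular _ V hm₂0 (hpos n) (hm₂ _ (by omega) (by omega)) hpop
  have h4 := mul_le_mul_of_nonneg_left h3 (pow_pos (hpos n) 3).le
  linear_combination 2 * hV + h4

end Levels

section Numerics

theorem thirty_seven_mul_pow_le {k n : ℕ} (hk : 5 ≤ k) (hn : n = (k + 4) / 8) :
    37 * 12 ^ (n - 1) ≤ 2 ^ (k + 1) := by
  obtain ⟨j, rfl⟩ : ∃ j, n = j + 1 := ⟨n - 1, by omega⟩
  rcases j with _ | j
  · calc 37 * 12 ^ (0 + 1 - 1) ≤ 2 ^ (5 + 1) := by norm_num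
      _ ≤ 2 ^ (k + 1) := Nat.pow_le_pow_right (by norm_num) (by omega)
  · have h : 12 ^ j ≤ 256 ^ j := Nat.pow_le_pow_left (by norm_num) j
    calc 37 * 12 ^ (j + 1 + 1 - 1) = 444 * 12 ^ j := by rw [Nat.add_sub_cancel, pow_succ]; ring
      _ ≤ 8192 * 256 ^ j := Nat.mul_le_mul (by norm_num) h
      _ = 2 ^ (8 * j + 13) := by rw [pow_add, pow_mul]; norm_num; ring
      _ ≤ 2 ^ (k + 1) := Nat.pow_le_pow_right (by norm_num) (by omega)

theorem sixteen_mul_pow_le {k n : ℕ} (hk : 5 ≤ k) (hn : n = (k + 4) / 8) :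
    16 * 12 ^ n + 2 ^ k * k ≤ 2 ^ k * (8 * n + 4) := by
  obtain ⟨r, hr, hkr⟩ : ∃ r < 8, k + 4 = 8 * n + r := ⟨(k + 4) % 8, by omega, by omega⟩
  obtain ⟨j, rfl⟩ : ∃ j, n = j + 1 := ⟨n - 1, by omega⟩
  obtain rfl : k = 8 * j + (4 + r) := by omega
  have h8 : 2 ^ (8 * j + (4 + r)) = 16 * 256 ^ j * 2 ^ r := by
    rw [pow_add, pow_add, pow_mul]; norm_num; ring
  rw [h8]
  rcases j with _ | j
  · interval_cases r <;> omega
  · have h : 12 ^ j ≤ 256 ^ j := Nat.pow_le_pow_left (by norm_num) j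
    have h1 : (12 : ℕ) ^ (j + 1 + 1) = 144 * 12 ^ j := by ring
    have h2 : (256 : ℕ) ^ (j + 1) = 256 * 256 ^ j := by ring
    have h3 : (0 : ℕ) < 256 ^ j := by positivity
    rw [h1, h2]
    clear h8 hn hkr h1 h2
    generalize 256 ^ j = b at h h3 ⊢
    generalize 12 ^ j = a at h ⊢
    interval_cases r <;> linarith

theorem two_mul_pow_gt {G g m P : ℝ} {k n : ℕ} (hk : 5 ≤ k) (hn : n = (k + 4) / 8)
    (hG : 1 ≤ G) (hGg : G ≤ 2 * g) (hP : P = G ^ ((2 : ℝ) ^ (-(k : ℝ)) / 2))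
    (hbound : m * 2 ^ (3 * k + 1) ≤ G ^ ((k : ℝ) / 8 + 1 / 2)) :
    m * (P ^ 12 ^ n) ^ 4 < 2 * g ^ (n + 1) := by
  have hG0 : 0 < G := by linarith
  have hP0 : 0 < P := by rw [hP]; positivity
  have h1 : (P ^ 12 ^ n) ^ 4 = G ^ ((2 : ℝ) ^ (-(k : ℝ)) / 2 * (12 ^ n * 4 : ℕ)) := by
    rw [← pow_mul, hP, Real.rpow_mul hG0.le, Real.rpow_natCast]
  have h2 : G ^ ((k : ℝ) / 8 + 1 / 2) * (P ^ 12 ^ n) ^ 4 ≤ G ^ (n + 1) := by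
    rw [h1, ← Real.rpow_add hG0, ← Real.rpow_natCast]
    refine Real.rpow_le_rpow_of_exponent_le hG ?_
    have h3 := sixteen_mul_pow_le hk hn
    have h4 : (16 : ℝ) * 12 ^ n + 2 ^ k * k ≤ 2 ^ k * (8 * n + 4) := by exact_mod_cast h3
    rw [Real.rpow_neg (by norm_num), Real.rpow_natCast]
    push_cast
    have h5 : (0 : ℝ) < 2 ^ k := by positivity
    refine le_of_mul_le_mul_left ?_ h5
    have h6 : (2 : ℝ) ^ k * ((k : ℝ) / 8 + 1 / 2 + (2 ^ k)⁻¹ / 2 * (12 ^ n * 4)) =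
        2 ^ k * ((k : ℝ) / 8 + 1 / 2) + 2 * 12 ^ n := by
      field_simp; ring
    rw [h6]
    linarith
  have h3 : G ^ (n + 1) ≤ 2 ^ (n + 1) * g ^ (n + 1) := by
    rw [← mul_pow]; exact pow_le_pow_left₀ hG0.le hGg _
  have h4 : m * (P ^ 12 ^ n) ^ 4 * 2 ^ (3 * k + 1) ≤ 2 ^ (n + 1) * g ^ (n + 1) := by
    refine le_trans ?_ (h2.trans h3)
    have := mul_le_mul_of_nonneg_right hbound (pow_pos (pow_pos hP0 (12 ^ n)) 4).le
    linarith
  have h5 : (2 : ℝ) ^ (n + 1) < 2 * 2 ^ (3 * k + 1) := by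
    rw [← pow_succ']
    exact pow_lt_pow_right₀ (by norm_num) (by omega)
  have hg : 0 < g := by linarith
  have h6 := mul_lt_mul_of_pos_right h5 (pow_pos hg (n + 1))
  refine lt_of_mul_lt_mul_right ?_ (show (0 : ℝ) ≤ 2 ^ (3 * k + 1) by positivity)
  linarith

end Numerics

section Cardinalities

variable {F : Type*} [Field F] [DecidableEq F]

theorem card_le_card_mul_of_ne_zero (R Γ : Finset F) {γ : F} (hγ : γ ∈ Γ) (h0 : γ ≠ 0) :
    #R ≤ #(R * Γ) :=
  Finset.card_le_card_of_injOn (fun u => u * γ) (fun _ hu => Finset.mul_mem_mul hu hγ)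
    fun _ _ _ _ h => mul_right_cancel₀ h0 h

theorem card_mul_pow_mono (Q Γ : Finset F) {γ : F} (hγ : γ ∈ Γ) (h0 : γ ≠ 0) :
    Monotone fun j : ℕ => #(Q * Γ ^ j) :=
  monotone_nat_of_le_succ fun j => by
    rw [pow_succ, ← mul_assoc]
    exact card_le_card_mul_of_ne_zero _ Γ hγ h0

theorem card_inter_add_singleton (Q₁ Q₂ : Finset F) (x : F) :
    #(Q₁ ∩ (Q₂ + {x})) = shiftCount Q₁ Q₂ x := by
  refine congrArg Finset.card (Finset.ext fun u => ?_)
  simp only [Finset.mem_inter, Finset.mem_filter, Finset.mem_add, Finset.mem_singleton]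
  refine and_congr_right fun _ => ⟨?_, fun h => ⟨_, h, x, rfl, sub_add_cancel u x⟩⟩
  rintro ⟨v, hv, _, rfl, rfl⟩
  rwa [add_sub_cancel_right]

theorem exists_mem_ne_zero {S : Finset F} (hS : S.Nonempty) (h : S ≠ {0}) : ∃ a ∈ S, a ≠ 0 := by
  by_contra! hcon
  exact h (hS.subset_singleton_iff.1 fun a ha => Finset.mem_singleton.2 (hcon a ha))

end Cardinalities

section Main

/-- The degenerate case where one of the two sets is `{0}`. -/
theorem shiftCount_le_of_eq_zero {F : Type*} [Field F] [DecidableEq F] (Q₁ Q₂ Γ : Finset F)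
    {x : F} (hx : x ≠ 0) {L e : ℝ} (hL : 1 ≤ L) (he : e ≤ 1 / 2) (hΓ : Γ.Nonempty)
    (hQ₁ : Q₁.Nonempty) (hQ₂ : Q₂.Nonempty) (hL₁ : #(Q₁ * Γ) ≤ L * #Q₁)
    (hL₂ : #(Q₂ * Γ) ≤ L * #Q₂) (h0 : Q₁ = {0} ∨ Q₂ = {0}) :
    (shiftCount Q₁ Q₂ x : ℝ) ≤ L * √((#Q₁ : ℝ) * #Q₂) * (#Γ : ℝ) ^ (-e) := by
  rcases Nat.eq_zero_or_pos (shiftCount Q₁ Q₂ x) with hr | hr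
  · rw [hr, Nat.cast_zero]; positivity
  have hG1 : (1 : ℝ) ≤ #Γ := by exact_mod_cast hΓ.card_pos
  have hq₁ : (1 : ℝ) ≤ #Q₁ := by exact_mod_cast hQ₁.card_pos
  have hq₂ : (1 : ℝ) ≤ #Q₂ := by exact_mod_cast hQ₂.card_pos
  have hmul : ∀ Q : Finset F, Q.Nonempty → Q ≠ {0} → #Γ ≤ #(Q * Γ) := by
    intro Q hQ hQ0
    obtain ⟨a, ha, ha0⟩ := exists_mem_ne_zero hQ hQ0
    rw [mul_comm]
    exact card_le_card_mul_of_ne_zero Γ Q ha ha0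
  have hr1 : (shiftCount Q₁ Q₂ x : ℝ) ≤ 1 := by
    rcases h0 with h | h
    · have := shiftCount_le_left Q₁ Q₂ x
      rw [h, Finset.card_singleton] at this
      rw [h]; exact_mod_cast this
    · have := shiftCount_le_right Q₁ Q₂ x
      rw [h, Finset.card_singleton] at this
      rw [h]; exact_mod_cast this
  have hprod : (#Γ : ℝ) ≤ L * (#Q₁ * #Q₂) := by
    by_cases h1 : Q₁ = {0}
    · by_cases h2 : Q₂ = {0}
      · subst h1 h2
        obtain ⟨u, hu⟩ := Finset.card_pos.1 hr
        simp only [Finset.mem_filter, Finset.mem_singleton] at hu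
        exact absurd (by linear_combination hu.1 - hu.2) hx
      · have h3 : (#Γ : ℝ) ≤ #(Q₂ * Γ) := by exact_mod_cast hmul Q₂ hQ₂ h2
        refine h3.trans (hL₂.trans (mul_le_mul_of_nonneg_left ?_ (by linarith)))
        exact le_mul_of_one_le_left (by linarith) hq₁
    · have h3 : (#Γ : ℝ) ≤ #(Q₁ * Γ) := by exact_mod_cast hmul Q₁ hQ₁ h1
      refine h3.trans (hL₁.trans (mul_le_mul_of_nonneg_left ?_ (by linarith)))
      exact le_mul_of_one_le_right (by linarith) hq₂
  refine hr1.trans ?_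
  have h4 : (#Γ : ℝ) ^ e ≤ L * √((#Q₁ : ℝ) * #Q₂) := by
    calc (#Γ : ℝ) ^ e ≤ (#Γ : ℝ) ^ (1 / 2 : ℝ) := Real.rpow_le_rpow_of_exponent_le hG1 he
      _ = √(#Γ : ℝ) := (Real.sqrt_eq_rpow _).symm
      _ ≤ √(L ^ 2 * (#Q₁ * #Q₂)) := by
          refine Real.sqrt_le_sqrt (hprod.trans (mul_le_mul_of_nonneg_right ?_ (by positivity)))
          exact le_self_pow₀ hL (by norm_num)
      _ = _ := by rw [Real.sqrt_mul (by positivity), Real.sqrt_sq (by linarith)]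
  rw [Real.rpow_neg (by linarith), ← div_eq_mul_inv, le_div_iff₀ (by positivity), one_mul]
  exact h4

/-- The main case, where both sets contain a nonzero element. -/
theorem shiftCount_le_of_ne_zero (p : ℕ) [Fact p.Prime] (Q₁ Q₂ Γ : Finset (ZMod p))
    {x : ZMod p} (hx : x ≠ 0) {L M : ℝ} {k : ℕ} (hL : 1 ≤ L) (hM : 1 ≤ M)
    (hΓ : Γ.Nonempty) (hΓ0 : Γ ≠ {0}) (hQ₁ : Q₁.Nonempty) (hQ₂ : Q₂.Nonempty) (hQ0 : Q₂ ≠ {0})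
    (hp : (#(Q₂ * Γ ^ k) : ℝ) * #Γ ≤ p) (hL₂ : #(Q₂ * Γ) ≤ L * #Q₂)
    (hM₁ : #(Q₁ * Γ ^ (k + 2)) ≤ M * #Q₁) (hM₂ : #(Q₂ * Γ ^ (k + 2)) ≤ M * #Q₂)
    (hbig : #Q₂ * L * M ^ (2 ^ k + 1) * 2 ^ (3 * k + 1) * (Real.logb 2 #(Q₂ * Γ ^ k)) ^ k ≤
      (#Γ : ℝ) ^ ((k : ℝ) / 8 + 1 / 2)) :
    (shiftCount Q₁ Q₂ x : ℝ) ≤ 2 * L * M * √((#Q₁ : ℝ) * #Q₂) *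
      (#Γ : ℝ) ^ (-((2 : ℝ) ^ (-(k : ℝ)) / 2)) := by
  by_contra! hlt
  have hG1 : (1 : ℝ) ≤ #Γ := by exact_mod_cast hΓ.card_pos
  have hq₁ : (1 : ℝ) ≤ #Q₁ := by exact_mod_cast hQ₁.card_pos
  have hq₂ : (1 : ℝ) ≤ #Q₂ := by exact_mod_cast hQ₂.card_pos
  obtain ⟨γ, hγ, hγ0⟩ := exists_mem_ne_zero hΓ hΓ0
  obtain ⟨a, ha, ha0⟩ := exists_mem_ne_zero hQ₂ hQ0
  have hmono₁ := card_mul_pow_mono Q₁ Γ hγ hγ0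
  have hmono₂ := card_mul_pow_mono Q₂ Γ hγ hγ0
  have hQΓ : #Γ ≤ #(Q₂ * Γ) := by
    rw [mul_comm]; exact card_le_card_mul_of_ne_zero Γ Q₂ ha ha0
  set P : ℝ := (#Γ : ℝ) ^ ((2 : ℝ) ^ (-(k : ℝ)) / 2) with hP
  have hP0 : 0 < P := by rw [hP]; positivity
  rw [Real.rpow_neg (by linarith), ← hP, ← div_eq_mul_inv] at hlt
  set s₀ := √((#Q₁ : ℝ) * #Q₂) with hs₀
  have hs₀0 : 0 < s₀ := Real.sqrt_pos.2 (by positivity)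
  have hs₀2 : s₀ ^ 2 = #Q₁ * #Q₂ := Real.sq_sqrt (by positivity)
  have hrs : (shiftCount Q₁ Q₂ x : ℝ) ≤ s₀ := by
    refine abs_le_of_sq_le_sq' ?_ hs₀0.le |>.2
    rw [hs₀2, sq]
    exact mul_le_mul (Nat.cast_le.2 (shiftCount_le_left _ _ _))
      (Nat.cast_le.2 (shiftCount_le_right _ _ _)) (Nat.cast_nonneg _) (Nat.cast_nonneg _)
  have hLMP : 2 * L * M < P := by
    have := hlt.trans_le hrs
    rw [div_lt_iff₀ hP0] at this
    exact lt_of_mul_lt_mul_right (by linarith) hs₀0.le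
  have hLM : M ≤ L * M := le_mul_of_one_le_left (by linarith) hL
  have h2P : 2 < P := by linarith
  have hPpow : P ^ 2 ^ (k + 1) = #Γ := by
    rw [hP, ← Real.rpow_natCast, ← Real.rpow_mul (by linarith), Real.rpow_neg (by norm_num),
      Real.rpow_natCast]
    push_cast
    rw [pow_succ, show ((2 : ℝ) ^ k)⁻¹ / 2 * (2 ^ k * 2) = 1 by field_simp, Real.rpow_one]
  have hG2 : 2 < (#Γ : ℝ) := by
    rw [← hPpow]
    exact h2P.trans_le (le_self_pow₀ (by linarith) (by positivity))
  have hlog : 1 ≤ (Real.logb 2 #(Q₂ * Γ ^ k)) ^ k := by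
    rcases Nat.eq_zero_or_pos k with rfl | hk
    · simp
    refine one_le_pow₀ ?_
    rw [Real.le_logb_iff_rpow_le (by norm_num), Real.rpow_one]
    · have h1 : #(Q₂ * Γ ^ 1) ≤ #(Q₂ * Γ ^ k) := hmono₂ hk
      rw [pow_one] at h1
      have h2 : (#Γ : ℝ) ≤ #(Q₂ * Γ ^ k) := by exact_mod_cast hQΓ.trans h1
      linarith
    · exact_mod_cast (hQ₂.mul hΓ.pow).card_pos
  have hbig' : #Q₂ * L * M * 2 ^ (3 * k + 1) ≤ (#Γ : ℝ) ^ ((k : ℝ) / 8 + 1 / 2) := by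
    refine le_trans ?_ hbig
    refine le_trans ?_ (le_mul_of_one_le_right (by positivity) hlog)
    refine mul_le_mul_of_nonneg_right (mul_le_mul_of_nonneg_left ?_ (by positivity))
      (by positivity)
    exact le_self_pow₀ hM (by positivity)
  have hk : 5 ≤ k := by
    by_contra! hk
    have h1 : (#Γ : ℝ) ^ ((k : ℝ) / 8 + 1 / 2) ≤ (#Γ : ℝ) ^ (1 : ℝ) := by
      refine Real.rpow_le_rpow_of_exponent_le hG1 ?_
      have : (k : ℝ) ≤ 4 := by exact_mod_cast (by omega : k ≤ 4)
      linarith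
    rw [Real.rpow_one] at h1
    have h2 : (#Γ : ℝ) ≤ L * #Q₂ := le_trans (by exact_mod_cast hQΓ) hL₂
    have h3 : (2 : ℝ) ≤ M * 2 ^ (3 * k + 1) := by
      calc (2 : ℝ) ≤ 2 ^ (3 * k + 1) := le_self_pow₀ (by norm_num) (by omega)
        _ ≤ _ := le_mul_of_one_le_left (by positivity) hM
    have h4 := mul_le_mul h2 h3 (by norm_num) (by positivity)
    linarith
  obtain ⟨n, hn⟩ : ∃ n, n = (k + 4) / 8 := ⟨_, rfl⟩
  have hgcard : (#(Γ.erase 0) : ℝ) + 1 ≥ #Γ := by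
    have h1 := Finset.pred_card_le_card_erase (s := Γ) (a := (0 : ZMod p))
    exact_mod_cast (by omega : #Γ ≤ #(Γ.erase 0) + 1)
  have hGg : (#Γ : ℝ) ≤ 2 * #(Γ.erase 0) := by linarith
  have hcG : (#Γ : ℝ) ≤ #(Q₂ * Γ ^ k) := by
    have h1 : #(Q₂ * Γ ^ 1) ≤ #(Q₂ * Γ ^ k) := hmono₂ (by omega : 1 ≤ k)
    rw [pow_one] at h1
    exact_mod_cast hQΓ.trans h1
  have hcq : (#Q₂ : ℝ) ≤ #(Q₂ * Γ ^ k) := by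
    have h1 : #(Q₂ * Γ ^ 0) ≤ #(Q₂ * Γ ^ k) := hmono₂ (Nat.zero_le k)
    rw [pow_zero, mul_one] at h1
    exact_mod_cast h1
  set P' := P ^ 12 ^ (n - 1) with hP'
  have hPP' : P ≤ P' := le_self_pow₀ (by linarith) (by positivity)
  have hP'37 : P' ^ 37 ≤ #Γ := by
    rw [hP', ← pow_mul, ← hPpow, mul_comm]
    exact pow_le_pow_right₀ (by linarith) (thirty_seven_mul_pow_le hk hn)
  have hP'18 : 2 * P' ^ 18 ≤ P' ^ 37 := by
    have h1 : (2 : ℝ) ≤ P' ^ 19 := by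
      have : P' ≤ P' ^ 19 := le_self_pow₀ (by linarith) (by norm_num)
      linarith
    have := mul_le_mul_of_nonneg_right h1 (pow_pos (show 0 < P' by linarith) 18).le
    linarith [pow_add P' 19 18]
  have hP'18pos : 0 < P' ^ 18 := pow_pos (by linarith) 18
  have hfinal := card_pow_le_of_popular p Q₁ Q₂ Γ hx (m₁ := M * #Q₁) (m₂ := M * #Q₂)
    (s := M * s₀) (P := P) (c := #(Q₂ * Γ ^ k)) (n := n) (by omega)
    (le_trans (by exact_mod_cast hmono₁ (by omega : 3 ≤ k + 2)) hM₁)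
    (fun j _ hj => le_trans (by exact_mod_cast hmono₂ (by omega : j ≤ k + 2)) hM₂)
    (by positivity) (by positivity) (by rw [mul_pow, hs₀2]; ring) h2P.le
    (by linarith) (by linarith) (by
      have h1 : (#(Q₂ * Γ ^ k) : ℝ) * #(Γ.erase 0) ≤ p :=
        (mul_le_mul_of_nonneg_left (Nat.cast_le.2 (Finset.card_le_card (Finset.erase_subset _ _)))
          (Nat.cast_nonneg _)).trans hp
      exact_mod_cast h1) (by
      have hc0 : (0 : ℝ) < #(Q₂ * Γ ^ k) := by linarith
      have h36 : 0 < P' ^ 36 := pow_pos (by linarith) 36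
      calc M * #Q₂ * P' ^ 36 ≤ M * #(Q₂ * Γ ^ k) * P' ^ 36 := by gcongr
        _ = #(Q₂ * Γ ^ k) * (M * P' ^ 36) := by ring
        _ < #(Q₂ * Γ ^ k) * (P' * P' ^ 36) :=
            mul_lt_mul_of_pos_left (mul_lt_mul_of_pos_right (by linarith) h36) hc0
        _ = #(Q₂ * Γ ^ k) * P' ^ 37 := by ring
        _ ≤ #(Q₂ * Γ ^ k) * (2 * #(Γ.erase 0)) :=
            mul_le_mul_of_nonneg_left (hP'37.trans hGg) hc0.le
        _ = _ := by ring) (by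
      refine le_trans ?_ hlt.le
      refine div_le_div_of_nonneg_right ?_ hP0.le
      have := mul_le_mul_of_nonneg_right hLM hs₀0.le
      linarith)
  refine absurd hfinal (not_le.2 (two_mul_pow_gt hk hn hG1 hGg hP ?_))
  refine le_trans (mul_le_mul_of_nonneg_right ?_ (by positivity)) hbig'
  have := mul_le_mul_of_nonneg_right hLM (Nat.cast_nonneg #Q₂)
  linarith

end Main

/-- there is an absolute constant `C ≥ 1` such that the following holds.
Let `p` be an odd prime, `Γ, Q1, Q2 ⊆ F_p` nonempty with `Γ ≠ {0}`, `M_* ≥ 1`, `M ≥ 1`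
reals and `k ≥ 0` an integer such that for `j = 1,2`:
`|Q_jΓ^{k+2}||Q_jΓ^{k+1}||Γ| ≤ p²`, `|Q_jΓ^k||Γ| ≤ p`, `|Q_jΓ| ≤ M_*|Q_j|`,
`|Q_jΓ^{k+2}| ≤ M|Q_j|`, and
`|Γ|^{k/8+1/2} ≥ |Q_j| M_* M^{2^k+1} 2^{3k+1} C^{(k+4)/4} (log|Q_jΓ^k|)^k`.
Then for every `x ≠ 0`, `|Q1 ∩ (Q2+x)| ≤ 2 M_* M √(|Q1||Q2|) |Γ|^{−2^{−k}/2}`. -/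
theorem stmt_16 :
    ∃ C : ℝ, 1 ≤ C ∧
      ∀ (p : ℕ) [Fact p.Prime], Odd p →
        ∀ (Γ Q1 Q2 : Finset (ZMod p)),
          Γ.Nonempty → Q1.Nonempty → Q2.Nonempty → Γ ≠ {0} →
          ∀ (Mstar M : ℝ), 1 ≤ Mstar → 1 ≤ M →
          ∀ k : ℕ,
            (∀ Q ∈ [Q1, Q2],
              ((Q * Γ ^ (k + 2)).card : ℝ) * (Q * Γ ^ (k + 1)).card * Γ.card ≤ (p : ℝ) ^ 2 ∧
              ((Q * Γ ^ k).card : ℝ) * Γ.card ≤ (p : ℝ) ∧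
              ((Q * Γ).card : ℝ) ≤ Mstar * Q.card ∧
              ((Q * Γ ^ (k + 2)).card : ℝ) ≤ M * Q.card ∧
              (Q.card : ℝ) * Mstar * M ^ (2 ^ k + 1) * 2 ^ (3 * k + 1) *
                  C ^ (((k : ℝ) + 4) / 4) * (Real.logb 2 (Q * Γ ^ k).card) ^ k ≤
                (Γ.card : ℝ) ^ ((k : ℝ) / 8 + 1 / 2)) →
            ∀ x : ZMod p, x ≠ 0 →
              ((Q1 ∩ (Q2 + {x})).card : ℝ) ≤
                2 * Mstar * M * Real.sqrt ((Q1.card : ℝ) * Q2.card) *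
                  (Γ.card : ℝ) ^ (-((2 : ℝ) ^ (-(k : ℝ)) / 2)) := by
  refine ⟨1, le_rfl, ?_⟩
  intro p _ _ Γ Q1 Q2 hΓ hQ1 hQ2 hΓ0 Mstar M hMs hM k h x hx
  obtain ⟨-, -, hL1, hM1, -⟩ := h Q1 (by simp)
  obtain ⟨-, hp2, hL2, hM2, hbig⟩ := h Q2 (by simp)
  rw [card_inter_add_singleton]
  by_cases h0 : Q1 = {0} ∨ Q2 = {0}
  · have he : (2 : ℝ) ^ (-(k : ℝ)) / 2 ≤ 1 / 2 := by
      have : (2 : ℝ) ^ (-(k : ℝ)) ≤ 1 :=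
        Real.rpow_le_one_of_one_le_of_nonpos (by norm_num) (by simp)
      linarith
    refine (shiftCount_le_of_eq_zero Q1 Q2 Γ hx hMs he hΓ hQ1 hQ2 hL1 hL2 h0).trans ?_
    refine mul_le_mul_of_nonneg_right (mul_le_mul_of_nonneg_right ?_ (by positivity))
      (by positivity)
    nlinarith
  · push Not at h0
    rw [Real.one_rpow, mul_one] at hbig
    exact shiftCount_le_of_ne_zero p Q1 Q2 Γ hx hMs hM hΓ hΓ0 hQ1 hQ2 h0.2 hp2 hL2 hM1 hM2 hbig
end

section
/- For every real κ with 0 < κ < 2^{−16}/40 there is a constant c = c(κ) > 0 such that for every injective function φ : R → R and every finite set A ⊂ R with |A| ≥ 2, one has |R[A]·φ(A)| ≥ c · |A|^{2+κ}, where R[A]·φ(A) is the product set of R[A] and the image φ(A). In particular, taking φ to be the identity, |{ (y−x)w/(z−x) : x, y, z, w ∈ A, x ≠ z }| ≥ c · |A|^{2+κ}. -/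
open Finset Pointwise

/-- `R[A] = {(a1−a)/(a2−a) : a, a1, a2 ∈ A, a2 ≠ a}`. -/
noncomputable def Rset (A : Finset ℝ) : Finset ℝ :=
  ((A ×ˢ A ×ˢ A).filter fun t => t.2.2 ≠ t.1).image
    fun t => (t.2.1 - t.1) / (t.2.2 - t.1)

/-- The set `{(y−x)w/(z−x) : x, y, z, w ∈ A, x ≠ z}`. -/
noncomputable def RsetMulA (A : Finset ℝ) : Finset ℝ :=
  ((A ×ˢ A ×ˢ A ×ˢ A).filter fun t => t.1 ≠ t.2.2.1).image
    fun t => (t.2.1 - t.1) * t.2.2.2 / (t.2.2.1 - t.1)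

theorem card_le_card_add_card_collisions {α β : Type*} [DecidableEq α] [DecidableEq β]
    (S : Finset α) (T : Finset β) (h : α → β) (hT : ∀ x ∈ S, h x ∈ T) :
    #S ≤ #T + #{p ∈ S ×ˢ S | p.1 ≠ p.2 ∧ h p.1 = h p.2} := by
  classical
  rcases S.eq_empty_or_nonempty with rfl | ⟨x₀, hx₀⟩
  · simp
  have : Nonempty α := ⟨x₀⟩
  set g := Function.invFunOn h (S : Set α) with hg
  have key : ∀ x ∈ S, g (h x) ∈ S ∧ h (g (h x)) = h x := fun x hx =>
    ⟨Function.invFunOn_mem ⟨x, hx, rfl⟩, Function.invFunOn_eq ⟨x, hx, rfl⟩⟩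
  rw [← card_filter_add_card_filter_not (s := S) (fun x => x = g (h x))]
  refine Nat.add_le_add ?_ ?_
  · refine card_le_card_of_injOn h (fun x hx => hT x (mem_filter.1 hx).1) ?_
    intro x hx y hy hxy
    rw [(mem_filter.1 hx).2, (mem_filter.1 hy).2, hxy]
  · refine card_le_card_of_injOn (fun x => (x, g (h x))) ?_ ?_
    · intro x hx
      obtain ⟨hx, hne⟩ := mem_filter.1 hx
      exact mem_filter.2 ⟨mem_product.2 ⟨hx, (key x hx).1⟩, hne, (key x hx).2.symm⟩
    · intro x _ y _ hxy
      exact (Prod.mk.inj hxy).1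

theorem card_sq_le_card_mul_card_collisions {α β : Type*} [DecidableEq β]
    (S : Finset α) (T : Finset β) (h : α → β) (hT : ∀ x ∈ S, h x ∈ T) :
    #S ^ 2 ≤ #T * #{p ∈ S ×ˢ S | h p.1 = h p.2} := by
  have h1 : #S = ∑ j ∈ T, #{x ∈ S | h x = j} := card_eq_sum_card_fiberwise hT
  have h2 : #{p ∈ S ×ˢ S | h p.1 = h p.2} = ∑ j ∈ T, #{x ∈ S | h x = j} ^ 2 := by
    rw [card_eq_sum_card_fiberwise (f := fun p => h p.1) (t := T)]
    · refine sum_congr rfl fun j _ => ?_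
      rw [sq, ← card_product]
      congr 1
      ext p
      simp only [mem_filter, mem_product]
      grind
    · intro p hp
      exact hT _ (mem_product.1 (mem_filter.1 hp).1).1
  rw [h2, h1]
  exact sq_sum_le_card_mul_sum_sq

/-- The index of the block containing `x` when `X`, in increasing order, is cut into blocks of
`D` consecutive elements. -/
noncomputable def blockIndex (X : Finset ℝ) (D : ℕ) (x : ℝ) : ℕ := #{z ∈ X | z < x} / D

theorem blockIndex_mono (X : Finset ℝ) (D : ℕ) : Monotone (blockIndex X D) := fun _ _ hxy =>
  Nat.div_le_div_right (card_le_card fun _ hz =>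
    mem_filter.2 ⟨(mem_filter.1 hz).1, (mem_filter.1 hz).2.trans_le hxy⟩)

theorem blockIndex_le (X : Finset ℝ) (D : ℕ) (x : ℝ) : blockIndex X D x ≤ #X / D :=
  Nat.div_le_div_right (card_filter_le _ _)

theorem card_blockIndex_eq_le (X : Finset ℝ) {D : ℕ} (hD : 0 < D) (j : ℕ) :
    #{x ∈ X | blockIndex X D x = j} ≤ D := by
  have hcard : #(Ico (j * D) (j * D + D)) = D := by simp
  refine (card_le_card_of_injOn (fun x => #{z ∈ X | z < x}) ?_ ?_).trans hcard.le
  · intro x hx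
    have hx := (mem_filter.1 hx).2
    unfold blockIndex at hx
    rw [Nat.div_eq_iff hD] at hx
    simp only [coe_Ico, Set.mem_Ico]
    omega
  · have hlt : ∀ x ∈ X, ∀ y : ℝ, x < y → #{z ∈ X | z < x} < #{z ∈ X | z < y} := by
      intro x hx y hxy
      refine card_lt_card (ssubset_iff_of_subset ?_ |>.2 ⟨x, ?_, ?_⟩)
      · exact fun z hz => mem_filter.2 ⟨(mem_filter.1 hz).1, (mem_filter.1 hz).2.trans hxy⟩
      · exact mem_filter.2 ⟨hx, hxy⟩
      · simp
    intro x hx y hy hxy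
    rcases lt_trichotomy x y with h | h | h
    · exact absurd hxy (hlt x (mem_filter.1 hx).1 y h).ne
    · exact h
    · exact absurd hxy (hlt y (mem_filter.1 hy).1 x h).ne'

theorem card_same_block_le (X : Finset ℝ) {D : ℕ} (hD : 0 < D) :
    #{p ∈ X ×ˢ X | blockIndex X D p.1 = blockIndex X D p.2} ≤ #X * D := by
  rw [card_eq_sum_card_fiberwise (f := Prod.fst) (t := X)
    fun p hp => (mem_product.1 (mem_filter.1 hp).1).1]
  refine (sum_le_card_nsmul _ _ D fun x _ => ?_).trans_eq (smul_eq_mul _ _)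
  refine (card_le_card_of_injOn Prod.snd ?_ ?_).trans
    (card_blockIndex_eq_le X hD (blockIndex X D x))
  · intro p hp
    simp only [coe_filter, mem_filter, mem_product, Set.mem_ofPred_eq] at hp ⊢
    grind
  · intro p hp q hq hpq
    have hp := (mem_filter.1 hp).2
    have hq := (mem_filter.1 hq).2
    exact Prod.ext (hp.trans hq.symm) hpq

/-- The points of a line on a grid meet few blocks, so most of them share a block with another. -/
theorem card_line_le (X Y : Finset ℝ) (D : ℕ) (s t : ℝ) :
    #{x ∈ X | s * x + t ∈ Y} ≤ (#X / D + #Y / D + 1) +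
      #{p ∈ {x ∈ X | s * x + t ∈ Y} ×ˢ {x ∈ X | s * x + t ∈ Y} | p.1 ≠ p.2 ∧
        blockIndex X D p.1 = blockIndex X D p.2 ∧
        blockIndex Y D (s * p.1 + t) = blockIndex Y D (s * p.2 + t)} := by
  set S : Finset ℝ := {x ∈ X | s * x + t ∈ Y}
  have main : ∀ h : ℝ → ℕ, (∀ x, h x ≤ #X / D + #Y / D) →
      (∀ x y, x ≤ y → h x = h y → blockIndex X D x = blockIndex X D y ∧
        blockIndex Y D (s * x + t) = blockIndex Y D (s * y + t)) →
      #S ≤ (#X / D + #Y / D + 1) + #{p ∈ S ×ˢ S | p.1 ≠ p.2 ∧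
        blockIndex X D p.1 = blockIndex X D p.2 ∧
        blockIndex Y D (s * p.1 + t) = blockIndex Y D (s * p.2 + t)} := by
    intro h hle hinj
    have := card_le_card_add_card_collisions S (range (#X / D + #Y / D + 1)) h
      fun x _ => mem_range.2 (Nat.lt_succ_of_le (hle x))
    rw [card_range] at this
    refine this.trans (Nat.add_le_add_left (card_le_card fun p hp => ?_) _)
    obtain ⟨hp, hne, heq⟩ := mem_filter.1 hp
    refine mem_filter.2 ⟨hp, hne, ?_⟩
    rcases le_total p.1 p.2 with hle | hle
    · exact hinj _ _ hle heq
    · exact ⟨(hinj _ _ hle heq.symm).1.symm, (hinj _ _ hle heq.symm).2.symm⟩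
  rcases le_or_gt 0 s with hs | hs
  · refine main (fun x => blockIndex X D x + blockIndex Y D (s * x + t))
      (fun x => add_le_add (blockIndex_le X D x) (blockIndex_le Y D _)) fun x y hxy heq => ?_
    have h1 := blockIndex_mono X D hxy
    have h2 := blockIndex_mono Y D (show s * x + t ≤ s * y + t by gcongr)
    omega
  · refine main (fun x => blockIndex X D x + (#Y / D - blockIndex Y D (s * x + t)))
      (fun x => add_le_add (blockIndex_le X D x) (Nat.sub_le _ _)) fun x y hxy heq => ?_
    have h1 := blockIndex_mono X D hxy
    have h2 := blockIndex_mono Y D (show s * y + t ≤ s * x + t by nlinarith)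
    have h3 := blockIndex_le Y D (s * x + t)
    omega

/-- A Szemerédi–Trotter type bound for a family of lines, each repeated at most `W` times, and
a Cartesian product. -/
theorem sum_card_line_le {ι : Type*} (C : Finset ι) (s t : ι → ℝ) (X Y : Finset ℝ) {D W : ℕ}
    (hD : 0 < D) (hW : ∀ u v, #{c ∈ C | s c = u ∧ t c = v} ≤ W) :
    ∑ c ∈ C, #{x ∈ X | s c * x + t c ∈ Y} ≤
      #C * (#X / D + #Y / D + 1) + #X * D * (#Y * D) * W := by
  classical
  set Q : Finset ((ℝ × ℝ) × (ℝ × ℝ)) :=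
    {p ∈ X ×ˢ X | blockIndex X D p.1 = blockIndex X D p.2} ×ˢ
      {p ∈ Y ×ˢ Y | blockIndex Y D p.1 = blockIndex Y D p.2} with hQ
  have hQcard : #Q ≤ #X * D * (#Y * D) := by
    rw [hQ, card_product]
    exact Nat.mul_le_mul (card_same_block_le X hD) (card_same_block_le Y hD)
  let inc : ι → (ℝ × ℝ) × (ℝ × ℝ) → Prop := fun c q =>
    q.1.1 ≠ q.1.2 ∧ s c * q.1.1 + t c = q.2.1 ∧ s c * q.1.2 + t c = q.2.2
  have hline : ∀ c ∈ C, #{x ∈ X | s c * x + t c ∈ Y} ≤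
      (#X / D + #Y / D + 1) + #(bipartiteAbove inc Q c) := by
    intro c _
    refine (card_line_le X Y D (s c) (t c)).trans (Nat.add_le_add_left ?_ _)
    refine card_le_card_of_injOn (fun p => (p, (s c * p.1 + t c, s c * p.2 + t c))) ?_ ?_
    · intro p hp
      simp only [coe_filter, mem_filter, mem_product, Set.mem_ofPred_eq, bipartiteAbove, hQ,
        inc] at hp ⊢
      tauto
    · intro p _ q _ hpq
      exact (Prod.mk.inj hpq).1
  refine (sum_le_sum hline).trans ?_
  rw [sum_add_distrib, sum_const, smul_eq_mul,
    sum_card_bipartiteAbove_eq_sum_card_bipartiteBelow]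
  refine Nat.add_le_add_left ?_ _
  refine (sum_le_card_nsmul _ _ W fun q _ => ?_).trans
    ((smul_eq_mul _ _).trans_le (Nat.mul_le_mul_right _ hQcard))
  refine (card_le_card fun c hc => ?_).trans
    (hW ((q.2.2 - q.2.1) / (q.1.2 - q.1.1))
      (q.2.1 - (q.2.2 - q.2.1) / (q.1.2 - q.1.1) * q.1.1))
  obtain ⟨hc, hne, h1, h2⟩ := mem_filter.1 hc
  have hs : s c = (q.2.2 - q.2.1) / (q.1.2 - q.1.1) := by
    rw [eq_div_iff (sub_ne_zero.2 hne.symm)]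
    linear_combination h2 - h1
  refine mem_filter.2 ⟨hc, hs, ?_⟩
  rw [← hs]
  linear_combination h1

/-- The number of points of `A × A` on the line `y = l.1 * x + l.2`. -/
noncomputable def gridCount (A : Finset ℝ) (l : ℝ × ℝ) : ℕ := #{x ∈ A | l.1 * x + l.2 ∈ A}

theorem gridCount_le (A : Finset ℝ) (l : ℝ × ℝ) : gridCount A l ≤ #A := card_filter_le _ _

theorem card_rich_lines_le (A : Finset ℝ) (L : Finset (ℝ × ℝ)) {k : ℕ} (hk : 2 ≤ k)
    (hkn : k ≤ #A) : k ^ 3 * #{l ∈ L | k ≤ gridCount A l} ≤ 324 * #A ^ 4 := by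
  set n := #A
  set D := n * 8 / k + 1
  set M := #{l ∈ L | k ≤ gridCount A l}
  have h1 : k * M ≤ M * (n / D + n / D + 1) + n * D * (n * D) * 1 := by
    refine le_trans ?_ (sum_card_line_le {l ∈ L | k ≤ gridCount A l} Prod.fst Prod.snd A A
      (Nat.succ_pos (n * 8 / k)) (W := 1) fun u v => ?_)
    · rw [mul_comm]
      exact (smul_eq_mul _ _).symm.trans_le
        (card_nsmul_le_sum _ _ _ fun l hl => (mem_filter.1 hl).2)
    · refine card_le_one.2 fun a ha b hb => ?_
      have ha := (mem_filter.1 ha).2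
      have hb := (mem_filter.1 hb).2
      exact Prod.ext (ha.1.trans hb.1.symm) (ha.2.trans hb.2.symm)
  have h2 : n / D * 8 ≤ k := by
    have hlt : n * 8 < k * D := by
      have := Nat.lt_mul_div_succ (n * 8) (show 0 < k by omega)
      simpa [D] using this
    have h3 : n / D * D ≤ n := Nat.div_mul_le_self n D
    have h4 : (n / D * 8) * D ≤ k * D := by nlinarith
    exact Nat.le_of_mul_le_mul_right h4 (Nat.succ_pos _)
  have h3 : k * D ≤ 9 * n := by
    have : k * (n * 8 / k) ≤ n * 8 := Nat.mul_div_le _ _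
    have : k * D = k * (n * 8 / k) + k := by simp only [D]; ring
    omega
  have h4 : M * (8 * (n / D + n / D + 1)) ≤ M * (6 * k) := Nat.mul_le_mul_left _ (by omega)
  have h5 : k * M ≤ 4 * (n * D) ^ 2 := by nlinarith
  calc k ^ 3 * M = k ^ 2 * (k * M) := by ring
    _ ≤ k ^ 2 * (4 * (n * D) ^ 2) := Nat.mul_le_mul_left _ h5
    _ = 4 * n ^ 2 * (k * D) ^ 2 := by ring
    _ ≤ 4 * n ^ 2 * (9 * n) ^ 2 := by gcongr
    _ = 324 * n ^ 4 := by ring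

theorem pow_three_le_sum (i : ℕ) : i ^ 3 ≤ ∑ k ∈ Icc 1 i, 3 * k ^ 2 := by
  induction i with
  | zero => simp
  | succ i ih =>
    rw [sum_Icc_succ_top (by omega)]
    have : (i + 1) ^ 3 + (3 * i + 2) = i ^ 3 + 3 * (i + 1) ^ 2 := by ring
    omega

theorem sum_gridCount_pow_three_le (A : Finset ℝ) (L : Finset (ℝ × ℝ))
    (hL : ∀ l ∈ L, 2 ≤ gridCount A l) :
    (∑ l ∈ L, (gridCount A l : ℝ) ^ 3) ≤ 972 * (#A : ℝ) ^ 4 * (1 + Real.log #A) := by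
  set n := #A with hn
  have h1 : ∑ l ∈ L, gridCount A l ^ 3 ≤
      ∑ k ∈ Icc 1 n, 3 * k ^ 2 * #{l ∈ L | k ≤ gridCount A l} := by
    calc ∑ l ∈ L, gridCount A l ^ 3
        ≤ ∑ l ∈ L, ∑ k ∈ Icc 1 n, if k ≤ gridCount A l then 3 * k ^ 2 else 0 := by
          refine sum_le_sum fun l _ => (pow_three_le_sum _).trans ?_
          rw [← sum_filter]
          refine sum_le_sum_of_subset fun k hk => ?_
          have := gridCount_le A l
          simp only [mem_filter, mem_Icc] at hk ⊢
          omega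
      _ = ∑ k ∈ Icc 1 n, 3 * k ^ 2 * #{l ∈ L | k ≤ gridCount A l} := by
          rw [sum_comm]
          refine sum_congr rfl fun k _ => ?_
          rw [← sum_filter, sum_const, smul_eq_mul, mul_comm]
  have h2 : ∀ k ∈ Icc 1 n, k ^ 3 * #{l ∈ L | k ≤ gridCount A l} ≤ 324 * n ^ 4 := by
    intro k hk
    obtain ⟨hk1, hkn⟩ := mem_Icc.1 hk
    rcases hk1.eq_or_lt with rfl | hk2
    · rcases L.eq_empty_or_nonempty with rfl | ⟨l, hl⟩
      · simp
      · have h := card_rich_lines_le A L le_rfl ((hL l hl).trans (gridCount_le A l))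
        rw [filter_true_of_mem hL] at h
        rw [filter_true_of_mem fun l hl => (hL l hl).trans' one_le_two]
        linarith
    · exact card_rich_lines_le A L hk2 hkn
  calc (∑ l ∈ L, (gridCount A l : ℝ) ^ 3)
      ≤ ∑ k ∈ Icc 1 n, 3 * (k : ℝ) ^ 2 * #{l ∈ L | k ≤ gridCount A l} := by exact_mod_cast h1
    _ ≤ ∑ k ∈ Icc 1 n, 972 * (n : ℝ) ^ 4 * (k : ℝ)⁻¹ := by
        refine sum_le_sum fun k hk => ?_
        have hk0 : (0 : ℝ) < k := by exact_mod_cast (mem_Icc.1 hk).1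
        have h3 : (k : ℝ) ^ 3 * #{l ∈ L | k ≤ gridCount A l} ≤ 324 * (n : ℝ) ^ 4 := by
          exact_mod_cast h2 k hk
        rw [← div_eq_mul_inv, le_div_iff₀ hk0]
        linarith
    _ = 972 * (n : ℝ) ^ 4 * (harmonic n : ℝ) := by
        rw [← mul_sum, harmonic_eq_sum_Icc]
        push_cast
        rfl
    _ ≤ 972 * (n : ℝ) ^ 4 * (1 + Real.log n) := by
        gcongr
        exact harmonic_le_one_add_log n

/-- Coincidences among the ratios `(a₁ - a) / (a₂ - a)` are collinear triples in `A × A`. -/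
theorem card_ratio_collisions_le (A : Finset ℝ) (S : Finset (ℝ × ℝ × ℝ))
    (hS : ∀ t ∈ S, (t.1 ∈ A ∧ t.2.1 ∈ A ∧ t.2.2 ∈ A) ∧ t.2.2 ≠ t.1) :
    (#{p ∈ S ×ˢ S | (p.1.2.1 - p.1.1) / (p.1.2.2 - p.1.1) =
      (p.2.2.1 - p.2.1) / (p.2.2.2 - p.2.1)} : ℝ) ≤
      972 * (#A : ℝ) ^ 4 * (1 + Real.log #A) := by
  classical
  set P := {p ∈ S ×ˢ S | (p.1.2.1 - p.1.1) / (p.1.2.2 - p.1.1) =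
      (p.2.2.1 - p.2.1) / (p.2.2.2 - p.2.1)}
  let line : (ℝ × ℝ × ℝ) × (ℝ × ℝ × ℝ) → ℝ × ℝ := fun p =>
    ((p.2.2.2 - p.2.1) / (p.1.2.2 - p.1.1),
      p.2.1 - (p.2.2.2 - p.2.1) / (p.1.2.2 - p.1.1) * p.1.1)
  have hon : ∀ p ∈ P, (line p).1 * p.1.1 + (line p).2 = p.2.1 ∧
      (line p).1 * p.1.2.1 + (line p).2 = p.2.2.1 ∧
      (line p).1 * p.1.2.2 + (line p).2 = p.2.2.2 := by
    intro p hp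
    obtain ⟨hp, heq⟩ := mem_filter.1 hp
    have h1 := sub_ne_zero.2 (hS _ (mem_product.1 hp).1).2
    have h2 := sub_ne_zero.2 (hS _ (mem_product.1 hp).2).2
    rw [div_eq_div_iff h1 h2] at heq
    refine ⟨by simp [line], ?_, ?_⟩
    · simp only [line]
      field_simp
      linear_combination heq
    · simp only [line]
      field_simp
      ring
  have hmem : ∀ p ∈ P, (p.1.1 ∈ A ∧ p.1.2.1 ∈ A ∧ p.1.2.2 ∈ A) ∧
      (p.2.1 ∈ A ∧ p.2.2.1 ∈ A ∧ p.2.2.2 ∈ A) ∧ p.1.2.2 ≠ p.1.1 := by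
    intro p hp
    have hp := mem_product.1 (mem_filter.1 hp).1
    exact ⟨(hS _ hp.1).1, (hS _ hp.2).1, (hS _ hp.1).2⟩
  refine le_trans ?_ (sum_gridCount_pow_three_le A (P.image line) ?_)
  · rw [card_eq_sum_card_image line P]
    push_cast
    refine sum_le_sum fun l _ => ?_
    norm_cast
    set T := {x ∈ A | l.1 * x + l.2 ∈ A} with hT
    have hcard : #(T ×ˢ T ×ˢ T) = gridCount A l ^ 3 := by
      rw [card_product, card_product]
      simp only [gridCount, ← hT]
      ring
    rw [← hcard]
    refine card_le_card_of_injOn Prod.fst ?_ ?_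
    · intro p hp
      obtain ⟨hpP, rfl⟩ := mem_filter.1 hp
      obtain ⟨h1, h2, -⟩ := hmem p hpP
      obtain ⟨e1, e2, e3⟩ := hon p hpP
      simp only [coe_product, Set.mem_prod, mem_coe, hT, mem_filter, e1, e2, e3]
      tauto
    · intro p hp q hq hpq
      obtain ⟨hp, hpl⟩ := mem_filter.1 hp
      obtain ⟨hq, hql⟩ := mem_filter.1 hq
      obtain ⟨e1, e2, e3⟩ := hon p hp
      obtain ⟨f1, f2, f3⟩ := hon q hq
      rw [hpl] at e1 e2 e3
      rw [hql, ← hpq] at f1 f2 f3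
      exact Prod.ext hpq (Prod.ext (e1.symm.trans f1)
        (Prod.ext (e2.symm.trans f2) (e3.symm.trans f3)))
  · intro l hl
    obtain ⟨p, hp, rfl⟩ := mem_image.1 hl
    obtain ⟨h1, h2, h3⟩ := hmem p hp
    obtain ⟨e1, e2, e3⟩ := hon p hp
    exact one_lt_card.2 ⟨p.1.1, mem_filter.2 ⟨h1.1, e1.symm ▸ h2.1⟩, p.1.2.2,
      mem_filter.2 ⟨h1.2.2, e3.symm ▸ h2.2.2⟩, h3.symm⟩

theorem card_Rset_ge (A : Finset ℝ) (hA : 2 ≤ #A) :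
    (#A : ℝ) ^ (1.99 : ℝ) / 400000 ≤ #(Rset A) := by
  set n := #A with hn
  set S := (A ×ˢ A ×ˢ A).filter fun t => t.2.2 ≠ t.1 with hSdef
  have hScard : #S + n ^ 2 = n ^ 3 := by
    have h1 := card_filter_add_card_filter_not (s := A ×ˢ A ×ˢ A) (fun t => t.2.2 ≠ t.1)
    have h2 : #{t ∈ A ×ˢ A ×ˢ A | ¬ t.2.2 ≠ t.1} = n ^ 2 := by
      rw [sq, hn, ← card_product]
      refine card_bij' (fun t _ => (t.1, t.2.1)) (fun t _ => (t.1, t.2, t.1)) ?_ ?_ ?_ ?_ <;>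
        simp +contextual [Prod.ext_iff]
    rw [h2, card_product, card_product] at h1
    rw [hSdef, h1]
    ring
  have hcs : (#S : ℝ) ^ 2 ≤ #(Rset A) * (972 * (n : ℝ) ^ 4 * (1 + Real.log n)) := by
    have h := card_sq_le_card_mul_card_collisions S (Rset A)
      (fun t => (t.2.1 - t.1) / (t.2.2 - t.1)) fun t ht => mem_image_of_mem _ ht
    rw [← Nat.cast_le (α := ℝ), Nat.cast_pow, Nat.cast_mul] at h
    refine h.trans ?_
    refine mul_le_mul_of_nonneg_left (card_ratio_collisions_le A S fun t ht => ?_)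
      (Nat.cast_nonneg _)
    simp only [hSdef, mem_filter, mem_product] at ht
    exact ht
  have hn2 : (2 : ℝ) ≤ n := by exact_mod_cast hA
  have hn0 : (0 : ℝ) < n := by linarith
  have hS : (n : ℝ) ^ 3 / 2 ≤ #S := by
    have : (#S : ℝ) + n ^ 2 = n ^ 3 := by exact_mod_cast hScard
    nlinarith [sq_nonneg (n : ℝ)]
  have hlog : 1 + Real.log n ≤ 101 * (n : ℝ) ^ (0.01 : ℝ) := by
    have h1 := Real.log_natCast_le_rpow_div n (show (0 : ℝ) < 0.01 by norm_num)
    have h2 := Real.one_le_rpow (show (1 : ℝ) ≤ n by linarith) (show (0 : ℝ) ≤ 0.01 by norm_num)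
    rw [le_div_iff₀ (by norm_num)] at h1
    linarith
  have hsq : ((n : ℝ) ^ 3 / 2) ^ 2 ≤ (#S : ℝ) ^ 2 := by gcongr
  have hfin : (n : ℝ) ^ 2 ≤ #(Rset A) * (400000 * (n : ℝ) ^ (0.01 : ℝ)) := by
    have h3 : #(Rset A) * (972 * (n : ℝ) ^ 4 * (1 + Real.log n)) ≤
        #(Rset A) * (972 * (n : ℝ) ^ 4 * (101 * (n : ℝ) ^ (0.01 : ℝ))) := by gcongr
    have h4 : (n : ℝ) ^ 2 * n ^ 4 ≤
        #(Rset A) * (4 * 972 * 101 * (n : ℝ) ^ (0.01 : ℝ)) * n ^ 4 := by linarith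
    have h5 := le_of_mul_le_mul_right h4 (by positivity)
    refine h5.trans ?_
    gcongr
    norm_num
  have hpow : (n : ℝ) ^ (1.99 : ℝ) * (n : ℝ) ^ (0.01 : ℝ) = (n : ℝ) ^ 2 := by
    rw [← Real.rpow_add hn0, ← Real.rpow_natCast]
    norm_num
  rw [← hpow] at hfin
  have hpos : 0 < (n : ℝ) ^ (0.01 : ℝ) := Real.rpow_pos_of_pos hn0 _
  rw [div_le_iff₀ (by norm_num)]
  refine le_of_mul_le_mul_right ?_ hpos
  linarith

/-- The triples `(b, c, x)` with `b, c ∈ B`, `x ∈ R` and `b * x = c * v`. -/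
noncomputable def dilates (R B : Finset ℝ) (v : ℝ) : Finset (ℝ × ℝ × ℝ) :=
  {q ∈ B ×ˢ B ×ˢ R | q.1 * q.2.2 = q.2.1 * v}

theorem card_sq_mul_card_sq_le_sum_card_dilates (R B D : Finset ℝ) (hD : D ⊆ R) :
    #D ^ 2 * #B ^ 2 ≤ #(R * B) * ∑ v ∈ D, #(dilates R B v) := by
  have h := card_sq_le_card_mul_card_collisions (D ×ˢ B) (R * B) (fun q => q.1 * q.2)
    fun q hq => mul_mem_mul (hD (mem_product.1 hq).1) (mem_product.1 hq).2
  rw [card_product, mul_pow] at h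
  refine h.trans (Nat.mul_le_mul_left _ ?_)
  rw [← card_sigma]
  refine card_le_card_of_injOn (fun p => ⟨p.1.1, p.2.2, p.1.2, p.2.1⟩) ?_ ?_
  · intro p hp
    simp only [coe_filter, mem_product, Set.mem_ofPred_eq] at hp
    obtain ⟨⟨⟨h1, h2⟩, h3, h4⟩, h5⟩ := hp
    simp only [coe_sigma, Set.mem_sigma_iff, mem_coe, dilates, mem_filter, mem_product]
    exact ⟨h1, ⟨h4, h2, hD h3⟩, by linarith⟩
  · rintro ⟨⟨a, b⟩, c, d⟩ _ ⟨⟨a', b'⟩, c', d'⟩ _ hpq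
    simp only [Sigma.mk.injEq, heq_eq_eq, Prod.mk.injEq] at hpq ⊢
    tauto

theorem card_le_two_mul_card_popular (R B : Finset ℝ) (hB : B.Nonempty)
    (hR : ∀ x ∈ R, 1 - x ∈ R) {τ : ℝ} (hτ : 4 * #(R * B) * τ ≤ #R * (#B : ℝ) ^ 2) :
    (#R : ℝ) ≤ 2 * #{v ∈ R | τ ≤ #(dilates R B v) ∧ τ ≤ #(dilates R B (1 - v))} := by
  set D := {v ∈ R | (#(dilates R B v) : ℝ) < τ} with hDdef
  set G := {v ∈ R | τ ≤ #(dilates R B v) ∧ τ ≤ #(dilates R B (1 - v))} with hG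
  have hm : (0 : ℝ) < #B := by exact_mod_cast hB.card_pos
  have hD : 4 * (#D : ℝ) ≤ #R := by
    rcases D.eq_empty_or_nonempty with h | h
    · simp [h]
    · have hd : (0 : ℝ) < #D := by exact_mod_cast h.card_pos
      have h1 : (#D : ℝ) ^ 2 * #B ^ 2 ≤ #(R * B) * ∑ v ∈ D, (#(dilates R B v) : ℝ) := by
        exact_mod_cast card_sq_mul_card_sq_le_sum_card_dilates R B D (filter_subset _ _)
      have h2 : ∑ v ∈ D, (#(dilates R B v) : ℝ) ≤ #D * τ := by
        rw [← nsmul_eq_mul]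
        exact sum_le_card_nsmul _ _ _ fun v hv => (mem_filter.1 hv).2.le
      have h3 : (#(R * B) : ℝ) * ∑ v ∈ D, (#(dilates R B v) : ℝ) ≤ #(R * B) * (#D * τ) := by
        gcongr
      have h4 : 4 * (#D : ℝ) * (#D * #B ^ 2) ≤ #R * (#D * #B ^ 2) := by nlinarith
      exact le_of_mul_le_mul_right h4 (by positivity)
  have hcover : #R ≤ #G + (#D + #D) := by
    have hsub : R ⊆ G ∪ (D ∪ D.image fun v => 1 - v) := by
      intro v hv
      simp only [mem_union, mem_image, hG, hDdef, mem_filter]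
      by_cases h1 : τ ≤ #(dilates R B v)
      · by_cases h2 : τ ≤ #(dilates R B (1 - v))
        · exact Or.inl ⟨hv, h1, h2⟩
        · exact Or.inr (Or.inr ⟨1 - v, ⟨hR v hv, not_le.1 h2⟩, by ring⟩)
      · exact Or.inr (Or.inl ⟨hv, not_le.1 h1⟩)
    refine (card_le_card hsub).trans ((card_union_le _ _).trans (Nat.add_le_add_left ?_ _))
    exact (card_union_le _ _).trans (Nat.add_le_add_left card_image_le _)
  have : (#R : ℝ) ≤ #G + (#D + #D) := by exact_mod_cast hcover
  linarith

theorem card_dilates_le (R B : Finset ℝ) (h0 : (0 : ℝ) ∉ B) (v : ℝ) :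
    #(dilates R B v) ≤ #{q ∈ dilates R B v | q.1 ≠ q.2.1} + #B := by
  rw [← card_filter_add_card_filter_not (s := dilates R B v) (fun q => q.1 ≠ q.2.1)]
  refine Nat.add_le_add_left (card_le_card_of_injOn Prod.fst ?_ ?_) _
  · intro q hq
    exact (mem_product.1 (mem_filter.1 (mem_filter.1 hq).1).1).1
  · rintro ⟨a, b, c⟩ hp ⟨a', b', c'⟩ hq hpq
    simp only [dilates, coe_filter, mem_filter, mem_product, ne_eq, not_not,
      Set.mem_ofPred_eq] at hp hq hpq
    obtain ⟨⟨⟨ha, hb, hc⟩, h1⟩, rfl⟩ := hp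
    obtain ⟨⟨⟨ha', hb', hc'⟩, hcancel⟩, rfl⟩ := hq
    obtain rfl := hpq
    have : a ≠ 0 := fun h => h0 (h ▸ ha)
    rw [mul_left_cancel₀ this h1, mul_left_cancel₀ this hcancel]

/-- A bound for the number of solutions of `b₂ = b₃ - (α * b₃ / b₄) * b₅` in `B`; the
coordinates of `q` are `b₃, b₄, b₅, b₂`. -/
theorem card_shifted_quotient_le (B : Finset ℝ) (h0 : (0 : ℝ) ∉ B) {α : ℝ} (hα : α ≠ 0) {E : ℕ}
    (hE : 0 < E) :
    #{q ∈ B ×ˢ B ×ˢ B ×ˢ B | q.2.2.2 = -(α * q.1 / q.2.1) * q.2.2.1 + q.1} ≤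
      #B * #B * (#B / E + #B / E + 1) + #B * E * (#B * E) * 1 := by
  have h := sum_card_line_le (B ×ˢ B) (fun c => -(α * c.1 / c.2)) (fun c => c.1) B B hE (W := 1)
    fun u v => card_le_one.2 ?_
  · rw [card_product, ← card_sigma] at h
    refine le_trans (card_le_card_of_injOn (fun q => ⟨(q.1, q.2.1), q.2.2.1⟩) ?_ ?_) h
    · rintro ⟨a, b, c, d⟩ hq
      simp only [coe_filter, mem_product, Set.mem_ofPred_eq] at hq
      obtain ⟨⟨ha, hb, hc, hd⟩, rfl⟩ := hq
      simp only [coe_sigma, Set.mem_sigma_iff, mem_coe, mem_filter, mem_product]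
      exact ⟨⟨ha, hb⟩, hc, hd⟩
    · rintro ⟨a, b, c, d⟩ hq ⟨a', b', c', d'⟩ hq' heq
      simp only [Sigma.mk.injEq, heq_eq_eq, Prod.mk.injEq] at heq
      obtain ⟨⟨rfl, rfl⟩, rfl⟩ := heq
      have e1 := (mem_filter.1 hq).2
      have e2 := (mem_filter.1 hq').2
      simp only at e1 e2
      rw [e1, e2]
  · rintro ⟨a, b⟩ hq ⟨a', b'⟩ hq'
    simp only [mem_filter, mem_product] at hq hq'
    obtain ⟨⟨ha, hb⟩, h1, h2⟩ := hq
    obtain ⟨⟨ha', hb'⟩, h1', h2'⟩ := hq'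
    have ha0 : a ≠ 0 := fun h => h0 (h ▸ ha)
    have hb0 : b ≠ 0 := fun h => h0 (h ▸ hb)
    have hb0' : b' ≠ 0 := fun h => h0 (h ▸ hb')
    obtain rfl : a = a' := h2.trans h2'.symm
    have h3 : α * a / b = α * a / b' := neg_injective (h1.trans h1'.symm)
    rw [div_eq_div_iff hb0 hb0'] at h3
    rw [Prod.mk.injEq]
    exact ⟨rfl, (mul_left_cancel₀ (mul_ne_zero hα ha0) h3).symm⟩

/-- The quintuples `(b₁, b₂, b₃, b₄, b₅)` with `b₂ ≠ b₃`, each giving rise to the affine map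
`y ↦ (b₄ / b₅) * (1 - (b₂ / b₃) * (1 - y / b₁))`. -/
noncomputable def quintuples (B : Finset ℝ) : Finset (ℝ × ℝ × ℝ × ℝ × ℝ) :=
  {c ∈ B ×ˢ B ×ˢ B ×ˢ B ×ˢ B | c.2.1 ≠ c.2.2.1}

/-- The slope of the affine map of a quintuple. -/
noncomputable def quintSlope (c : ℝ × ℝ × ℝ × ℝ × ℝ) : ℝ :=
  c.2.2.2.1 * c.2.1 / (c.2.2.2.2 * c.2.2.1 * c.1)

/-- The intercept of the affine map of a quintuple. -/
noncomputable def quintIntercept (c : ℝ × ℝ × ℝ × ℝ × ℝ) : ℝ :=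
  c.2.2.2.1 / c.2.2.2.2 * (1 - c.2.1 / c.2.2.1)

theorem card_quintuples_le (B : Finset ℝ) : #(quintuples B) ≤ #B ^ 5 := by
  refine (card_filter_le _ _).trans_eq ?_
  simp only [card_product]
  ring

theorem card_quintuples_line_le (B : Finset ℝ) (h0 : (0 : ℝ) ∉ B) {E : ℕ} (hE : 0 < E)
    (u v : ℝ) :
    #{c ∈ quintuples B | quintSlope c = u ∧ quintIntercept c = v} ≤
      #B * #B * (#B / E + #B / E + 1) + #B * E * (#B * E) * 1 := by
  have hne : ∀ b ∈ B, b ≠ 0 := fun b hb h => h0 (h ▸ hb)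
  rcases eq_or_ne v 0 with rfl | hv
  · rw [card_eq_zero.2]
    · exact Nat.zero_le _
    · refine filter_eq_empty_iff.2 ?_
      rintro ⟨b₁, b₂, b₃, b₄, b₅⟩ hc ⟨-, h⟩
      simp only [quintuples, mem_filter, mem_product] at hc
      obtain ⟨⟨h1, h2, h3, h4, h5⟩, hb⟩ := hc
      simp only [quintIntercept] at h
      have := hne _ h3
      rcases mul_eq_zero.1 h with h | h
      · exact div_ne_zero (hne _ h4) (hne _ h5) h
      · rw [sub_eq_zero, eq_comm, div_eq_one_iff_eq this] at h
        exact hb h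
  · refine le_trans (card_le_card_of_injOn
      (fun c => (c.2.2.1, c.2.2.2.1, c.2.2.2.2, c.2.1)) ?_ ?_)
      (card_shifted_quotient_le B h0 hv hE)
    · rintro ⟨b₁, b₂, b₃, b₄, b₅⟩ hc
      obtain ⟨hq, -, rfl⟩ := mem_filter.1 hc
      simp only [quintuples, mem_filter, mem_product] at hq
      obtain ⟨⟨h1, h2, h3, h4, h5⟩, hb⟩ := hq
      rw [mem_coe, mem_filter]
      simp only [mem_product, quintIntercept]
      refine ⟨⟨h3, h4, h5, h2⟩, ?_⟩
      have := hne _ h3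
      have := hne _ h4
      have := hne _ h5
      field_simp
      ring
    · rintro ⟨b₁, b₂, b₃, b₄, b₅⟩ hc ⟨c₁, c₂, c₃, c₄, c₅⟩ hc' heq
      simp only [Prod.mk.injEq] at heq
      obtain ⟨rfl, rfl, rfl, rfl⟩ := heq
      obtain ⟨hc, e, -⟩ := mem_filter.1 hc
      have e' := (mem_filter.1 hc').2.1
      simp only [quintuples, mem_filter, mem_product] at hc
      obtain ⟨⟨h1, h2, h3, h4, h5⟩, hb⟩ := hc
      have h2 := hne _ h2
      have h3 := hne _ h3
      have h4 := hne _ h4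
      have h5 := hne _ h5
      have h6 := e.trans e'.symm
      simp only [quintSlope, div_eq_mul_inv] at h6
      have h6 := inv_injective (mul_left_cancel₀ (mul_ne_zero h4 h2) h6)
      rw [mul_left_cancel₀ (mul_ne_zero h5 h3) h6]

theorem sum_card_dilates_mul_le (R B : Finset ℝ) (h0 : (0 : ℝ) ∉ B)
    (hR : ∀ x ∈ R, 1 - x ∈ R) :
    ∑ v ∈ R, #{q ∈ dilates R B v | q.1 ≠ q.2.1} * #(dilates R B (1 - v)) * #B ≤
      ∑ c ∈ quintuples B, #{y ∈ R * B | quintSlope c * y + quintIntercept c ∈ R} := by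
  have hne : ∀ b ∈ B, b ≠ 0 := fun b hb h => h0 (h ▸ hb)
  simp only [← card_product]
  rw [← card_sigma, ← card_sigma]
  refine card_le_card_of_injOn (fun p =>
    ⟨(p.2.2, p.2.1.1.1, p.2.1.1.2.1, p.2.1.2.2.1, p.2.1.2.1), (1 - p.2.1.1.2.2) * p.2.2⟩) ?_ ?_
  · rintro ⟨v, ⟨⟨b₂, b₃, x⟩, b₅, b₄, z⟩, b₁⟩ hp
    simp only [dilates, coe_sigma, Set.mem_sigma_iff, mem_coe, mem_filter, mem_product] at hp
    obtain ⟨hv, ⟨⟨⟨⟨h2, h3, hx⟩, e⟩, hb⟩, ⟨h5, h4, hz⟩, e'⟩, h1⟩ := hp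
    rw [mem_coe, mem_sigma, mem_filter]
    refine ⟨?_, mul_mem_mul (hR x hx) h1, ?_⟩
    · simp only [quintuples, mem_filter, mem_product]
      exact ⟨⟨h1, h2, h3, h4, h5⟩, hb⟩
    simp only [quintSlope, quintIntercept]
    have h1 := hne _ h1
    have h3 := hne _ h3
    have h5 := hne _ h5
    convert hz using 1
    have hz' : z = b₄ * (1 - v) / b₅ := by
      rw [eq_div_iff h5]; linear_combination e'
    have hv' : v = b₂ * x / b₃ := by
      rw [eq_div_iff h3]; linear_combination -e
    rw [hz', hv']
    field_simp
    ring
  · rintro ⟨v, ⟨⟨b₂, b₃, x⟩, b₅, b₄, z⟩, b₁⟩ hp ⟨v', ⟨⟨c₂, c₃, x'⟩, c₅, c₄, z'⟩, c₁⟩ hp' heq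
    simp only [Sigma.mk.injEq, heq_eq_eq, Prod.mk.injEq] at heq
    obtain ⟨⟨rfl, rfl, rfl, rfl, rfl⟩, hx⟩ := heq
    simp only [dilates, coe_sigma, Set.mem_sigma_iff, mem_coe, mem_filter, mem_product] at hp hp'
    obtain ⟨hv, ⟨⟨⟨⟨h2, h3, -⟩, e⟩, hb⟩, ⟨h5, h4, hz⟩, e'⟩, h1⟩ := hp
    obtain ⟨-, ⟨⟨⟨-, f⟩, -⟩, -, f'⟩, -⟩ := hp'
    obtain rfl : x = x' := by linarith [mul_right_cancel₀ (hne _ h1) hx]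
    obtain rfl : v = v' := mul_left_cancel₀ (hne _ h3) (e.symm.trans f)
    obtain rfl : z = z' := mul_left_cancel₀ (hne _ h5) (e'.trans f'.symm)
    rfl

theorem card_pow_mul_card_pow_le (R B : Finset ℝ) (hB : B.Nonempty) (h0 : (0 : ℝ) ∉ B)
    (hRne : R.Nonempty) (hR : ∀ x ∈ R, 1 - x ∈ R)
    (hlarge : 8 * (#(R * B) : ℝ) ≤ #B * #R) {D E : ℕ} (hD : 0 < D) (hE : 0 < E) :
    (#B : ℝ) ^ 5 * #R ^ 3 / (64 * #(R * B) ^ 2) ≤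
      #B ^ 5 * (#(R * B) / D + #R / D + 1) +
        #(R * B) * D * (#R * D) * (#B ^ 2 * (2 * #B / E + 1 + E ^ 2)) := by
  have hp : (0 : ℝ) < #(R * B) := by exact_mod_cast (hRne.mul hB).card_pos
  have hm : (0 : ℝ) < #B := by exact_mod_cast hB.card_pos
  have hN : (0 : ℝ) < #R := by exact_mod_cast hRne.card_pos
  set τ : ℝ := #R * (#B : ℝ) ^ 2 / (4 * #(R * B)) with hτ
  have hτ0 : 0 ≤ τ := by positivity
  have hτm : 2 * (#B : ℝ) ≤ τ := by
    rw [hτ, le_div_iff₀ (by positivity)]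
    nlinarith
  have hpop := card_le_two_mul_card_popular R B hB hR (τ := τ)
    (by rw [hτ, mul_div_cancel₀ _ (by positivity)])
  set G := {v ∈ R | τ ≤ #(dilates R B v) ∧ τ ≤ #(dilates R B (1 - v))} with hG
  have hlow : (#G : ℝ) * (τ / 2 * τ * #B) ≤
      ∑ v ∈ R, (#{q ∈ dilates R B v | q.1 ≠ q.2.1} * #(dilates R B (1 - v)) * #B : ℝ) := by
    rw [← nsmul_eq_mul]
    refine (card_nsmul_le_sum _ _ _ fun v hv => ?_).trans
      (sum_le_sum_of_subset_of_nonneg (filter_subset _ _) fun v _ _ => by positivity)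
    obtain ⟨-, h1, h2⟩ := mem_filter.1 hv
    have h3 : (#(dilates R B v) : ℝ) ≤ #{q ∈ dilates R B v | q.1 ≠ q.2.1} + #B := by
      exact_mod_cast card_dilates_le R B h0 v
    have h4 : τ / 2 ≤ #{q ∈ dilates R B v | q.1 ≠ q.2.1} := by linarith
    gcongr
  have hmid : (∑ v ∈ R, (#{q ∈ dilates R B v | q.1 ≠ q.2.1} * #(dilates R B (1 - v)) * #B : ℝ))
      ≤ ((∑ c ∈ quintuples B, #{y ∈ R * B | quintSlope c * y + quintIntercept c ∈ R} : ℕ) : ℝ) := by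
    exact_mod_cast sum_card_dilates_mul_le R B h0 hR
  have hup := sum_card_line_le (quintuples B) quintSlope quintIntercept (R * B) R hD
    (card_quintuples_line_le B h0 hE)
  have hup' : ((∑ c ∈ quintuples B,
      #{y ∈ R * B | quintSlope c * y + quintIntercept c ∈ R} : ℕ) : ℝ) ≤
      #B ^ 5 * (#(R * B) / D + #R / D + 1) +
        #(R * B) * D * (#R * D) * (#B ^ 2 * (2 * #B / E + 1 + E ^ 2)) := by
    refine (Nat.cast_le.2 hup).trans ?_
    push_cast
    have h1 : (#(quintuples B) : ℝ) ≤ #B ^ 5 := by exact_mod_cast card_quintuples_le B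
    have h2 := Nat.cast_div_le (α := ℝ) (m := #(R * B)) (n := D)
    have h3 := Nat.cast_div_le (α := ℝ) (m := #R) (n := D)
    have h4 := Nat.cast_div_le (α := ℝ) (m := #B) (n := E)
    gcongr
    calc (#B : ℝ) * #B * (((#B / E : ℕ) : ℝ) + ((#B / E : ℕ) : ℝ) + 1) + #B * E * (#B * E) * 1
        ≤ (#B : ℝ) * #B * ((#B : ℝ) / E + (#B : ℝ) / E + 1) + #B * E * (#B * E) * 1 := by gcongr
      _ = #B ^ 2 * (2 * #B / E + 1 + E ^ 2) := by ring
  refine le_trans ?_ ((hlow.trans hmid).trans hup')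
  have h5 : (#R : ℝ) / 2 * (τ / 2 * τ * #B) ≤ #G * (τ / 2 * τ * #B) := by
    gcongr
    linarith
  refine le_of_eq_of_le ?_ h5
  rw [hτ]
  field_simp
  norm_num

theorem one_sub_mem_Rset {A : Finset ℝ} {x : ℝ} (hx : x ∈ Rset A) : 1 - x ∈ Rset A := by
  simp only [Rset, mem_image, mem_filter, mem_product, Prod.exists] at hx ⊢
  obtain ⟨a, a₁, a₂, ⟨⟨ha, ha₁, ha₂⟩, hne⟩, rfl⟩ := hx
  refine ⟨a₂, a₁, a, ⟨⟨ha₂, ha₁, ha⟩, hne.symm⟩, ?_⟩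
  have h1 := sub_ne_zero.2 hne
  have h2 := sub_ne_zero.2 hne.symm
  field_simp
  ring

theorem Rset_nonempty {A : Finset ℝ} (hA : 2 ≤ #A) : (Rset A).Nonempty := by
  obtain ⟨a, ha, b, hb, hab⟩ := one_lt_card.1 hA
  have hmem : (a, a, b) ∈ A ×ˢ A ×ˢ A := mem_product.2 ⟨ha, mem_product.2 ⟨ha, hb⟩⟩
  exact ⟨_, mem_image_of_mem _ (mem_filter.2 ⟨hmem, hab.symm⟩)⟩

theorem Rset_mul_image_id_subset (A : Finset ℝ) : Rset A * A.image id ⊆ RsetMulA A := by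
  intro u hu
  obtain ⟨r, hr, w, hw, rfl⟩ := mem_mul.1 hu
  simp only [Rset, mem_image, mem_filter, mem_product, Prod.exists] at hr
  obtain ⟨a, a₁, a₂, ⟨⟨ha, ha₁, ha₂⟩, hne⟩, rfl⟩ := hr
  rw [image_id] at hw
  simp only [RsetMulA, mem_image, mem_filter, mem_product, Prod.exists]
  exact ⟨a, a₁, a₂, w, ⟨⟨ha, ha₁, ha₂, hw⟩, hne.symm⟩, by ring⟩

theorem ceil_le_two_mul {x : ℝ} (hx : 1 ≤ x) : (⌈x⌉₊ : ℝ) ≤ 2 * x := by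
  linarith [Nat.ceil_lt_add_one (show 0 ≤ x by linarith)]

/-- If `m` is comparable to `n`, `N ≥ c * n ^ 1.99` and `p ≤ n ^ 2.001`, then the inequality of
`card_pow_mul_card_pow_le` bounds `n`. -/
theorem rpow_le_of_growth {n m N p c D E : ℝ} (hn : 1 ≤ n) (hc : 0 < c) (hm : n / 2 ≤ m)
    (hmn : m ≤ n) (hN : c * n ^ (1.99 : ℝ) ≤ N) (hNp : N ≤ p) (hp : p ≤ n ^ (2.001 : ℝ))
    (hD : n ^ (0.05 : ℝ) ≤ D) (hD' : D ≤ 2 * n ^ (0.05 : ℝ))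
    (hE : n ^ (0.3 : ℝ) ≤ E) (hE' : E ≤ 2 * n ^ (0.3 : ℝ))
    (h : m ^ 5 * N ^ 3 / (64 * p ^ 2) ≤
      m ^ 5 * (p / D + N / D + 1) + p * D * (N * D) * (m ^ 2 * (2 * m / E + 1 + E ^ 2))) :
    c ^ 3 * n ^ (0.017 : ℝ) ≤ 64 * 227 := by
  have hn0 : 0 < n := by linarith
  have hx : ∀ a : ℝ, 0 < n ^ a := fun a => Real.rpow_pos_of_pos hn0 a
  have hone : ∀ a : ℝ, 0 ≤ a → 1 ≤ n ^ a := fun a ha => Real.one_le_rpow hn ha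
  have hadd : ∀ a b : ℝ, n ^ a * n ^ b = n ^ (a + b) := fun a b => (Real.rpow_add hn0 a b).symm
  have hpow : ∀ (a : ℝ) (k : ℕ), (n ^ a) ^ k = n ^ (a * k) := fun a k => by
    rw [Real.rpow_mul hn0.le, Real.rpow_natCast]
  have hm0 : 0 < m := by linarith
  have hD0 : 0 < D := (hx _).trans_le hD
  have hE0 : 0 < E := (hx _).trans_le hE
  have hN0 : 0 < N := (mul_pos hc (hx _)).trans_le hN
  have hp0 : 0 < p := hN0.trans_le hNp
  have hleft : c ^ 3 * n ^ (1.968 : ℝ) / 64 ≤ N ^ 3 / (64 * p ^ 2) := by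
    rw [div_le_div_iff₀ (by norm_num) (by positivity)]
    have h1 : p ^ 2 ≤ n ^ (4.002 : ℝ) := by
      refine (pow_le_pow_left₀ hp0.le hp 2).trans_eq ?_
      rw [hpow]; norm_num
    have h2 : c ^ 3 * n ^ (5.97 : ℝ) ≤ N ^ 3 := by
      refine le_of_eq_of_le ?_ (pow_le_pow_left₀ (mul_pos hc (hx _)).le hN 3)
      rw [mul_pow, hpow]; norm_num
    have h3 : n ^ (1.968 : ℝ) * n ^ (4.002 : ℝ) = n ^ (5.97 : ℝ) := by
      rw [hadd]; norm_num
    calc c ^ 3 * n ^ (1.968 : ℝ) * (64 * p ^ 2)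
        ≤ c ^ 3 * n ^ (1.968 : ℝ) * (64 * n ^ (4.002 : ℝ)) := by
          have := hx 1.968
          gcongr
      _ = c ^ 3 * n ^ (5.97 : ℝ) * 64 := by rw [← h3]; ring
      _ ≤ N ^ 3 * 64 := by gcongr
  have hfirst : p / D + N / D + 1 ≤ 3 * n ^ (1.951 : ℝ) := by
    have h1 : p / D ≤ n ^ (1.951 : ℝ) := by
      rw [div_le_iff₀ hD0]
      refine hp.trans ?_
      refine le_of_eq_of_le ?_ (mul_le_mul_of_nonneg_left hD (hx _).le)
      rw [hadd]; norm_num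
    have h2 : N / D ≤ p / D := by gcongr
    linarith [hone 1.951 (by norm_num)]
  have hE2 : 2 * m / E + 1 + E ^ 2 ≤ 7 * n ^ (0.7 : ℝ) := by
    have h1 : 2 * m / E ≤ 2 * n ^ (0.7 : ℝ) := by
      rw [div_le_iff₀ hE0]
      have h2 : n ^ (0.7 : ℝ) * n ^ (0.3 : ℝ) = n := by
        rw [hadd]; norm_num
      nlinarith [hx 0.7]
    have h2 : E ^ 2 ≤ 4 * n ^ (0.7 : ℝ) := by
      have h3 : (n ^ (0.3 : ℝ)) ^ 2 ≤ n ^ (0.7 : ℝ) := by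
        rw [hpow]
        exact Real.rpow_le_rpow_of_exponent_le hn (by norm_num)
      have h4 := pow_le_pow_left₀ hE0.le hE' 2
      linarith
    linarith [hone 0.7 (by norm_num)]
  have hsecond : p * D * (N * D) * (2 * m / E + 1 + E ^ 2) ≤ m ^ 3 * (224 * n ^ (1.951 : ℝ)) := by
    have h1 : p * D * (N * D) ≤ 4 * n ^ (4.102 : ℝ) := by
      have h2 : p * D ≤ n ^ (2.001 : ℝ) * (2 * n ^ (0.05 : ℝ)) := by
        have := hx 2.001
        gcongr
      have h3 : N * D ≤ p * D := by gcongr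
      have h4 : n ^ (2.001 : ℝ) * (2 * n ^ (0.05 : ℝ)) = 2 * n ^ (2.051 : ℝ) := by
        rw [mul_left_comm, hadd]; norm_num
      rw [h4] at h2
      calc p * D * (N * D) ≤ (2 * n ^ (2.051 : ℝ)) * (2 * n ^ (2.051 : ℝ)) := by
            have := hx 2.051
            exact mul_le_mul h2 (h3.trans h2) (by positivity) (by positivity)
        _ = 4 * (n ^ (2.051 : ℝ) * n ^ (2.051 : ℝ)) := by ring
        _ = 4 * n ^ (4.102 : ℝ) := by rw [hadd]; norm_num
    have h5 : n ^ (4.102 : ℝ) * n ^ (0.7 : ℝ) ≤ n ^ 3 * n ^ (1.951 : ℝ) := by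
      rw [hadd, ← Real.rpow_natCast n 3, hadd]
      exact Real.rpow_le_rpow_of_exponent_le hn (by norm_num)
    have h6 : (n / 2) ^ 3 ≤ m ^ 3 := by gcongr
    calc p * D * (N * D) * (2 * m / E + 1 + E ^ 2)
        ≤ 4 * n ^ (4.102 : ℝ) * (7 * n ^ (0.7 : ℝ)) := by
          have := hx 4.102
          gcongr
      _ = 28 * (n ^ (4.102 : ℝ) * n ^ (0.7 : ℝ)) := by ring
      _ ≤ 28 * (n ^ 3 * n ^ (1.951 : ℝ)) := by gcongr
      _ = (n / 2) ^ 3 * (224 * n ^ (1.951 : ℝ)) := by ring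
      _ ≤ m ^ 3 * (224 * n ^ (1.951 : ℝ)) := by
          have := hx 1.951
          gcongr
  have hmain : m ^ 5 * (c ^ 3 * n ^ (1.968 : ℝ) / 64) ≤ m ^ 5 * (227 * n ^ (1.951 : ℝ)) := by
    calc m ^ 5 * (c ^ 3 * n ^ (1.968 : ℝ) / 64) ≤ m ^ 5 * (N ^ 3 / (64 * p ^ 2)) := by gcongr
      _ = m ^ 5 * N ^ 3 / (64 * p ^ 2) := by ring
      _ ≤ m ^ 5 * (p / D + N / D + 1) +
          m ^ 2 * (p * D * (N * D) * (2 * m / E + 1 + E ^ 2)) := by linarith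
      _ ≤ m ^ 5 * (3 * n ^ (1.951 : ℝ)) + m ^ 2 * (m ^ 3 * (224 * n ^ (1.951 : ℝ))) := by
          gcongr
      _ = m ^ 5 * (227 * n ^ (1.951 : ℝ)) := by ring
  have h1 := le_of_mul_le_mul_left hmain (by positivity)
  have h2 : n ^ (0.017 : ℝ) * n ^ (1.951 : ℝ) = n ^ (1.968 : ℝ) := by
    rw [hadd]; norm_num
  rw [← h2] at h1
  refine le_of_mul_le_mul_right ?_ (hx 1.951)
  linarith

theorem card_Rset_mul_gt {A : Finset ℝ} {φ : ℝ → ℝ} (hφ : Function.Injective φ) (hA : 2 ≤ #A)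
    (hlarge : 64 * 227 * 400000 ^ 3 < (#A : ℝ) ^ (0.017 : ℝ)) :
    (#A : ℝ) ^ (2.001 : ℝ) < #(Rset A * A.image φ) := by
  by_contra! hle
  set n : ℝ := (#A : ℝ) with hn
  set B := (A.image φ).erase 0 with hB
  have hn2 : 2 ≤ n := by rw [hn]; exact_mod_cast hA
  have hn1 : 1 ≤ n := by linarith
  have hn0 : 0 < n := by linarith
  have himage : #(A.image φ) = #A := card_image_of_injective A hφ
  have hBcard : (#A : ℝ) ≤ #B + 1 := by
    have := pred_card_le_card_erase (s := A.image φ) (a := 0)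
    rw [himage, ← hB] at this
    exact_mod_cast (show #A ≤ #B + 1 by omega)
  have hmn : (#B : ℝ) ≤ n := by
    have : #B ≤ #A := himage ▸ card_erase_le
    rw [hn]
    exact_mod_cast this
  have hm : n / 2 ≤ #B := by linarith
  have h0 : (0 : ℝ) ∉ B := notMem_erase _ _
  have hBne : B.Nonempty := by
    rw [← card_pos]
    have : (0 : ℝ) < #B := by linarith
    exact_mod_cast this
  have hp : (#(Rset A * B) : ℝ) ≤ n ^ (2.001 : ℝ) := by
    refine le_trans ?_ hle
    exact_mod_cast card_le_card (mul_subset_mul_left (erase_subset _ _))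
  have hN : 1 / 400000 * n ^ (1.99 : ℝ) ≤ #(Rset A) := by
    linarith [card_Rset_ge A hA]
  have hNp : (#(Rset A) : ℝ) ≤ #(Rset A * B) := by
    obtain ⟨b, hb⟩ := hBne
    have hb0 : b ≠ 0 := fun h => h0 (h ▸ hb)
    have : #(Rset A) ≤ #(Rset A * B) := card_le_card_of_injOn (fun x => x * b)
      (fun x hx => mul_mem_mul hx hb) fun x _ y _ hxy => mul_right_cancel₀ hb0 hxy
    exact_mod_cast this
  have hbig : 8 * (#(Rset A * B) : ℝ) ≤ #B * #(Rset A) := by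
    have hpos : 0 < n ^ (2.001 : ℝ) := Real.rpow_pos_of_pos hn0 _
    have hmono : n ^ (0.017 : ℝ) ≤ n ^ (0.989 : ℝ) :=
      Real.rpow_le_rpow_of_exponent_le hn1 (by norm_num)
    have hsplit : n ^ (0.989 : ℝ) * n ^ (2.001 : ℝ) = n * n ^ (1.99 : ℝ) := by
      rw [← Real.rpow_add hn0, ← Real.rpow_one_add' hn0.le (by norm_num)]
      norm_num
    have hge : 6400000 * n ^ (2.001 : ℝ) ≤ n * n ^ (1.99 : ℝ) := by
      rw [← hsplit]
      refine mul_le_mul_of_nonneg_right ?_ hpos.le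
      linarith
    have hprod : n / 2 * (1 / 400000 * n ^ (1.99 : ℝ)) ≤ #B * #(Rset A) := by
      have := Real.rpow_pos_of_pos hn0 1.99
      gcongr
    linarith
  have hD1 := Real.one_le_rpow hn1 (show (0 : ℝ) ≤ 0.05 by norm_num)
  have hE1 := Real.one_le_rpow hn1 (show (0 : ℝ) ≤ 0.3 by norm_num)
  have h := card_pow_mul_card_pow_le (Rset A) B hBne h0 (Rset_nonempty hA)
    (fun x hx => one_sub_mem_Rset hx) hbig
    (Nat.ceil_pos.2 (show 0 < n ^ (0.05 : ℝ) by linarith))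
    (Nat.ceil_pos.2 (show 0 < n ^ (0.3 : ℝ) by linarith))
  have hfin := rpow_le_of_growth hn1 (by norm_num) hm hmn hN hNp hp (Nat.le_ceil _)
    (ceil_le_two_mul hD1) (Nat.le_ceil _) (ceil_le_two_mul hE1) h
  linarith

/-- for every real `κ` with `0 < κ < 2^{−16}/40` there is `c = c(κ) > 0`
such that for every injective `φ : ℝ → ℝ` and every finite `A ⊂ ℝ` with `|A| ≥ 2`,
`|R[A]·φ(A)| ≥ c|A|^{2+κ}`; in particular (taking `φ` the identity),
`|{(y−x)w/(z−x) : x,y,z,w ∈ A, x ≠ z}| ≥ c|A|^{2+κ}`. -/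
theorem stmt_19 :
    ∀ κ : ℝ, 0 < κ → κ < (2 : ℝ) ^ (-(16 : ℝ)) / 40 →
      ∃ c : ℝ, 0 < c ∧
        ∀ (φ : ℝ → ℝ), Function.Injective φ →
          ∀ A : Finset ℝ, 2 ≤ A.card →
            c * (A.card : ℝ) ^ ((2 : ℝ) + κ) ≤ ((Rset A * A.image φ).card : ℝ) ∧
            c * (A.card : ℝ) ^ ((2 : ℝ) + κ) ≤ ((RsetMulA A).card : ℝ) := by
  intro κ _ hκ
  have hκ' : κ ≤ 0.001 := by
    have : (2 : ℝ) ^ (-(16 : ℝ)) ≤ 2 ^ (0 : ℝ) :=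
      Real.rpow_le_rpow_of_exponent_le (by norm_num) (by norm_num)
    have h16 : (2 : ℝ) ^ (-(16 : ℝ)) = 1 / 65536 := by
      rw [Real.rpow_neg (by norm_num), show (16 : ℝ) = (16 : ℕ) by norm_num, Real.rpow_natCast]
      norm_num
    rw [h16] at hκ
    linarith
  obtain ⟨n₀, hn₀⟩ := Filter.eventually_atTop.1
    (((tendsto_rpow_atTop (show (0 : ℝ) < 0.017 by norm_num)).comp
      tendsto_natCast_atTop_atTop).eventually_gt_atTop (64 * 227 * 400000 ^ 3))
  set M : ℝ := ((n₀ : ℝ) + 1) ^ (2.001 : ℝ) with hM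
  have hM1 : 1 ≤ M := Real.one_le_rpow (by linarith [n₀.cast_nonneg (α := ℝ)]) (by norm_num)
  have hM0 : 0 < M := by linarith
  have main : ∀ φ : ℝ → ℝ, Function.Injective φ → ∀ A : Finset ℝ, 2 ≤ #A →
      M⁻¹ * (#A : ℝ) ^ ((2 : ℝ) + κ) ≤ #(Rset A * A.image φ) := by
    intro φ hφ A hA
    have hA1 : (1 : ℝ) ≤ #A := by exact_mod_cast (by omega : 1 ≤ #A)
    have hexp : (#A : ℝ) ^ ((2 : ℝ) + κ) ≤ (#A : ℝ) ^ (2.001 : ℝ) :=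
      Real.rpow_le_rpow_of_exponent_le hA1 (by linarith)
    rw [inv_mul_le_iff₀ hM0]
    refine hexp.trans ?_
    rcases le_total n₀ #A with hn | hn
    · have h := card_Rset_mul_gt hφ hA (hn₀ _ hn)
      nlinarith [Nat.cast_nonneg (α := ℝ) #(Rset A * A.image φ)]
    · have hne : (Rset A * A.image φ).Nonempty :=
        (Rset_nonempty hA).mul ((card_pos.1 (by omega)).image φ)
      have h1 : (1 : ℝ) ≤ #(Rset A * A.image φ) := by exact_mod_cast hne.card_pos
      have h2 : (#A : ℝ) ^ (2.001 : ℝ) ≤ M := by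
        have : (#A : ℝ) ≤ n₀ := by exact_mod_cast hn
        exact Real.rpow_le_rpow (by linarith) (by linarith) (by norm_num)
      nlinarith
  refine ⟨M⁻¹, inv_pos.2 hM0, fun φ hφ A hA => ⟨main φ hφ A hA, ?_⟩⟩
  exact (main id Function.injective_id A hA).trans
    (by exact_mod_cast card_le_card (Rset_mul_image_id_subset A))
end
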